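/- arXiv:1506.00856 — 7 statements merged into one kernel-verified Lean document; each statement's English description precedes it below -/
import Mathlib

section
/- Let D > 1 be a squarefree integer with D ≡ 1 (mod 4), and for n ≥ 1 let χ(n) = (n/D) denote the Jacobi symbol. Then there exists an entire function F : ℂ → ℂ such that F(s) = Σ_{n≥1} χ(n)·n^{−s} for all s with Re s > 1, and such that for every s ∈ ℂ for which neither s/2 nor (1−s)/2 is a nonpositive integer, π^{−s/2}·D^{s/2}·Γ(s/2)·F(s) = π^{−(1−s)/2}·D^{(1−s)/2}·Γ((1−s)/2)·F(1−s), i.e. F(1−s) = (D/π)^{s−1/2}·(Γ(s/2)/Γ((1−s)/2))·F(s). -/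
open Real Filter Set

/-- The Jacobi symbol `(· / D)` as a complex-valued function on `ZMod D`. -/
noncomputable def jacobiChar (D : ℕ) (x : ZMod D) : ℂ := (jacobiSym (x.val : ℤ) D : ℂ)

lemma jacobiChar_intCast (D : ℕ) [NeZero D] (a : ℤ) :
    jacobiChar D (a : ZMod D) = (jacobiSym a D : ℂ) := by
  rw [jacobiChar, ZMod.val_intCast, ← jacobiSym.mod_left]

lemma jacobiChar_prime (p : ℕ) [Fact p.Prime] (x : ZMod p) :
    jacobiChar p x = (quadraticChar (ZMod p) x : ℂ) := by
  obtain ⟨a, rfl⟩ := ZMod.intCast_surjective x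
  rw [jacobiChar_intCast, ← jacobiSym.legendreSym.to_jacobiSym, legendreSym]

lemma jacobiChar_mul_level {m n : ℕ} [NeZero m] [NeZero n] (h : m.Coprime n) (x : ZMod (m * n)) :
    jacobiChar (m * n) x = jacobiChar m (ZMod.chineseRemainder h x).1 *
      jacobiChar n (ZMod.chineseRemainder h x).2 := by
  obtain ⟨a, rfl⟩ := ZMod.intCast_surjective x
  rw [map_intCast, Prod.fst_intCast, Prod.snd_intCast]
  simp only [jacobiChar_intCast, jacobiSym.mul_right, Int.cast_mul]

lemma ZMod.sum_chineseRemainder {m n : ℕ} [NeZero m] [NeZero n] (h : m.Coprime n)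
    (f : ZMod m → ℂ) (g : ZMod n → ℂ) :
    ∑ x : ZMod (m * n), f (ZMod.chineseRemainder h x).1 * g (ZMod.chineseRemainder h x).2 =
      (∑ a, f a) * ∑ b, g b := by
  rw [Finset.sum_mul_sum, ← Fintype.sum_prod_type']
  exact Fintype.sum_equiv (ZMod.chineseRemainder h).toEquiv _ _ fun _ ↦ rfl

/-- A primitive additive character on `ZMod (m * n)` splits as a product of primitive characters
under the Chinese remainder isomorphism. -/
lemma AddChar.IsPrimitive.exists_chineseRemainder {m n : ℕ} (h : m.Coprime n)
    {ψ : AddChar (ZMod (m * n)) ℂ} (hψ : ψ.IsPrimitive) :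
    ∃ (ψ₁ : AddChar (ZMod m) ℂ) (ψ₂ : AddChar (ZMod n) ℂ), ψ₁.IsPrimitive ∧ ψ₂.IsPrimitive ∧
      ∀ x, ψ x = ψ₁ (ZMod.chineseRemainder h x).1 * ψ₂ (ZMod.chineseRemainder h x).2 := by
  set e := ZMod.chineseRemainder h
  refine ⟨ψ.compAddMonoidHom (e.symm.toAddMonoidHom.comp (AddMonoidHom.inl _ _)),
    ψ.compAddMonoidHom (e.symm.toAddMonoidHom.comp (AddMonoidHom.inr _ _)), ?_, ?_, ?_⟩
  · intro a ha hs
    refine hψ (a := e.symm (a, 0)) (by simpa using ha) ?_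
    ext x
    have := DFunLike.congr_fun hs (e x).1
    simp only [AddChar.mulShift_apply, AddChar.compAddMonoidHom_apply, AddChar.one_apply] at this ⊢
    rw [← this]
    congr 1
    apply e.injective
    simp [Prod.ext_iff]
  · intro a ha hs
    refine hψ (a := e.symm (0, a)) (by simpa using ha) ?_
    ext x
    have := DFunLike.congr_fun hs (e x).2
    simp only [AddChar.mulShift_apply, AddChar.compAddMonoidHom_apply, AddChar.one_apply] at this ⊢
    rw [← this]
    congr 1
    apply e.injective
    simp [Prod.ext_iff]
  · intro x
    simp only [AddChar.compAddMonoidHom_apply]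
    rw [← AddChar.map_add_eq_mul]
    congr 1
    apply e.injective
    simp

lemma sum_quadraticChar_mul_addChar {p : ℕ} [Fact p.Prime] (hp : p ≠ 2)
    {ψ : AddChar (ZMod p) ℂ} (hψ : ψ.IsPrimitive) :
    ∑ x : ZMod p, (quadraticChar (ZMod p) x : ℂ) * ψ x = ∑ x : ZMod p, ψ (x ^ 2) := by
  have h0 : ∑ x, ψ x = 0 := AddChar.sum_eq_zero_of_ne_one (by simpa using hψ one_ne_zero)
  have h1 : ∑ x : ZMod p, ψ (x ^ 2) =
      ∑ y : ZMod p, ((quadraticChar (ZMod p) y : ℂ) + 1) * ψ y := by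
    rw [← Finset.sum_fiberwise Finset.univ (fun x : ZMod p ↦ x ^ 2)]
    refine Finset.sum_congr rfl fun y _ ↦ ?_
    have hc := quadraticChar_card_sqrts (F := ZMod p) ((ZMod.ringChar_zmod_n p).substr hp) y
    rw [Finset.sum_congr rfl (g := fun _ ↦ ψ y) (by simp +contextual), Finset.sum_const,
      nsmul_eq_mul]
    congr 1
    have : ((({x : ZMod p | x ^ 2 = y} : Set (ZMod p)).toFinset.card : ℤ) : ℂ) =
      ((quadraticChar (ZMod p) y + 1 : ℤ) : ℂ) := congrArg _ hc
    push_cast at this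
    rw [← this]
    congr 2
    ext; simp
  simp [h1, add_mul, Finset.sum_add_distrib, h0]

lemma sum_quadraticChar_mul_addChar_mul {p : ℕ} [Fact p.Prime] (hp : p ≠ 2)
    (ψ : AddChar (ZMod p) ℂ) (a : ZMod p) :
    ∑ x : ZMod p, (quadraticChar (ZMod p) x : ℂ) * ψ (a * x) =
      quadraticChar (ZMod p) a * ∑ x : ZMod p, (quadraticChar (ZMod p) x : ℂ) * ψ x := by
  rcases eq_or_ne a 0 with rfl | ha
  · have := quadraticChar_sum_zero (F := ZMod p) ((ZMod.ringChar_zmod_n p).substr hp)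
    simp only [zero_mul, AddChar.map_zero_eq_one, mul_one, ← Int.cast_sum, this, MulChar.map_zero,
      Int.cast_zero]
  · have h := gaussSum_mulShift ((quadraticChar (ZMod p)).ringHomComp (Int.castRingHom ℂ)) ψ
      (Units.mk0 a ha)
    simp only [gaussSum, MulChar.ringHomComp_apply, AddChar.mulShift_apply, Units.val_mk0,
      eq_intCast] at h
    rw [← h, ← mul_assoc, ← Int.cast_mul, ← sq, quadraticChar_sq_one ha]
    simp

/-- The Gauss sum of the Jacobi symbol modulo an odd squarefree `D` is separable, and agrees with
the corresponding quadratic exponential sum. -/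
lemma sum_jacobiChar_mul_addChar {D : ℕ} (hsf : Squarefree D) (hodd : Odd D) :
    ∀ [NeZero D] {ψ : AddChar (ZMod D) ℂ}, ψ.IsPrimitive →
      ∑ x, jacobiChar D x * ψ x = ∑ x, ψ (x ^ 2) ∧
      ∀ a, ∑ x, jacobiChar D x * ψ (a * x) = jacobiChar D a * ∑ x, jacobiChar D x * ψ x := by
  induction D using Nat.recOnPosPrimePosCoprime with
  | prime_pow p n hp hn =>
    obtain rfl : n = 1 := by
      by_contra hne
      exact hne ((Nat.squarefree_pow_iff hp.ne_one hn.ne').mp hsf).2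
    rw [pow_one] at hodd ⊢
    intro _ ψ hψ
    have : Fact p.Prime := ⟨hp⟩
    have hp2 : p ≠ 2 := by rintro rfl; exact absurd hodd (by decide)
    simp only [jacobiChar_prime]
    exact ⟨sum_quadraticChar_mul_addChar hp2 hψ, sum_quadraticChar_mul_addChar_mul hp2 ψ⟩
  | zero => exact absurd hodd (by decide)
  | one =>
    intro _ ψ _
    have h (x : ZMod 1) : x = 0 := Subsingleton.elim _ _
    refine ⟨?_, fun a ↦ ?_⟩
    · simp [jacobiChar, h]
    · simp only [jacobiChar, jacobiSym.one_right, Int.cast_one, one_mul, h]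
  | coprime m n hm hn hmn ihm ihn =>
    intro _ ψ hψ
    have : NeZero m := ⟨by omega⟩
    have : NeZero n := ⟨by omega⟩
    obtain ⟨ψ₁, ψ₂, h₁, h₂, hs⟩ := hψ.exists_chineseRemainder hmn
    obtain ⟨hm₁, hm₂⟩ := ihm (hsf.squarefree_of_dvd (dvd_mul_right _ _))
      (Nat.odd_mul.mp hodd).1 h₁
    obtain ⟨hn₁, hn₂⟩ := ihn (hsf.squarefree_of_dvd (dvd_mul_left _ _))
      (Nat.odd_mul.mp hodd).2 h₂
    have key (a : ZMod (m * n)) : ∑ x, jacobiChar (m * n) x * ψ (a * x) =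
        (∑ x, jacobiChar m x * ψ₁ ((ZMod.chineseRemainder hmn a).1 * x)) *
        ∑ x, jacobiChar n x * ψ₂ ((ZMod.chineseRemainder hmn a).2 * x) := by
      rw [← ZMod.sum_chineseRemainder hmn]
      refine Finset.sum_congr rfl fun x _ ↦ ?_
      rw [jacobiChar_mul_level hmn, hs, map_mul, Prod.fst_mul, Prod.snd_mul]
      ring
    have key₁ : ∑ x, jacobiChar (m * n) x * ψ x =
        (∑ x, jacobiChar m x * ψ₁ x) * ∑ x, jacobiChar n x * ψ₂ x := by
      simpa using key 1
    refine ⟨?_, fun a ↦ ?_⟩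
    · rw [key₁, hm₁, hn₁, ← ZMod.sum_chineseRemainder hmn]
      simp [hs]
    · rw [key, key₁, hm₂, hn₂, jacobiChar_mul_level hmn]
      ring

/-- A lower bound by summation by parts against a nonnegative decreasing weight. -/
lemma sum_sub_mul_ge_of_antitone {A g : ℕ → ℝ} {M : ℝ} {k : ℕ} (hM : 0 ≤ M)
    (hA : ∀ n, A 0 - M ≤ A n) (hg : ∀ n < k, 0 ≤ g n) (hanti : ∀ n, n + 1 < k → g (n + 1) ≤ g n)
    (hg0 : 0 ≤ g 0) :
    -(M * g 0) ≤ ∑ n ∈ Finset.range k, (A (n + 1) - A n) * g n := by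
  have H : ∀ j, j + 1 ≤ k → (A (j + 1) - A 0 + M) * g j - M * g 0 ≤
      ∑ n ∈ Finset.range (j + 1), (A (n + 1) - A n) * g n := by
    intro j
    induction j with
    | zero => intro _; simp; linarith
    | succ j ih =>
      intro hj
      rw [Finset.sum_range_succ]
      have h1 := ih (by omega)
      have h2 := mul_le_mul_of_nonneg_left (hanti j (by omega))
        (show 0 ≤ A (j + 1) - A 0 + M by linarith [hA (j + 1)])
      linarith
  rcases k with _ | k
  · simpa using mul_nonneg hM hg0
  · have h1 := H k le_rfl
    have h2 := mul_nonneg (show 0 ≤ A (k + 1) - A 0 + M by linarith [hA (k + 1)])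
      (hg k (by omega))
    linarith

lemma sin_antitone_inv {x y : ℝ} (hx : 0 < x) (hxy : x ≤ y) (hy : y ≤ π / 2) :
    (sin y)⁻¹ ≤ (sin x)⁻¹ :=
  inv_anti₀ (sin_pos_of_pos_of_lt_pi hx (by linarith [pi_pos]))
    (sin_le_sin_of_le_of_le_pi_div_two (by linarith) hy hxy)

/-- Tail of the cosine sum, from `r + 1` on. -/
lemma sum_cos_sq_tail {k r N : ℕ} (hN : N = 4 * k + 1) (hr : N < 4 * (r + 1) ^ 2) :
    -√N ≤ ∑ n ∈ Finset.range (k - r), 2 * cos (2 * π * ((n + r + 1 : ℕ) : ℝ) ^ 2 / N) := by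
  rcases Nat.le_total k r with hkr | hkr
  · simp [Nat.sub_eq_zero_of_le hkr]
  rcases hkr.eq_or_lt with rfl | hkr
  · simp
  have hN0 : (0 : ℝ) < N := by rw [hN]; positivity
  have hNk : (N : ℝ) = 4 * k + 1 := by rw [hN]; push_cast; ring
  have harg (n : ℕ) (hn : n < k - r) : 2 * π * ((n + r + 1 : ℕ) : ℝ) / N ≤ π / 2 := by
    have : ((n + r + 1 : ℕ) : ℝ) ≤ k := by exact_mod_cast (by omega)
    rw [div_le_iff₀ hN0]
    nlinarith [pi_pos]
  have harg0 (n : ℕ) : 0 < 2 * π * ((n + r + 1 : ℕ) : ℝ) / N := by positivity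
  have hsin (n : ℕ) (hn : n < k - r) : 0 < sin (2 * π * ((n + r + 1 : ℕ) : ℝ) / N) :=
    sin_pos_of_pos_of_lt_pi (harg0 n) (by linarith [harg n hn, pi_pos])
  have h := sum_sub_mul_ge_of_antitone (k := k - r) (M := 2)
    (A := fun n ↦ sin (2 * π * ((n + r : ℕ) : ℝ) * ((n + r : ℕ) + 1) / N))
    (g := fun n ↦ (sin (2 * π * ((n + r + 1 : ℕ) : ℝ) / N))⁻¹) (by norm_num)
    (fun n ↦ by
      linarith [sin_le_one (2 * π * ((0 + r : ℕ) : ℝ) * ((0 + r : ℕ) + 1) / N),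
        neg_one_le_sin (2 * π * ((n + r : ℕ) : ℝ) * ((n + r : ℕ) + 1) / N)])
    (fun n hn ↦ (inv_pos.mpr (hsin n hn)).le)
    (fun n hn ↦ sin_antitone_inv (harg0 n) (by push_cast; gcongr; simp) (harg (n + 1) hn))
    (inv_pos.mpr (hsin 0 (by omega))).le
  have hsum : ∑ n ∈ Finset.range (k - r), 2 * cos (2 * π * ((n + r + 1 : ℕ) : ℝ) ^ 2 / N) =
      ∑ n ∈ Finset.range (k - r), (sin (2 * π * ((n + 1 + r : ℕ) : ℝ) * ((n + 1 + r : ℕ) + 1) / N)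
        - sin (2 * π * ((n + r : ℕ) : ℝ) * ((n + r : ℕ) + 1) / N)) *
        (sin (2 * π * ((n + r + 1 : ℕ) : ℝ) / N))⁻¹ := by
    refine Finset.sum_congr rfl fun n hn ↦ ?_
    rw [← div_eq_mul_inv, eq_div_iff (hsin n (Finset.mem_range.mp hn)).ne', sin_sub_sin]
    push_cast
    rw [mul_right_comm]
    congr 2
    · congr 1
      field_simp
      ring
    · field_simp
      ring
  rw [hsum]
  refine le_trans ?_ h
  rw [neg_le_neg_iff, ← div_eq_mul_inv, div_le_iff₀ (hsin 0 (by omega))]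
  have hj := mul_le_sin (harg0 0).le (harg 0 (by omega))
  have hs : √N < 2 * ((0 + r + 1 : ℕ) : ℝ) := by
    rw [sqrt_lt' (by positivity)]
    have : (N : ℝ) < 4 * (r + 1) ^ 2 := by exact_mod_cast hr
    push_cast
    nlinarith
  have hs0 : 0 < √(N : ℝ) := sqrt_pos.mpr hN0
  calc (2 : ℝ) ≤ √N * (2 / π * (2 * π * ((0 + r + 1 : ℕ) : ℝ) / N)) := by
        have : √N * (2 / π * (2 * π * ((0 + r + 1 : ℕ) : ℝ) / N)) =
            2 * (2 * ((0 + r + 1 : ℕ) : ℝ)) / √N := by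
          nth_rewrite 2 [← Real.mul_self_sqrt hN0.le]
          field_simp
        rw [this, le_div_iff₀ hs0]
        linarith
    _ ≤ _ := by gcongr

lemma sum_cos_sq_ge {k N : ℕ} (hN : N = 4 * k + 1) :
    -√N ≤ ∑ n ∈ Finset.range k, 2 * cos (2 * π * ((n + 1 : ℕ) : ℝ) ^ 2 / N) := by
  have hN0 : (0 : ℝ) < N := by rw [hN]; positivity
  set r := Nat.sqrt (N / 4)
  have hr1 : 4 * r ^ 2 ≤ N := by
    have : r ^ 2 ≤ N / 4 := Nat.sqrt_le' _
    omega
  have hr2 : N < 4 * (r + 1) ^ 2 := by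
    have : N / 4 < (r + 1) ^ 2 := Nat.lt_succ_sqrt' _
    omega
  have hrk : r ≤ k := by nlinarith
  obtain ⟨d, rfl⟩ := Nat.exists_eq_add_of_le hrk
  rw [Finset.sum_range_add]
  have h1 : 0 ≤ ∑ n ∈ Finset.range r, 2 * cos (2 * π * ((n + 1 : ℕ) : ℝ) ^ 2 / N) := by
    refine Finset.sum_nonneg fun n hn ↦ ?_
    have hle : 4 * ((n + 1 : ℕ) : ℝ) ^ 2 ≤ N := by
      have : n + 1 ≤ r := Finset.mem_range.mp hn
      have : 4 * (n + 1) ^ 2 ≤ N := le_trans (by gcongr) hr1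
      exact_mod_cast this
    refine mul_nonneg (by norm_num) (cos_nonneg_of_neg_pi_div_two_le_of_le ?_ ?_)
    · exact le_trans (by linarith [pi_pos]) (show (0 : ℝ) ≤ _ by positivity)
    · rw [div_le_iff₀ hN0]
      nlinarith [pi_pos]
  have h2 := sum_cos_sq_tail hN hr2
  rw [Nat.add_sub_cancel_left] at h2
  have h3 : ∑ n ∈ Finset.range d, 2 * cos (2 * π * ((n + r + 1 : ℕ) : ℝ) ^ 2 / N) =
      ∑ n ∈ Finset.range d, 2 * cos (2 * π * ((r + n + 1 : ℕ) : ℝ) ^ 2 / N) := by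
    simp only [add_comm r]
  linarith

lemma sum_sin_odd_sq_ge {k N : ℕ} (hN : N = 4 * k + 1) (hk : 0 < k) :
    -1 < ∑ j ∈ Finset.range k, 2 * sin (π * (2 * (j : ℝ) + 1) ^ 2 / (2 * N)) := by
  have hN0 : (0 : ℝ) < N := by rw [hN]; positivity
  have hNk : (N : ℝ) = 4 * k + 1 := by rw [hN]; push_cast; ring
  have hk1 : (1 : ℝ) ≤ k := by exact_mod_cast hk
  have harg (n : ℕ) (hn : n < k) : π * (2 * (n : ℝ) + 1) / N ≤ π / 2 := by
    have : (n : ℝ) + 1 ≤ k := by exact_mod_cast hn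
    rw [div_le_iff₀ hN0]
    nlinarith [pi_pos]
  have harg0 (n : ℕ) : 0 < π * (2 * (n : ℝ) + 1) / N := by positivity
  have hsin (n : ℕ) (hn : n < k) : 0 < sin (π * (2 * (n : ℝ) + 1) / N) :=
    sin_pos_of_pos_of_lt_pi (harg0 n) (by linarith [harg n hn, pi_pos])
  have h := sum_sub_mul_ge_of_antitone (k := k) (M := 1 - cos (π / (2 * N)))
    (A := fun n ↦ -cos (π * (4 * (n : ℝ) ^ 2 - 1) / (2 * N)))
    (g := fun n ↦ (sin (π * (2 * (n : ℝ) + 1) / N))⁻¹) (by linarith [cos_le_one (π / (2 * N))])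
    (fun n ↦ by
      have : π * (4 * ((0 : ℕ) : ℝ) ^ 2 - 1) / (2 * N) = -(π / (2 * N)) := by
        push_cast; ring
      simp only [this, cos_neg]
      linarith [cos_le_one (π * (4 * (n : ℝ) ^ 2 - 1) / (2 * N))])
    (fun n hn ↦ (inv_pos.mpr (hsin n hn)).le)
    (fun n hn ↦ sin_antitone_inv (harg0 n) (by push_cast; gcongr; simp) (harg (n + 1) hn))
    (inv_pos.mpr (hsin 0 hk)).le
  have hsum : ∑ j ∈ Finset.range k, 2 * sin (π * (2 * (j : ℝ) + 1) ^ 2 / (2 * N)) =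
      ∑ n ∈ Finset.range k, (-cos (π * (4 * ((n + 1 : ℕ) : ℝ) ^ 2 - 1) / (2 * N)) -
        -cos (π * (4 * (n : ℝ) ^ 2 - 1) / (2 * N))) * (sin (π * (2 * (n : ℝ) + 1) / N))⁻¹ := by
    refine Finset.sum_congr rfl fun n hn ↦ ?_
    rw [← div_eq_mul_inv, eq_div_iff (hsin n (Finset.mem_range.mp hn)).ne', neg_sub_neg,
      cos_sub_cos, ← neg_sub (π * (4 * ((n + 1 : ℕ) : ℝ) ^ 2 - 1) / (2 * N)), neg_div, sin_neg]
    push_cast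
    rw [mul_neg, neg_mul, neg_mul, neg_neg]
    congr 2
    · congr 1
      field_simp
      ring
    · field_simp
      ring
  rw [hsum]
  refine lt_of_lt_of_le ?_ h
  rw [neg_lt_neg_iff, ← div_eq_mul_inv, div_lt_one (hsin 0 hk)]
  have hx : π * (2 * ((0 : ℕ) : ℝ) + 1) / N = 2 * (π / (2 * N)) := by
    push_cast; field_simp; ring
  have hx1 : π / (2 * N) < π / 3 := by gcongr; linarith
  have hx0 : 0 < π / (2 * N) := by positivity
  rw [hx, sin_two_mul]
  have hc : 1 / 2 < cos (π / (2 * N)) := by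
    rw [← cos_pi_div_three]
    exact cos_lt_cos_of_nonneg_of_le_pi hx0.le (by linarith [pi_pos]) hx1
  have hs : 0 < sin (π / (2 * N)) := sin_pos_of_pos_of_lt_pi hx0 (by linarith [pi_pos])
  nlinarith [sin_sq_add_cos_sq (π / (2 * N)), sin_le_one (π / (2 * N)), cos_le_one (π / (2 * N))]

/-- The quadratic cosine sum modulo `N ≡ 1 mod 4` is larger than `-√N`. -/
lemma neg_sqrt_lt_sum_cos_sq {k N : ℕ} (hN : N = 4 * k + 1) (hk : 0 < k) :
    -√N < ∑ n ∈ Finset.range N, cos (2 * π * (n : ℝ) ^ 2 / N) := by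
  have hN0 : (N : ℝ) ≠ 0 := by rw [hN]; positivity
  set c : ℕ → ℝ := fun n ↦ cos (2 * π * (n : ℝ) ^ 2 / N) with hc
  have hsymm (n : ℕ) (hn : n ≤ N) : c (N - n) = c n := by
    simp only [hc, Nat.cast_sub hn]
    rw [← cos_add_int_mul_two_pi (2 * π * (n : ℝ) ^ 2 / N) ((N : ℤ) - 2 * n)]
    congr 1
    push_cast
    field_simp
    ring
  have hodd (j : ℕ) (hj : j < k) : c (2 * k - j) = sin (π * (2 * (j : ℝ) + 1) ^ 2 / (2 * N)) := by
    simp only [hc]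
    rw [← cos_pi_div_two_sub, ← cos_neg (π / 2 - _),
      ← cos_add_int_mul_two_pi (-(π / 2 - _)) ((k : ℤ) - j)]
    congr 1
    rw [Nat.cast_sub (by omega)]
    have : (N : ℝ) = 4 * k + 1 := by rw [hN]; push_cast; ring
    push_cast
    field_simp
    rw [this]
    ring
  have hsplit : ∑ n ∈ Finset.range N, c n =
      c 0 + ∑ n ∈ Finset.range (2 * k), 2 * c (n + 1) := by
    rw [hN, Finset.sum_range_succ', add_comm, show 4 * k = 2 * k + 2 * k by ring,
      Finset.sum_range_add, ← Finset.sum_range_reflect (fun n ↦ c (2 * k + n + 1)),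
      ← Finset.sum_add_distrib]
    congr 1
    refine Finset.sum_congr rfl fun n hn ↦ ?_
    have hn := Finset.mem_range.mp hn
    rw [show 2 * k + (2 * k - 1 - n) + 1 = N - (n + 1) by omega, hsymm _ (by omega)]
    ring
  have hsplit2 : ∑ n ∈ Finset.range (2 * k), 2 * c (n + 1) =
      ∑ n ∈ Finset.range k, 2 * c (n + 1) +
      ∑ j ∈ Finset.range k, 2 * sin (π * (2 * (j : ℝ) + 1) ^ 2 / (2 * N)) := by
    rw [two_mul k, Finset.sum_range_add, ← Finset.sum_range_reflect (fun n ↦ 2 * c (k + n + 1))]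
    congr 1
    refine Finset.sum_congr rfl fun j hj ↦ ?_
    have hj := Finset.mem_range.mp hj
    rw [← hodd j hj, show k + (k - 1 - j) + 1 = 2 * k - j by omega]
  have h0 : c 0 = 1 := by simp [hc]
  have h1 := sum_cos_sq_ge hN
  have h2 := sum_sin_odd_sq_ge hN hk
  rw [hsplit, hsplit2, h0]
  simp only [hc]
  linarith

lemma jacobiChar_neg {D : ℕ} [NeZero D] (hmod : D % 4 = 1) (x : ZMod D) :
    jacobiChar D (-x) = jacobiChar D x := by
  obtain ⟨a, rfl⟩ := ZMod.intCast_surjective x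
  rw [← Int.cast_neg, jacobiChar_intCast, jacobiChar_intCast,
    jacobiSym.neg a (Nat.odd_iff.mpr (by omega)), ZMod.χ₄_nat_one_mod_four hmod, one_mul]

lemma jacobiChar_zero {D : ℕ} (hD : 1 < D) : jacobiChar D 0 = 0 := by
  simp [jacobiChar, jacobiSym.zero_left hD]

lemma re_stdAddChar_natCast_sq (N : ℕ) [NeZero N] (n : ℕ) :
    (ZMod.stdAddChar ((n : ZMod N) ^ 2)).re = cos (2 * π * (n : ℝ) ^ 2 / N) := by
  have h := ZMod.stdAddChar_coe (N := N) ((n : ℤ) ^ 2)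
  push_cast at h
  rw [h, show 2 * (π : ℂ) * Complex.I * (n : ℂ) ^ 2 / N =
    ((2 * π * (n : ℝ) ^ 2 / N : ℝ) : ℂ) * Complex.I by push_cast; ring,
    Complex.exp_ofReal_mul_I_re]

/-- **Gauss's sign theorem** for the Jacobi symbol of squarefree modulus `D ≡ 1 mod 4`, stated
through the discrete Fourier transform. -/
lemma dft_jacobiChar {D : ℕ} [NeZero D] (hD : 1 < D) (hsf : Squarefree D) (hmod : D % 4 = 1) :
    ZMod.dft (jacobiChar D) = fun k ↦ (√D : ℂ) * jacobiChar D k := by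
  obtain ⟨hsq, hsep⟩ := sum_jacobiChar_mul_addChar hsf (Nat.odd_iff.mpr (by omega))
    (ZMod.isPrimitive_stdAddChar D)
  set G := ∑ x, jacobiChar D x * ZMod.stdAddChar x
  have hdft : ZMod.dft (jacobiChar D) = fun k ↦ G * jacobiChar D k := by
    funext k
    rw [ZMod.dft_apply, ← jacobiChar_neg hmod k, mul_comm G, ← hsep (-k)]
    refine Finset.sum_congr rfl fun x _ ↦ ?_
    rw [smul_eq_mul, mul_comm, neg_mul, mul_comm x]
  have hG2 : G ^ 2 = (√D : ℂ) ^ 2 := by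
    have h := congrFun (ZMod.dft_dft (jacobiChar D)) 1
    rw [hdft, ZMod.dft_const_mul, hdft] at h
    have h1 : jacobiChar D 1 = 1 := by simpa using jacobiChar_intCast D 1
    simp only [jacobiChar_neg hmod, h1, smul_eq_mul, mul_one] at h
    rw [sq, h, ← Complex.ofReal_pow, Real.sq_sqrt (Nat.cast_nonneg D), Complex.ofReal_natCast]
  have hre : -√D < G.re := by
    have hsum : G.re = ∑ n ∈ Finset.range D, cos (2 * π * (n : ℝ) ^ 2 / D) := by
      rw [hsq, Complex.re_sum]
      symm
      refine Finset.sum_bij (fun n _ ↦ (n : ZMod D)) (fun _ _ ↦ Finset.mem_univ _) ?_ ?_ ?_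
      · intro a ha b hb hab
        rw [← ZMod.val_cast_of_lt (Finset.mem_range.mp ha), hab,
          ZMod.val_cast_of_lt (Finset.mem_range.mp hb)]
      · exact fun b _ ↦ ⟨b.val, Finset.mem_range.mpr (ZMod.val_lt b), ZMod.natCast_zmod_val b⟩
      · exact fun n _ ↦ (re_stdAddChar_natCast_sq D n).symm
    rw [hsum]
    exact neg_sqrt_lt_sum_cos_sq (k := D / 4) (by omega) (by omega)
  rcases sq_eq_sq_iff_eq_or_eq_neg.mp hG2 with h | h
  · rw [hdft, h]
  · rw [h, Complex.neg_re, Complex.ofReal_re] at hre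
    exact absurd hre (lt_irrefl _)

lemma sum_jacobiChar {D : ℕ} [NeZero D] (hD : 1 < D) (hsf : Squarefree D) (hmod : D % 4 = 1) :
    ∑ x, jacobiChar D x = 0 := by
  rw [← ZMod.dft_apply_zero, dft_jacobiChar hD hsf hmod]
  simp only [jacobiChar_zero hD, mul_zero]

/-- For squarefree `D > 1` with `D ≡ 1 (mod 4)`, the Dirichlet series
`Σ_{n≥1} (n/D)·n^{−s}` (Jacobi symbol coefficients) extends to an entire function `F`
satisfying the functional equation
`π^{−s/2}·D^{s/2}·Γ(s/2)·F(s) = π^{−(1−s)/2}·D^{(1−s)/2}·Γ((1−s)/2)·F(1−s)`. -/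
theorem jacobi_Lfunction_entire_and_functional_equation
    (D : ℕ) (hD : 1 < D) (hsf : Squarefree D) (hmod : D % 4 = 1) :
    ∃ F : ℂ → ℂ, Differentiable ℂ F ∧
      (∀ s : ℂ, 1 < s.re →
        F s = ∑' n : ℕ, (jacobiSym ((n : ℤ) + 1) D : ℂ) * (((n : ℕ) + 1 : ℕ) : ℂ) ^ (-s)) ∧
      (∀ s : ℂ, (∀ k : ℕ, s / 2 ≠ -(k : ℂ)) → (∀ k : ℕ, (1 - s) / 2 ≠ -(k : ℂ)) →
        (π : ℂ) ^ (-s / 2) * (D : ℂ) ^ (s / 2) * Complex.Gamma (s / 2) * F s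
          = (π : ℂ) ^ (-(1 - s) / 2) * (D : ℂ) ^ ((1 - s) / 2) *
              Complex.Gamma ((1 - s) / 2) * F (1 - s)) := by
  have : NeZero D := ⟨by omega⟩
  have hD0 : (D : ℂ) ≠ 0 := NeZero.ne _
  have hsum := sum_jacobiChar hD hsf hmod
  have heven : (jacobiChar D).Even := jacobiChar_neg hmod
  have hzero := jacobiChar_zero hD
  refine ⟨ZMod.LFunction (jacobiChar D), ZMod.differentiable_LFunction_of_sum_zero hsum,
    fun s hs ↦ ?_, fun s hs hs' ↦ ?_⟩
  · have hsummable := ZMod.LSeriesSummable_of_one_lt_re (jacobiChar D) hs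
    rw [ZMod.LFunction_eq_LSeries _ hs, LSeries, hsummable.tsum_eq_zero_add, LSeries.term_zero,
      zero_add]
    refine tsum_congr fun n ↦ ?_
    have h := jacobiChar_intCast D ((n : ℤ) + 1)
    push_cast at h
    rw [LSeries.term_of_ne_zero n.succ_ne_zero, Complex.cpow_neg, ← div_eq_mul_inv, ← h]
    push_cast
    rfl
  · have hΓ {t : ℂ} (ht : ∀ k : ℕ, t / 2 ≠ -(k : ℂ)) :
        (π : ℂ) ^ (-t / 2) * Complex.Gamma (t / 2) * ZMod.LFunction (jacobiChar D) t =
          ZMod.completedLFunction (jacobiChar D) t := by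
      have hne : Complex.Gammaℝ t ≠ 0 := by
        rw [Ne, Complex.Gammaℝ_eq_zero_iff]
        rintro ⟨k, hk⟩
        exact ht k (by rw [hk]; ring)
      rw [ZMod.LFunction_eq_completed_div_gammaFactor_even heven t (.inr hzero),
        ← Complex.Gammaℝ_def, mul_div_cancel₀ _ hne]
    have hfe := ZMod.completedLFunction_one_sub_even heven s (.inr hsum) (.inr hzero)
    rw [dft_jacobiChar hD hsf hmod, ZMod.completedLFunction_const_mul] at hfe
    have hsqrt : ((√D : ℝ) : ℂ) = (D : ℂ) ^ (1 / 2 : ℂ) := by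
      rw [Real.sqrt_eq_rpow, Complex.ofReal_cpow (Nat.cast_nonneg D)]
      push_cast
      rfl
    calc _ = (D : ℂ) ^ (s / 2) * ZMod.completedLFunction (jacobiChar D) s := by
          rw [← hΓ hs]; ring
      _ = (D : ℂ) ^ ((1 - s) / 2) * ZMod.completedLFunction (jacobiChar D) (1 - s) := by
          rw [hfe, hsqrt, ← mul_assoc, ← mul_assoc, ← Complex.cpow_add _ _ hD0, mul_assoc,
            ← mul_assoc, ← Complex.cpow_add _ _ hD0]
          ring_nf
      _ = _ := by rw [← hΓ hs']; ring
end

section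
/- Let β denote the entire function which for Re s > 1 equals the Dirichlet series Σ_{n≥0} (−1)^n·(2n+1)^{−s} (the L-function of the unique nontrivial Dirichlet character modulo 4). Then for every s ∈ ℂ that is not a nonpositive integer, β(1−s) = (2/π)^s·Γ(s)·sin(πs/2)·β(s). -/
open Real Filter Set

open ZMod in
/-- The discrete Fourier transform of the nontrivial character modulo 4 is `-2 * I` times itself. -/
lemma dft_chi_four (k : ZMod 4) :
    ZMod.dft (fun j : ZMod 4 ↦ ((χ₄ j : ℤ) : ℂ)) k = -2 * Complex.I * ((χ₄ k : ℤ) : ℂ) := by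
  have h0 : (stdAddChar (0 : ZMod 4) : ℂ) = 1 := AddChar.map_zero_eq_one _
  have h1 : (stdAddChar (1 : ZMod 4) : ℂ) = Complex.I := by
    have := stdAddChar_coe (N := 4) 1
    rw [Int.cast_one] at this
    rw [this]
    refine Eq.trans ?_ Complex.exp_pi_div_two_mul_I
    congr 1
    push_cast
    ring
  have h2 : (stdAddChar (2 : ZMod 4) : ℂ) = -1 := by
    rw [show (2 : ZMod 4) = 1 + 1 by decide, AddChar.map_add_eq_mul, h1, Complex.I_mul_I]
  have h3 : (stdAddChar (3 : ZMod 4) : ℂ) = -Complex.I := by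
    rw [show (3 : ZMod 4) = 2 + 1 by decide, AddChar.map_add_eq_mul, h1, h2, neg_one_mul]
  have c0 : χ₄ 0 = 0 := by decide
  have c1 : χ₄ 1 = 1 := by decide
  have c2 : χ₄ 2 = 0 := by decide
  have c3 : χ₄ 3 = -1 := by decide
  have hsum (f : ZMod 4 → ℂ) : ∑ j, f j = f 0 + f 1 + f 2 + f 3 := Fin.sum_univ_four f
  rw [dft_apply, hsum, c0, c1, c2, c3]
  have hk : k = 0 ∨ k = 1 ∨ k = 2 ∨ k = 3 := by revert k; decide
  rcases hk with rfl | rfl | rfl | rfl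
  · simp [c0]
  · rw [show -((1 : ZMod 4) * 1) = 3 by decide, show -((3 : ZMod 4) * 1) = 1 by decide, h1, h3, c1]
    simp
    ring
  · rw [show -((1 : ZMod 4) * 2) = 2 by decide, show -((3 : ZMod 4) * 2) = 2 by decide, h2, c2]
    simp
  · rw [show -((1 : ZMod 4) * 3) = 1 by decide, show -((3 : ZMod 4) * 3) = 3 by decide, h1, h3, c3]
    simp
    ring

lemma chi_four_two_mul_add_one (n : ℕ) :
    ZMod.χ₄ ((2 * n + 1 : ℕ) : ZMod 4) = (-1) ^ n := by
  rw [ZMod.χ₄_eq_neg_one_pow (by omega)]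
  congr 1
  omega

/-- The L-function of the nontrivial character modulo 4 as a sum over odd integers. -/
lemma LFunction_chi_four_eq_tsum {s : ℂ} (hs : 1 < s.re) :
    ZMod.LFunction (fun j : ZMod 4 ↦ ((ZMod.χ₄ j : ℤ) : ℂ)) s =
      ∑' n : ℕ, (-1 : ℂ) ^ n * ((2 * n + 1 : ℕ) : ℂ) ^ (-s) := by
  have hinj : Function.Injective fun n : ℕ ↦ 2 * n + 1 := fun a b h ↦ by
    simpa using h
  rw [ZMod.LFunction_eq_LSeries _ hs, LSeries, ← hinj.tsum_eq]
  · refine tsum_congr fun n ↦ ?_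
    rw [LSeries.term_of_ne_zero (by omega), chi_four_two_mul_add_one, Complex.cpow_neg,
      div_eq_mul_inv]
    push_cast
    rfl
  · intro n hn
    rcases Nat.even_or_odd' n with ⟨m, rfl | rfl⟩
    · refine absurd ?_ hn
      rw [LSeries.term_def, ZMod.χ₄_nat_eq_if_mod_four]
      simp
    · exact ⟨m, rfl⟩

/-- An entire function given by the Dirichlet beta series for `1 < re s` is the L-function of the
nontrivial character modulo 4. -/
lemma eq_LFunction_chi_four {β : ℂ → ℂ} (hβ : Differentiable ℂ β)
    (hser : ∀ s : ℂ, 1 < s.re →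
      β s = ∑' n : ℕ, (-1 : ℂ) ^ n * ((2 * n + 1 : ℕ) : ℂ) ^ (-s)) :
    β = ZMod.LFunction (fun j : ZMod 4 ↦ ((ZMod.χ₄ j : ℤ) : ℂ)) := by
  have hsum : ∑ j : ZMod 4, ((ZMod.χ₄ j : ℤ) : ℂ) = 0 := by
    exact_mod_cast (by decide : ∑ j : ZMod 4, ZMod.χ₄ j = 0)
  refine AnalyticOnNhd.eq_of_eventuallyEq (z₀ := 2)
    (fun z _ ↦ hβ.analyticAt z)
    (fun z _ ↦ (ZMod.differentiable_LFunction_of_sum_zero hsum).analyticAt z) ?_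
  filter_upwards [(isOpen_lt continuous_const Complex.continuous_re).mem_nhds
    (show (1 : ℝ) < (2 : ℂ).re by norm_num)] with s hs
  rw [hser s hs, LFunction_chi_four_eq_tsum hs]

lemma LFunction_const_mul {N : ℕ} [NeZero N] (a : ℂ) (Φ : ZMod N → ℂ) (s : ℂ) :
    ZMod.LFunction (fun j ↦ a * Φ j) s = a * ZMod.LFunction Φ s := by
  simp only [ZMod.LFunction, mul_assoc, ← Finset.mul_sum]
  ring

/-- Let `β` be the entire function which for `Re s > 1` equals
`Σ_{n≥0} (−1)^n·(2n+1)^{−s}` (the Dirichlet beta function). Then for every `s` that is not a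
nonpositive integer, `β(1−s) = (2/π)^s·Γ(s)·sin(πs/2)·β(s)`. -/
theorem dirichlet_beta_functional_equation (β : ℂ → ℂ) (hβ : Differentiable ℂ β)
    (hser : ∀ s : ℂ, 1 < s.re →
      β s = ∑' n : ℕ, (-1 : ℂ) ^ n * ((2 * n + 1 : ℕ) : ℂ) ^ (-s)) :
    ∀ s : ℂ, (∀ k : ℕ, s ≠ -(k : ℂ)) →
      β (1 - s) = (2 / (π : ℂ)) ^ s * Complex.Gamma s * Complex.sin ((π : ℂ) * s / 2) * β s := by
  intro s hs
  rw [eq_LFunction_chi_four hβ hser]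
  have hneg : (fun j : ZMod 4 ↦ ((ZMod.χ₄ (-j) : ℤ) : ℂ)) =
      fun j ↦ -((ZMod.χ₄ j : ℤ) : ℂ) := by
    have h : ∀ j : ZMod 4, ZMod.χ₄ (-j) = -ZMod.χ₄ j := by decide
    funext j
    rw [h, Int.cast_neg]
  have hdft : ZMod.dft (fun j : ZMod 4 ↦ ((ZMod.χ₄ j : ℤ) : ℂ)) =
      fun k ↦ -2 * Complex.I * ((ZMod.χ₄ k : ℤ) : ℂ) := funext dft_chi_four
  have hdft' : ZMod.dft (fun j : ZMod 4 ↦ ((ZMod.χ₄ (-j) : ℤ) : ℂ)) =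
      fun k ↦ 2 * Complex.I * ((ZMod.χ₄ k : ℤ) : ℂ) := by
    rw [hneg, show (fun j : ZMod 4 ↦ -((ZMod.χ₄ j : ℤ) : ℂ)) =
      -(fun j : ZMod 4 ↦ ((ZMod.χ₄ j : ℤ) : ℂ)) from rfl, map_neg, hdft]
    funext k
    simp
  rw [ZMod.LFunction_one_sub _ hs (Or.inl (by simp)), hdft, hdft',
    LFunction_const_mul, LFunction_const_mul]
  have hπ : (π : ℂ) ≠ 0 := Complex.ofReal_ne_zero.mpr Real.pi_ne_zero
  have hpow : ((4 : ℕ) : ℂ) ^ (s - 1) * (2 * (π : ℂ)) ^ (-s) = (2 / (π : ℂ)) ^ s / 4 := by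
    have h4 : ((4 : ℕ) : ℂ) ^ s = (2 / (π : ℂ)) ^ s * (2 * (π : ℂ)) ^ s := by
      have := Complex.mul_cpow_ofReal_nonneg (a := 2 / π) (b := 2 * π) (by positivity)
        (by positivity) s
      push_cast at this
      rw [← this]
      congr 1
      push_cast
      field_simp
      norm_num
    have h2π : (2 * (π : ℂ)) ^ s ≠ 0 := by simp [Complex.cpow_eq_zero_iff, hπ]
    rw [Complex.cpow_sub _ _ (by norm_num), Complex.cpow_one, Complex.cpow_neg, h4]
    field_simp
    norm_num
  rw [hpow, Complex.sin, show (π : ℂ) * Complex.I * s / 2 = π * s / 2 * Complex.I by ring,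
    show -(π : ℂ) * Complex.I * s / 2 = -(π * s / 2) * Complex.I by ring]
  ring
end

section
/- The Riemann zeta function has infinitely many zeros on the critical line: the set { t ∈ ℝ | ζ(1/2 + it) = 0 } is infinite. -/
open Complex

section

open MeasureTheory Set Filter Topology Real Asymptotics ComplexConjugate

lemma integrableOn_rpow_mul_exp_neg_mul {a b : ℝ} (ha : -1 < a) (hb : 0 < b) :
    IntegrableOn (fun t : ℝ ↦ t ^ a * Real.exp (-b * t)) (Ioi 0) := by
  simpa using integrableOn_rpow_mul_exp_neg_mul_rpow (p := 1) ha zero_lt_one hb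

lemma norm_cpow_mul_cexp_neg_mul {s r : ℂ} {t : ℝ} (ht : 0 < t) :
    ‖(t : ℂ) ^ s * cexp (-(r * t))‖ = t ^ s.re * Real.exp (-r.re * t) := by
  rw [norm_mul, norm_cpow_eq_rpow_re_of_pos ht, norm_exp]
  simp

lemma aestronglyMeasurable_cpow_mul_cexp (s r : ℂ) :
    AEStronglyMeasurable (fun t : ℝ ↦ (t : ℂ) ^ s * cexp (-(r * t)))
      (volume.restrict (Ioi 0)) := by
  refine ContinuousOn.aestronglyMeasurable (fun t ht ↦ ?_) measurableSet_Ioi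
  have : (t : ℂ) ∈ slitPlane := ofReal_mem_slitPlane.mpr ht
  refine ContinuousAt.continuousWithinAt (ContinuousAt.mul ?_ (by fun_prop))
  exact ContinuousAt.cpow (by fun_prop) (by fun_prop) this

lemma integrableOn_cpow_mul_cexp {s r : ℂ} (hs : 0 < s.re) (hr : 0 < r.re) :
    IntegrableOn (fun t : ℝ ↦ (t : ℂ) ^ (s - 1) * cexp (-(r * t))) (Ioi 0) := by
  refine Integrable.mono' (integrableOn_rpow_mul_exp_neg_mul (a := s.re - 1) (b := r.re)
    (by linarith) hr) (aestronglyMeasurable_cpow_mul_cexp _ _) ?_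
  filter_upwards [ae_restrict_mem measurableSet_Ioi] with t ht
  rw [norm_cpow_mul_cexp_neg_mul ht]
  simp

lemma differentiableAt_integral_cpow_mul_cexp {s r : ℂ} (hs : 0 < s.re) (hr : 0 < r.re) :
    DifferentiableAt ℂ (fun r : ℂ ↦ ∫ t in Ioi (0 : ℝ), (t : ℂ) ^ (s - 1) * cexp (-(r * t))) r := by
  have hU : {z : ℂ | r.re / 2 < z.re} ∈ 𝓝 r :=
    (isOpen_lt continuous_const continuous_re).mem_nhds (by simpa using hr)
  refine (hasDerivAt_integral_of_dominated_loc_of_deriv_le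
    (F := fun (r : ℂ) (t : ℝ) ↦ (t : ℂ) ^ (s - 1) * cexp (-(r * t)))
    (F' := fun r t ↦ -((t : ℂ) ^ s * cexp (-(r * t))))
    (bound := fun t ↦ t ^ s.re * Real.exp (-(r.re / 2) * t)) hU
    (.of_forall fun z ↦ aestronglyMeasurable_cpow_mul_cexp _ _)
    (integrableOn_cpow_mul_cexp hs hr) (aestronglyMeasurable_cpow_mul_cexp _ _).neg ?_
    (integrableOn_rpow_mul_exp_neg_mul (by linarith) (by linarith)) ?_).2.differentiableAt
  · filter_upwards [ae_restrict_mem measurableSet_Ioi] with t ht z hz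
    rw [norm_neg, norm_cpow_mul_cexp_neg_mul ht]
    have : (0 : ℝ) < t := ht
    have : r.re / 2 < z.re := hz
    gcongr
  · filter_upwards [ae_restrict_mem measurableSet_Ioi] with t ht z hz
    have ht' : (t : ℂ) ≠ 0 := ofReal_ne_zero.mpr (ne_of_gt ht)
    have := (((hasDerivAt_id z).mul_const (t : ℂ)).fun_neg.cexp).const_mul ((t : ℂ) ^ (s - 1))
    refine this.congr_deriv ?_
    rw [cpow_sub _ _ ht', cpow_one]
    simp
    field_simp

/-- The Gamma integral along a ray in the right half-plane. -/
lemma integral_cpow_mul_cexp_neg_mul {s r : ℂ} (hs : 0 < s.re) (hr : 0 < r.re) :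
    ∫ t in Ioi (0 : ℝ), (t : ℂ) ^ (s - 1) * cexp (-(r * t)) = r ^ (-s) * Complex.Gamma s := by
  have hopen : IsOpen {z : ℂ | 0 < z.re} := isOpen_lt continuous_const continuous_re
  have hconn : IsPreconnected {z : ℂ | 0 < z.re} := (convex_halfSpace_re_gt 0).isPreconnected
  have h1 : AnalyticOnNhd ℂ (fun r : ℂ ↦ ∫ t in Ioi (0 : ℝ),
      (t : ℂ) ^ (s - 1) * cexp (-(r * t))) {z : ℂ | 0 < z.re} :=
    DifferentiableOn.analyticOnNhd (fun z hz ↦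
      (differentiableAt_integral_cpow_mul_cexp hs hz).differentiableWithinAt) hopen
  have h2 : AnalyticOnNhd ℂ (fun r : ℂ ↦ r ^ (-s) * Complex.Gamma s) {z : ℂ | 0 < z.re} := by
    refine DifferentiableOn.analyticOnNhd (fun z hz ↦ ?_) hopen
    have : z ∈ slitPlane := .inl hz
    exact ((differentiableAt_id.cpow_const this).mul_const _).differentiableWithinAt
  refine h1.eqOn_of_preconnected_of_frequently_eq h2 hconn (z₀ := 1) (by simp) ?_ hr
  have hreal : ∀ x : ℝ, 0 < x → ∫ t in Ioi (0 : ℝ), (t : ℂ) ^ (s - 1) * cexp (-((x : ℂ) * t)) =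
      (x : ℂ) ^ (-s) * Complex.Gamma s := by
    intro x hx
    rw [integral_cpow_mul_exp_neg_mul_Ioi hs hx, one_div, inv_cpow _ _ (by
      rw [arg_ofReal_of_nonneg hx.le]; exact pi_pos.ne), cpow_neg]
  have htend : Tendsto (fun x : ℝ ↦ (x : ℂ)) (𝓝[≠] 1) (𝓝[≠] 1) := by
    refine tendsto_nhdsWithin_of_tendsto_nhds_of_eventually_within _ ?_ ?_
    · exact (continuous_ofReal.tendsto' 1 1 (by simp)).mono_left nhdsWithin_le_nhds
    · filter_upwards [self_mem_nhdsWithin] with x hx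
      simpa using hx
  refine htend.frequently (Eventually.frequently ?_)
  filter_upwards [mem_nhdsWithin_of_mem_nhds (lt_mem_nhds (zero_lt_one' ℝ))] with x hx
  exact hreal x hx

lemma ofReal_mul_cpow {a : ℝ} (ha : 0 < a) {w : ℂ} (hw : w ≠ 0) (s : ℂ) :
    ((a : ℂ) * w) ^ s = (a : ℂ) ^ s * w ^ s := by
  have ha' : (a : ℂ) ≠ 0 := ofReal_ne_zero.mpr ha.ne'
  rw [cpow_def_of_ne_zero (mul_ne_zero ha' hw), cpow_def_of_ne_zero ha', cpow_def_of_ne_zero hw,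
    log_ofReal_mul ha hw, ← Complex.exp_add, ofReal_log ha.le, add_mul]

lemma ne_zero_of_re_pos' {w : ℂ} (hw : 0 < w.re) : w ≠ 0 := by
  rintro rfl
  simp at hw

lemma inv_re_pos {w : ℂ} (hw : 0 < w.re) : 0 < w⁻¹.re := by
  rw [inv_re]
  exact div_pos hw (normSq_pos.mpr (ne_zero_of_re_pos' hw))

/-- Jacobi's theta function in the variable `w` of the right half-plane,
`∑ n : ℤ, exp (-π n ^ 2 w)`. -/
noncomputable def rightTheta (w : ℂ) : ℂ := jacobiTheta (I * w)

lemma rightTheta_inv {w : ℂ} (hw : 0 < w.re) :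
    rightTheta w⁻¹ = w ^ (1 / 2 : ℂ) * rightTheta w := by
  have hw0 := ne_zero_of_re_pos' hw
  have h := jacobiTheta₂_functional_equation 0 (I * w)
  rw [← jacobiTheta_eq_jacobiTheta₂] at h
  have e1 : -I * (I * w) = w := by rw [← mul_assoc]; simp
  have e2 : -1 / (I * w) = I * w⁻¹ := by
    field_simp
    simp
  rw [e1, e2, zero_div, ← jacobiTheta_eq_jacobiTheta₂] at h
  have hc : w ^ (1 / 2 : ℂ) ≠ 0 := by simp [cpow_eq_zero_iff, hw0]
  rw [rightTheta, rightTheta, h]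
  simp only [ne_eq, OfNat.ofNat_ne_zero, not_false_eq_true, zero_pow, mul_zero, zero_div,
    Complex.exp_zero, mul_one]
  field_simp

lemma continuousAt_rightTheta {w : ℂ} (hw : 0 < w.re) : ContinuousAt rightTheta w := by
  have : ContinuousAt jacobiTheta (I * w) := continuousAt_jacobiTheta (by simpa using hw)
  exact ContinuousAt.comp (f := fun w ↦ I * w) this (by fun_prop)

lemma tendsto_rightTheta_one : Tendsto rightTheta (comap re atTop) (𝓝 1) := by
  have h1 : Tendsto (fun w : ℂ ↦ I * w) (comap re atTop) (comap im atTop) := by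
    rw [tendsto_comap_iff]
    refine tendsto_comap.congr fun w ↦ by simp
  have h2 : Tendsto (fun τ : ℂ ↦ rexp (-π * τ.im)) (comap im atTop) (𝓝 0) := by
    have : Tendsto (fun y : ℝ ↦ rexp (-π * y)) atTop (𝓝 0) :=
      Real.tendsto_exp_atBot.comp (tendsto_id.const_mul_atTop_of_neg (neg_lt_zero.mpr pi_pos))
    exact this.comp tendsto_comap
  have h3 := (isBigO_at_im_infty_jacobiTheta_sub_one.trans_tendsto h2).comp h1
  simpa using! h3.add_const 1

lemma rightTheta_mul_sub_one_isBigO {w : ℂ} (hw : 0 < w.re) (r : ℝ) :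
    (fun x : ℝ ↦ rightTheta (w * x) - 1) =O[atTop] (· ^ r) := by
  have h1 : Tendsto (fun x : ℝ ↦ I * (w * x)) atTop (comap im atTop) := by
    rw [tendsto_comap_iff]
    refine (tendsto_id.const_mul_atTop hw).congr fun x ↦ by simp
  refine (isBigO_at_im_infty_jacobiTheta_sub_one.comp_tendsto h1).trans ?_
  have : (fun x : ℝ ↦ rexp (-(π * w.re) * x)) =o[atTop] (· ^ r) :=
    isLittleO_exp_neg_mul_rpow_atTop (by positivity) r
  refine this.isBigO.congr_left fun x ↦ ?_
  simp [mul_assoc]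

lemma continuousAt_rightTheta_mul {w : ℂ} (hw : 0 < w.re) {x : ℝ} (hx : 0 < x) :
    ContinuousAt (fun x : ℝ ↦ rightTheta (w * x)) x :=
  ContinuousAt.comp (f := fun x : ℝ ↦ w * x)
    (continuousAt_rightTheta (by simpa using mul_pos hw hx)) (by fun_prop)

lemma locallyIntegrableOn_rightTheta_mul {w : ℂ} (hw : 0 < w.re) :
    LocallyIntegrableOn (fun x : ℝ ↦ rightTheta (w * x)) (Ioi 0) :=
  ContinuousOn.locallyIntegrableOn
    (fun _ hx ↦ (continuousAt_rightTheta_mul hw hx).continuousWithinAt) measurableSet_Ioi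

/-- The functions `x ↦ θ (w x)` and `x ↦ θ (x / w)` as a weak FE-pair. -/
noncomputable def rightThetaPair {w : ℂ} (hw : 0 < w.re) : WeakFEPair ℂ where
  f x := rightTheta (w * x)
  g x := rightTheta (w⁻¹ * x)
  k := 1 / 2
  ε := w⁻¹ ^ (1 / 2 : ℂ)
  f₀ := 1
  g₀ := 1
  hf_int := locallyIntegrableOn_rightTheta_mul hw
  hg_int := locallyIntegrableOn_rightTheta_mul (inv_re_pos hw)
  hk := by norm_num
  hε := by simp [cpow_eq_zero_iff, ne_zero_of_re_pos' hw]
  h_feq x hx := by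
    have hx : (0 : ℝ) < x := hx
    have hw' := inv_re_pos hw
    have h := rightTheta_inv (w := x * w⁻¹) (by simpa using mul_pos hx hw')
    rw [ofReal_mul_cpow hx (ne_zero_of_re_pos' hw'), mul_inv, inv_inv] at h
    rw [smul_eq_mul, ofReal_cpow hx.le, mul_comm w⁻¹ (x : ℂ)]
    simp only [one_div, ofReal_inv, mul_comm w, ofReal_ofNat] at h ⊢
    rw [h]
    ring
  hf_top := rightTheta_mul_sub_one_isBigO hw
  hg_top := rightTheta_mul_sub_one_isBigO (inv_re_pos hw)

lemma hasSum_rightTheta {w : ℂ} (hw : 0 < w.re) :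
    HasSum (fun n : ℕ ↦ 2 * cexp (-(π * (n + 1) ^ 2 * w))) (rightTheta w - 1) := by
  have h := (hasSum_nat_jacobiTheta (τ := I * w) (by simpa using hw)).mul_left 2
  rw [mul_div_cancel₀ _ (two_ne_zero' ℂ)] at h
  refine h.congr_fun fun n ↦ ?_
  congr 2
  linear_combination (-π * (n + 1) ^ 2 * w) * I_mul_I

lemma mellin_rightTheta_mul_sub_one {w s : ℂ} (hw : 0 < w.re) (hs : 1 / 2 < s.re) :
    mellin (fun x : ℝ ↦ rightTheta (w * x) - 1) s =
      2 * (w ^ (-s) * completedRiemannZeta (2 * s)) := by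
  have hs0 : 0 < s.re := by linarith
  have hw0 := ne_zero_of_re_pos' hw
  have hr (n : ℕ) : 0 < (π * (n + 1) ^ 2 * w : ℂ).re := by
    have : (π * (n + 1) ^ 2 * w : ℂ) = (π * (n + 1) ^ 2 : ℝ) * w := by push_cast; ring
    rw [this, re_ofReal_mul]
    positivity
  have hterm (n : ℕ) : ∫ t in Ioi (0 : ℝ), (t : ℂ) ^ (s - 1) *
      (2 * cexp (-(π * (n + 1) ^ 2 * w * t))) =
      2 * w ^ (-s) * (π ^ (-s) * Complex.Gamma s) * (1 / ((n : ℂ) + 1) ^ (2 * s)) := by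
    simp_rw [mul_left_comm _ (2 : ℂ)]
    rw [integral_const_mul, integral_cpow_mul_cexp_neg_mul hs0 (hr n)]
    have e : (π * (n + 1) ^ 2 * w : ℂ) = (π : ℝ) * (((n + 1 : ℝ) * ((n + 1 : ℝ) * w) : ℂ)) := by
      push_cast; ring
    have hn : (0 : ℝ) < n + 1 := by positivity
    have hn' : ((n + 1 : ℝ) : ℂ) ≠ 0 := ofReal_ne_zero.mpr hn.ne'
    rw [e, ofReal_mul_cpow pi_pos (mul_ne_zero hn' (mul_ne_zero hn' hw0)),
      ofReal_mul_cpow hn (mul_ne_zero hn' hw0),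
      ofReal_mul_cpow hn hw0, two_mul s, cpow_add _ _ (by exact_mod_cast hn'), one_div, mul_inv,
      cpow_neg ((n + 1 : ℝ) : ℂ)]
    push_cast
    ring
  have hsum : HasSum (fun n : ℕ ↦ ∫ t in Ioi (0 : ℝ), (t : ℂ) ^ (s - 1) *
      (2 * cexp (-(π * (n + 1) ^ 2 * w * t))))
      (mellin (fun x : ℝ ↦ rightTheta (w * x) - 1) s) := by
    have heq : mellin (fun x : ℝ ↦ rightTheta (w * x) - 1) s = ∫ t in Ioi (0 : ℝ),
        ∑' n : ℕ, (t : ℂ) ^ (s - 1) * (2 * cexp (-(π * (n + 1) ^ 2 * w * t))) := by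
      refine setIntegral_congr_fun measurableSet_Ioi fun t ht ↦ ?_
      have ht : (0 : ℝ) < t := ht
      have := hasSum_rightTheta (w := w * t) (by simpa using mul_pos hw ht)
      simp only [smul_eq_mul]
      rw [← this.tsum_eq, ← tsum_mul_left]
      simp only [mul_assoc]
    rw [heq]
    refine hasSum_integral_of_summable_integral_norm (fun n ↦ ?_) ?_
    · simp_rw [mul_left_comm _ (2 : ℂ)]
      exact (integrableOn_cpow_mul_cexp hs0 (hr n)).const_mul 2
    · have hnorm (n : ℕ) : ∫ t in Ioi (0 : ℝ), ‖(t : ℂ) ^ (s - 1) *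
          (2 * cexp (-(π * (n + 1) ^ 2 * w * t)))‖ =
          (2 * (1 / (π * w.re)) ^ s.re * Real.Gamma s.re) * (1 / ((n + 1 : ℕ) : ℝ) ^ (2 * s.re)) := by
        have e : (π * (n + 1) ^ 2 * w : ℂ).re = π * w.re * (n + 1) ^ 2 := by
          have : (π * (n + 1) ^ 2 * w : ℂ) = (π * (n + 1) ^ 2 : ℝ) * w := by push_cast; ring
          rw [this, re_ofReal_mul]
          ring
        have : ∫ t in Ioi (0 : ℝ), ‖(t : ℂ) ^ (s - 1) *
            (2 * cexp (-(π * (n + 1) ^ 2 * w * t)))‖ = ∫ t in Ioi (0 : ℝ),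
            2 * (t ^ (s.re - 1) * rexp (-((π * (n + 1) ^ 2 * w : ℂ).re * t))) := by
          refine setIntegral_congr_fun measurableSet_Ioi fun t ht ↦ ?_
          simp only [mul_left_comm _ (2 : ℂ)]
          rw [norm_mul, norm_cpow_mul_cexp_neg_mul ht, Complex.norm_two, neg_mul, sub_re, one_re]
        rw [this, integral_const_mul, Real.integral_rpow_mul_exp_neg_mul_Ioi hs0 (hr n), e,
          ← one_div_mul_one_div, Real.mul_rpow (by positivity) (by positivity),
          Real.rpow_mul (by positivity), Real.rpow_two,
          Real.div_rpow zero_le_one (by positivity : (0 : ℝ) ≤ (n + 1) ^ 2), Real.one_rpow]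
        push_cast
        ring
      simp_rw [hnorm]
      exact (((summable_nat_add_iff 1).mpr
        (Real.summable_one_div_nat_rpow.mpr (by linarith : 1 < 2 * s.re)))).mul_left _
  have h2s : 1 < (2 * s).re := by simp; linarith
  rw [← hsum.tsum_eq]
  simp_rw [hterm]
  rw [tsum_mul_left, ← zeta_eq_tsum_one_div_nat_add_one_cpow h2s,
    completedZeta_eq_tsum_of_one_lt_re h2s, zeta_eq_tsum_one_div_nat_cpow h2s]
  have : -(2 * s) / 2 = -s := by ring
  rw [this, mul_div_cancel_left₀ _ (two_ne_zero' ℂ)]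
  ring

/-- Inside the strip `0 < re s < k`, the function `Λ` of a weak FE-pair is a Mellin transform. -/
lemma WeakFEPair.hasMellin_of_re_lt (P : WeakFEPair ℂ) {s : ℂ} (hs : 0 < s.re)
    (hs' : s.re < P.k) :
    HasMellin (fun x : ℝ ↦ P.f x - P.f₀ - P.ε * (x ^ (-P.k) : ℝ) * P.g₀) s (P.Λ s) := by
  have h1 : HasMellin P.f_modif s (P.Λ₀ s) := by
    have := P.isStrongFEPair_toStrongFEPair.hasMellin s
    rwa [P.isStrongFEPair_toStrongFEPair.Λ_eq] at this
  have h2 := hasMellin_one_Ioc hs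
  have h3 : HasMellin ((Ioi 1).indicator fun x : ℝ ↦ (x : ℂ) ^ (-P.k : ℂ)) s (1 / (P.k - s)) := by
    have hlt : (s - 1 - P.k).re < -1 := by simp; linarith
    have hi := integrableOn_Ioi_cpow_of_lt hlt zero_lt_one
    have hv := integral_Ioi_cpow_of_lt hlt zero_lt_one
    have e : EqOn (fun x : ℝ ↦ (x : ℂ) ^ (s - 1 - P.k))
        (fun x : ℝ ↦ (x : ℂ) ^ (s - 1) • (x : ℂ) ^ (-P.k : ℂ)) (Ioi 1) := by
      intro x hx
      have : (x : ℂ) ≠ 0 := ofReal_ne_zero.mpr (zero_lt_one.trans hx).ne'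
      simp only [smul_eq_mul]
      rw [sub_eq_add_neg, cpow_add _ _ this]
    simp_rw [HasMellin, mellin, MellinConvergent, ← indicator_smul]
    rw [IntegrableOn, integrable_indicator_iff measurableSet_Ioi, IntegrableOn,
      setIntegral_indicator measurableSet_Ioi, Measure.restrict_restrict measurableSet_Ioi,
      Ioi_inter_Ioi, Ioi_inter_Ioi, sup_of_le_left zero_le_one, sup_of_le_right zero_le_one]
    refine ⟨hi.congr_fun e measurableSet_Ioi, ?_⟩
    rw [← setIntegral_congr_fun measurableSet_Ioi e, hv]
    simp only [ofReal_one, one_cpow]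
    rw [← neg_sub s, one_div, div_eq_mul_inv, ← neg_inv]
    ring_nf
  have h2' := hasMellin_const_smul h2.1 P.f₀
  have h3' := hasMellin_const_smul h3.1 (P.ε * P.g₀)
  have h4 := hasMellin_sub h1.1 h2'.1
  have h5 := hasMellin_sub h4.1 h3'.1
  have e : ∀ᵐ x : ℝ ∂(volume.restrict (Ioi 0)),
      P.f x - P.f₀ - P.ε * (x ^ (-P.k) : ℝ) * P.g₀ = P.f_modif x
        - P.f₀ • (Ioc 0 1).indicator (fun _ : ℝ ↦ (1 : ℂ)) x
        - (P.ε * P.g₀) • (Ioi 1).indicator (fun x : ℝ ↦ (x : ℂ) ^ (-P.k : ℂ)) x := by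
    have hne : ∀ᵐ x : ℝ ∂(volume.restrict (Ioi 0)), x ≠ 1 :=
      ae_restrict_of_ae (by simp [ae_iff])
    filter_upwards [hne, ae_restrict_mem measurableSet_Ioi] with x hx1 hx0
    have hx0 : 0 < x := hx0
    rcases lt_or_gt_of_ne hx1 with hx | hx
    · simp [WeakFEPair.f_modif, hx, hx.le, hx0, hx.not_gt]
      ring
    · simp [WeakFEPair.f_modif, hx, hx.not_ge, hx0, hx.not_gt, ofReal_cpow hx0.le]
      ring
  have e' : ∀ᵐ x : ℝ ∂(volume.restrict (Ioi 0)), _ :=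
    e.mono fun x hx ↦ congr_arg (fun z ↦ (x : ℂ) ^ (s - 1) • z) hx
  refine ⟨(integrable_congr e').mpr h5.1, ?_⟩
  rw [mellin, integral_congr_ae e']
  refine h5.2.trans ?_
  rw [h4.2, h3'.2, h2'.2, h1.2, h2.2, h3.2, WeakFEPair.Λ]
  simp only [smul_eq_mul]
  ring

lemma rightThetaPair_Λ {w s : ℂ} (hw : 0 < w.re) (hs : s ≠ 0) (hs' : s ≠ 1 / 2) :
    (rightThetaPair hw).Λ s = 2 * (w ^ (-s) * completedRiemannZeta (2 * s)) := by
  have hopen : IsOpen ({0, 1 / 2}ᶜ : Set ℂ) := (Set.toFinite _).isClosed.isOpen_compl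
  have hconn : IsPreconnected ({0, 1 / 2}ᶜ : Set ℂ) :=
    ((Set.toFinite _).countable.isPathConnected_compl_of_one_lt_rank
      (by simp)).isConnected.isPreconnected
  have hk : (((rightThetaPair hw).k : ℝ) : ℂ) = 1 / 2 := by simp [rightThetaPair]
  have h1 : AnalyticOnNhd ℂ (rightThetaPair hw).Λ {0, 1 / 2}ᶜ := by
    refine DifferentiableOn.analyticOnNhd (fun z hz ↦ ?_) hopen
    simp only [mem_compl_iff, mem_insert_iff, mem_singleton_iff, not_or] at hz
    exact ((rightThetaPair hw).differentiableAt_Λ (.inl hz.1)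
      (.inl (hk ▸ hz.2))).differentiableWithinAt
  have h2 : AnalyticOnNhd ℂ (fun s ↦ 2 * (w ^ (-s) * completedRiemannZeta (2 * s)))
      {0, 1 / 2}ᶜ := by
    refine DifferentiableOn.analyticOnNhd (fun z hz ↦ ?_) hopen
    simp only [mem_compl_iff, mem_insert_iff, mem_singleton_iff, not_or] at hz
    refine DifferentiableAt.differentiableWithinAt (((differentiableAt_id.fun_neg.const_cpow
      (.inl (ne_zero_of_re_pos' hw))).mul ?_).const_mul _)
    refine DifferentiableAt.comp (f := fun z ↦ 2 * z) z
      (differentiableAt_completedZeta (by simpa using hz.1) fun h ↦ hz.2 ?_) (by fun_prop)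
    linear_combination h / 2
  refine h1.eqOn_of_preconnected_of_eventuallyEq h2 hconn (z₀ := 1) (by simp) ?_
    (by simpa [hs] using hs' : s ∈ ({0, 1 / 2}ᶜ : Set ℂ))
  have : {z : ℂ | 1 / 2 < z.re} ∈ 𝓝 (1 : ℂ) :=
    (isOpen_lt continuous_const continuous_re).mem_nhds (by norm_num)
  filter_upwards [this] with z hz
  rw [← mellin_rightTheta_mul_sub_one hw hz]
  exact ((rightThetaPair hw).hasMellin hz).2.symm

/-- The theta function with its singular parts at `0` and `∞` removed. -/
noncomputable def strippedTheta (w : ℂ) (x : ℝ) : ℂ :=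
  rightTheta (w * x) - 1 - w⁻¹ ^ (1 / 2 : ℂ) * (x ^ (-(1 / 2) : ℝ) : ℝ)

lemma hasMellin_strippedTheta {w s : ℂ} (hw : 0 < w.re) (hs : 0 < s.re) (hs' : s.re < 1 / 2) :
    HasMellin (strippedTheta w) s (2 * (w ^ (-s) * completedRiemannZeta (2 * s))) := by
  rw [← rightThetaPair_Λ hw (by rintro rfl; simp at hs) (by rintro rfl; norm_num at hs')]
  have := (rightThetaPair hw).hasMellin_of_re_lt hs hs'
  convert this using 2
  simp [strippedTheta, rightThetaPair]

lemma exists_norm_completedRiemannZeta_le {w : ℂ} (hw : 0 < w.re) :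
    ∃ C : ℝ, ∀ y : ℝ, ‖w ^ (-(1 / 4 + y * I : ℂ)) *
      completedRiemannZeta (1 / 2 + (2 * y : ℝ) * I)‖ ≤ C := by
  refine ⟨∫ x in Ioi (0 : ℝ), ‖(x : ℂ) ^ ((1 / 4 : ℂ) - 1) • strippedTheta w x‖, fun y ↦ ?_⟩
  have h := (hasMellin_strippedTheta (s := 1 / 4 + y * I) hw (by simp) (by norm_num)).2
  have e : 2 * (1 / 4 + y * I : ℂ) = 1 / 2 + (2 * y : ℝ) * I := by push_cast; ring
  rw [e] at h
  have h2 : ‖w ^ (-(1 / 4 + y * I : ℂ)) * completedRiemannZeta (1 / 2 + (2 * y : ℝ) * I)‖ ≤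
      ‖mellin (strippedTheta w) (1 / 4 + y * I)‖ := by
    rw [h, norm_mul 2, Complex.norm_two]
    linarith [norm_nonneg (w ^ (-(1 / 4 + y * I : ℂ)) *
      completedRiemannZeta (1 / 2 + (2 * y : ℝ) * I))]
  refine h2.trans ((norm_integral_le_integral_norm _).trans_eq ?_)
  refine setIntegral_congr_fun measurableSet_Ioi fun x hx ↦ ?_
  simp only [norm_smul]
  rw [norm_cpow_eq_rpow_re_of_pos hx, norm_cpow_eq_rpow_re_of_pos hx]
  simp

lemma hasSum_int_rightTheta {w : ℂ} (hw : 0 < w.re) :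
    HasSum (fun n : ℤ ↦ cexp (-(π * n ^ 2 * w))) (rightTheta w) := by
  have h := hasSum_jacobiTheta₂_term 0 (τ := I * w) (by simpa using hw)
  rw [← jacobiTheta_eq_jacobiTheta₂] at h
  refine h.congr_fun fun n ↦ ?_
  rw [jacobiTheta₂_term]
  congr 1
  linear_combination (-π * n ^ 2 * w) * I_mul_I

lemma rightTheta_add_two_mul_I (w : ℂ) : rightTheta (w + 2 * I) = rightTheta w := by
  rw [rightTheta, rightTheta, ← jacobiTheta_two_add]
  congr 1
  linear_combination 2 * I_mul_I

lemma rightTheta_add_I {w : ℂ} (hw : 0 < w.re) :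
    rightTheta (w + I) = 2 * rightTheta (4 * w) - rightTheta w := by
  have h1 := (hasSum_int_rightTheta (w := w + I) (by simpa using hw)).add (hasSum_int_rightTheta hw)
  have h2 := (hasSum_int_rightTheta (w := 4 * w) (by simpa using hw)).mul_left 2
  have hinj : Function.Injective fun n : ℤ ↦ 2 * n := fun a b h ↦ by simpa using h
  rw [eq_sub_iff_add_eq]
  refine h1.unique ((hinj.hasSum_iff ?_).mp (h2.congr_fun fun n ↦ ?_))
  · intro n hn
    rcases Int.even_or_odd' n with ⟨m, rfl | rfl⟩
    · exact absurd ⟨m, rfl⟩ hn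
    · have : -(π * ((2 * m + 1 : ℤ) : ℂ) ^ 2 * (w + I)) =
          -(π * ((2 * m + 1 : ℤ) : ℂ) ^ 2 * w) - π * I + (-(2 * m ^ 2 + 2 * m) : ℤ) * (2 * π * I) := by
        push_cast
        ring
      rw [this, Complex.exp_add, exp_int_mul_two_pi_mul_I, Complex.exp_sub, exp_pi_mul_I]
      ring
  · have : -(π * ((2 * n : ℤ) : ℂ) ^ 2 * (w + I)) =
        -(π * ((2 * n : ℤ) : ℂ) ^ 2 * w) + (-(2 * n ^ 2) : ℤ) * (2 * π * I) := by
      push_cast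
      ring
    simp only [Function.comp_apply]
    rw [this, Complex.exp_add, exp_int_mul_two_pi_mul_I]
    push_cast
    ring_nf

lemma ofReal_mul_cpow_half_mul_rightTheta {a : ℝ} (ha : 0 < a) {v : ℂ} (hv : 0 < v.re) :
    v ^ (1 / 2 : ℂ) * rightTheta (a * v) =
      ((a : ℂ) ^ (1 / 2 : ℂ))⁻¹ * rightTheta ((a⁻¹ : ℝ) * v⁻¹) := by
  have h := rightTheta_inv (w := a * v) (by simpa using mul_pos ha hv)
  rw [ofReal_mul_cpow ha (ne_zero_of_re_pos' hv)] at h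
  have : (a : ℂ) ^ (1 / 2 : ℂ) ≠ 0 := by simp [cpow_eq_zero_iff, ha.ne']
  rw [ofReal_inv, ← mul_inv, h]
  field_simp

lemma tendsto_rightTheta_mul_inv {ι : Type*} {l : Filter ι} {v : ι → ℂ}
    (hv : Tendsto (fun i ↦ (v i)⁻¹.re) l atTop) {a : ℝ} (ha : 0 < a) :
    Tendsto (fun i ↦ rightTheta (a * (v i)⁻¹)) l (𝓝 1) := by
  refine tendsto_rightTheta_one.comp (tendsto_comap_iff.mpr ?_)
  refine (hv.const_mul_atTop ha).congr fun i ↦ ?_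
  rw [Function.comp_apply, re_ofReal_mul]

lemma four_cpow_half : ((4 : ℝ) : ℂ) ^ (1 / 2 : ℂ) = 2 := by
  have h : (4 : ℝ) ^ (1 / 2 : ℝ) = 2 := by
    rw [show (4 : ℝ) = 2 ^ (2 : ℝ) by norm_num, ← Real.rpow_mul (by norm_num)]
    norm_num
  rw [show (1 / 2 : ℂ) = ((1 / 2 : ℝ) : ℂ) by norm_num, ← ofReal_cpow (by norm_num), h,
    ofReal_ofNat]

/-- At the cusp `I` the theta function is small compared to its size at the cusp `2 * I`. -/
lemma not_exists_norm_rightTheta_le {ι : Type*} {l : Filter ι} [l.NeBot] {v : ι → ℂ}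
    (hv : ∀ᶠ i in l, 0 < (v i).re) (hv0 : Tendsto v l (𝓝 0))
    (hv' : Tendsto (fun i ↦ (v i)⁻¹.re) l atTop) (C : ℝ) :
    ¬ ∀ᶠ i in l, ‖rightTheta (2 * (v i + I))‖ ≤ ‖rightTheta (v i + I)‖ + C := by
  intro h
  have hz : Tendsto (fun i ↦ v i ^ (1 / 2 : ℂ)) l (𝓝 0) := by
    have : Tendsto (fun i ↦ ‖v i‖ ^ (1 / 2 : ℝ)) l (𝓝 0) := by
      simpa using hv0.norm.rpow_const (p := 1 / 2) (.inr (by norm_num))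
    refine tendsto_zero_iff_norm_tendsto_zero.mpr (this.congr' ?_)
    filter_upwards [hv] with i hi
    have := norm_cpow_of_ne_zero (ne_zero_of_re_pos' hi) (1 / 2)
    rw [this]
    simp
  have h1 : Tendsto (fun i ↦ ‖v i ^ (1 / 2 : ℂ) * rightTheta (2 * (v i + I))‖) l
      (𝓝 ‖((2 : ℝ) : ℂ) ^ (1 / 2 : ℂ)‖⁻¹) := by
    have := ((tendsto_rightTheta_mul_inv hv' (inv_pos.mpr two_pos)).const_mul
      (((2 : ℝ) : ℂ) ^ (1 / 2 : ℂ))⁻¹).norm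
    rw [mul_one, norm_inv] at this
    refine this.congr' ?_
    filter_upwards [hv] with i hi
    rw [← ofReal_mul_cpow_half_mul_rightTheta two_pos hi, mul_add, rightTheta_add_two_mul_I,
      ofReal_ofNat]
  have h2 : Tendsto (fun i ↦ ‖v i ^ (1 / 2 : ℂ) * rightTheta (v i + I)‖) l (𝓝 0) := by
    have ha := tendsto_rightTheta_mul_inv hv' (inv_pos.mpr (by norm_num : (0 : ℝ) < 4))
    have hb := tendsto_rightTheta_mul_inv hv' (inv_pos.mpr one_pos)
    have := (ha.sub hb).norm
    rw [sub_self, norm_zero] at this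
    refine this.congr' ?_
    filter_upwards [hv] with i hi
    have e1 := ofReal_mul_cpow_half_mul_rightTheta (by norm_num : (0 : ℝ) < 4) hi
    have e2 := ofReal_mul_cpow_half_mul_rightTheta one_pos hi
    rw [four_cpow_half] at e1
    rw [ofReal_one, one_cpow, inv_one, one_mul, one_mul] at e2
    rw [rightTheta_add_I hi, mul_sub, e2, mul_left_comm, ← ofReal_ofNat 4, e1]
    ring_nf
  have h3 := h2.add (hz.norm.mul_const C)
  rw [norm_zero, zero_mul, add_zero] at h3
  have h4 := le_of_tendsto_of_tendsto h1 h3 <| h.mono fun i hi ↦ by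
    simp only [norm_mul, ← mul_add]
    gcongr
  have : (0 : ℝ) < ‖((2 : ℝ) : ℂ) ^ (1 / 2 : ℂ)‖⁻¹ := by
    rw [norm_cpow_eq_rpow_re_of_pos two_pos]
    positivity
  exact absurd h4 this.not_ge

lemma tendsto_inv_exp_sub_I :
    Tendsto (fun β : ℝ ↦ (cexp (β * I) - I)⁻¹.re) (𝓝[<] (π / 2)) atTop := by
  have hc : Tendsto (fun β : ℝ ↦ (Real.cos β)⁻¹ / 2) (𝓝[<] (π / 2)) atTop := by
    refine Tendsto.atTop_div_const two_pos (Tendsto.inv_tendsto_nhdsGT_zero ?_)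
    exact Real.tendsto_cos_pi_div_two
  refine tendsto_atTop_mono' _ ?_ hc
  filter_upwards [Ioo_mem_nhdsLT (show (0 : ℝ) < π / 2 by positivity)] with β hβ
  have hcos : 0 < Real.cos β := Real.cos_pos_of_mem_Ioo ⟨by linarith [hβ.1, pi_pos], hβ.2⟩
  have hsin : 0 < Real.sin β := Real.sin_pos_of_pos_of_lt_pi hβ.1 (by linarith [hβ.2, pi_pos])
  have hsq := Real.sin_sq_add_cos_sq β
  have hsin1 : Real.sin β < 1 := by nlinarith
  rw [inv_re, normSq_apply]
  simp only [sub_re, exp_ofReal_mul_I_re, I_re, sub_zero, sub_im, exp_ofReal_mul_I_im, I_im]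
  rw [show Real.cos β * Real.cos β + (Real.sin β - 1) * (Real.sin β - 1) =
    2 * (1 - Real.sin β) by nlinarith, inv_eq_one_div, div_div, div_le_div_iff₀ (by positivity)
    (by linarith)]
  nlinarith

lemma completedRiemannZeta_eq_mul {s : ℂ} (hs : 0 < s.re) :
    completedRiemannZeta s = riemannZeta s * Gammaℝ s := by
  rw [riemannZeta_def_of_ne_zero (ne_zero_of_re_pos' hs),
    div_mul_cancel₀ _ (Gammaℝ_ne_zero_of_re_pos hs)]

lemma Gammaℝ_conj (s : ℂ) : Gammaℝ (conj s) = conj (Gammaℝ s) := by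
  have h : conj s / 2 = conj (s / 2) := by rw [map_div₀, conj_ofNat]
  have h' : -conj s / 2 = conj (-s / 2) := by rw [map_div₀, map_neg, conj_ofNat]
  rw [Gammaℝ_def, Gammaℝ_def, map_mul, h, h', Gamma_conj, cpow_conj, conj_ofReal]
  simp [arg_ofReal_of_nonneg pi_pos.le, pi_ne_zero.symm]

lemma ofReal_re_completedRiemannZeta (t : ℝ) :
    (((completedRiemannZeta (1 / 2 + t * I)).re : ℝ) : ℂ) =
      completedRiemannZeta (1 / 2 + t * I) := by
  rw [← conj_eq_iff_re]
  have h : conj (1 / 2 + t * I : ℂ) = 1 - (1 / 2 + t * I) := by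
    rw [map_add, map_div₀, map_mul, conj_ofReal, conj_I, map_one, conj_ofNat]
    ring
  nth_rw 2 [← completedRiemannZeta_one_sub]
  rw [← h, completedRiemannZeta_eq_mul (by simp), completedRiemannZeta_eq_mul (by simp),
    riemannZeta_conj, Gammaℝ_conj, map_mul]

/-- The completed zeta function on the critical line, as a real-valued function. -/
noncomputable def criticalZeta (y : ℝ) : ℝ :=
  (completedRiemannZeta (1 / 2 + (2 * y : ℝ) * I)).re

lemma ofReal_criticalZeta (y : ℝ) :
    (criticalZeta y : ℂ) = completedRiemannZeta (1 / 2 + (2 * y : ℝ) * I) :=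
  ofReal_re_completedRiemannZeta _

lemma continuous_criticalZeta : Continuous criticalZeta := by
  refine continuous_re.comp (continuous_iff_continuousAt.mpr fun y ↦ ?_)
  refine ContinuousAt.comp (g := completedRiemannZeta) ?_ (by fun_prop)
  refine (differentiableAt_completedZeta ?_ ?_).continuousAt
  · intro h
    simpa using congrArg re h
  · intro h
    have := congrArg re h
    norm_num at this

lemma riemannZeta_eq_zero_of_criticalZeta_eq_zero {y : ℝ} (h : criticalZeta y = 0) :
    riemannZeta (1 / 2 + (2 * y : ℝ) * I) = 0 := by
  have h2 := ofReal_criticalZeta y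
  rw [h, ofReal_zero, completedRiemannZeta_eq_mul (by simp), zero_eq_mul] at h2
  exact h2.resolve_right (Gammaℝ_ne_zero_of_re_pos (by simp))

lemma exp_mul_I_re_pos {β : ℝ} (hβ : β ∈ Ioo (-(π / 2)) (π / 2)) : 0 < (cexp (β * I)).re := by
  rw [exp_ofReal_mul_I_re]
  exact Real.cos_pos_of_mem_Ioo hβ

lemma exp_mul_I_cpow {β : ℝ} (hβ : β ∈ Ioo (-(π / 2)) (π / 2)) (y : ℝ) :
    cexp (β * I) ^ (-(1 / 4 + y * I : ℂ)) =
      cexp ((-β / 4 : ℝ) * I) * (Real.exp (β * y) : ℝ) := by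
  rw [cpow_def_of_ne_zero (Complex.exp_ne_zero _), Complex.log_exp, ofReal_exp, ← Complex.exp_add]
  · congr 1
    push_cast
    linear_combination -β * y * I_mul_I
  · simp
    linarith [hβ.1, pi_pos]
  · simp
    linarith [hβ.2, pi_pos]

lemma exists_exp_mul_abs_criticalZeta_le {β : ℝ} (hβ : β ∈ Ioo (-(π / 2)) (π / 2)) :
    ∃ C, ∀ y, Real.exp (β * y) * |criticalZeta y| ≤ C := by
  obtain ⟨C, hC⟩ := exists_norm_completedRiemannZeta_le (exp_mul_I_re_pos hβ)
  refine ⟨C, fun y ↦ (hC y).trans' (le_of_eq ?_)⟩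
  rw [exp_mul_I_cpow hβ, ← ofReal_criticalZeta, norm_mul, norm_mul, norm_exp_ofReal_mul_I, one_mul,
    norm_real, norm_real, Real.norm_eq_abs, Real.norm_eq_abs, abs_of_pos (Real.exp_pos _)]

lemma integrable_exp_mul_criticalZeta {β : ℝ} (hβ : β ∈ Ioo (-(π / 2)) (π / 2)) :
    Integrable fun y ↦ Real.exp (β * y) * criticalZeta y := by
  obtain ⟨b, hb, hb'⟩ := exists_between hβ.2
  obtain ⟨a, ha', ha⟩ := exists_between hβ.1
  obtain ⟨A, hA⟩ := exists_exp_mul_abs_criticalZeta_le ⟨ha', ha.trans hβ.2⟩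
  obtain ⟨B, hB⟩ := exists_exp_mul_abs_criticalZeta_le ⟨hβ.1.trans hb, hb'⟩
  have hcont : Continuous fun y ↦ Real.exp (β * y) * criticalZeta y := by
    have := continuous_criticalZeta
    fun_prop
  have hO (c D : ℝ) (hD : ∀ y, Real.exp (c * y) * |criticalZeta y| ≤ D) (y : ℝ) :
      ‖Real.exp (β * y) * criticalZeta y‖ ≤ D * Real.exp (-(c - β) * y) := by
    rw [norm_mul, Real.norm_eq_abs, Real.norm_eq_abs, abs_of_pos (Real.exp_pos _),
      show β * y = c * y + -(c - β) * y by ring, Real.exp_add, mul_right_comm]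
    gcongr
    exact hD y
  rw [← integrableOn_univ, ← Iic_union_Ioi (a := (0 : ℝ)), integrableOn_union]
  constructor
  · refine Integrable.mono' ((integrableOn_exp_mul_Iic (a := β - a) (by linarith) 0).const_mul A)
      hcont.aestronglyMeasurable (.of_forall fun y ↦ ?_)
    simpa using hO a A hA y
  · refine Integrable.mono' ((integrableOn_exp_mul_Ioi (a := β - b) (by linarith) 0).const_mul B)
      hcont.aestronglyMeasurable (.of_forall fun y ↦ ?_)
    simpa using hO b B hB y

lemma continuousAt_strippedTheta {w : ℂ} (hw : 0 < w.re) {x : ℝ} (hx : 0 < x) :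
    ContinuousAt (strippedTheta w) x := by
  refine ((continuousAt_rightTheta_mul hw hx).sub continuousAt_const).sub
    (continuousAt_const.mul ?_)
  exact continuous_ofReal.continuousAt.comp (Real.continuousAt_rpow_const _ _ (.inl hx.ne'))

lemma pi_mul_strippedTheta {β : ℝ} (hβ : β ∈ Ioo (-(π / 2)) (π / 2)) {x : ℝ} (hx : 0 < x) :
    π * strippedTheta (cexp (β * I)) x = cexp ((-β / 4 : ℝ) * I) *
      ∫ y : ℝ, (x : ℂ) ^ (-(1 / 4 + y * I : ℂ)) * (Real.exp (β * y) * criticalZeta y : ℝ) := by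
  have hw := exp_mul_I_re_pos hβ
  have hm (y : ℝ) := hasMellin_strippedTheta (s := (1 / 4 : ℝ) + y * I) hw (by simp) (by norm_num)
  have hv (y : ℝ) : mellin (strippedTheta (cexp (β * I))) ((1 / 4 : ℝ) + y * I) =
      2 * (cexp ((-β / 4 : ℝ) * I) * (Real.exp (β * y) * criticalZeta y : ℝ)) := by
    rw [(hm y).2, show (2 * ((1 / 4 : ℝ) + y * I) : ℂ) = 1 / 2 + (2 * y : ℝ) * I by
      push_cast; ring, ← ofReal_criticalZeta, show (((1 / 4 : ℝ) : ℂ)) = 1 / 4 by norm_num,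
      exp_mul_I_cpow hβ]
    push_cast
    ring
  have h0 : MellinConvergent (strippedTheta (cexp (β * I))) ((1 / 4 : ℝ) : ℂ) := by
    simpa using (hm 0).1
  have hi : VerticalIntegrable (mellin (strippedTheta (cexp (β * I)))) (1 / 4) := by
    unfold VerticalIntegrable
    simp_rw [hv]
    exact (((integrable_exp_mul_criticalZeta hβ).ofReal).const_mul _).const_mul _
  have h := mellinInv_mellin_eq (1 / 4) _ hx h0 hi (continuousAt_strippedTheta hw hx)
  rw [← h, mellinInv]
  simp_rw [hv, smul_eq_mul]
  rw [← integral_const_mul, real_smul, ← mul_assoc, ← integral_const_mul]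
  congr 1
  ext y
  push_cast
  field_simp

lemma exists_abs_criticalZeta_eq (h : {y | criticalZeta y = 0}.Finite) :
    ∃ T : ℝ, 0 ≤ T ∧ ∃ σ : ℝ, |σ| = 1 ∧ ∀ y, T < y → |criticalZeta y| = σ * criticalZeta y := by
  obtain ⟨T, hT⟩ := h.bddAbove
  have hne {y : ℝ} (hy : max T 0 < y) : criticalZeta y ≠ 0 := fun h0 ↦
    ((le_max_left T 0).trans_lt hy).not_ge (hT h0)
  have hu {a b : ℝ} (ha : max T 0 < a) (hb : max T 0 < b) (ha0 : criticalZeta a ≤ 0) :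
      ¬ 0 ≤ criticalZeta b := fun hb0 ↦ by
    obtain ⟨y, hy, hy0⟩ := intermediate_value_uIcc
      (continuous_criticalZeta.continuousOn (s := uIcc a b)) (mem_uIcc_of_le ha0 hb0)
    exact hne ((lt_min ha hb).trans_le hy.1) hy0
  refine ⟨max T 0, le_max_right _ _, ?_⟩
  have h1 : max T 0 < max T 0 + 1 := lt_add_one _
  rcases le_total (criticalZeta (max T 0 + 1)) 0 with h0 | h0
  · refine ⟨-1, by simp, fun y hy ↦ ?_⟩
    rw [abs_of_neg (not_le.mp (hu h1 hy h0)), neg_one_mul]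
  · refine ⟨1, abs_one, fun y hy ↦ ?_⟩
    rw [abs_of_pos (not_le.mp fun hy0 ↦ hu hy h1 hy0 h0), one_mul]

lemma exists_integral_exp_mul_abs_criticalZeta_le (h : {y | criticalZeta y = 0}.Finite) :
    ∃ C, ∀ β ∈ Ico 0 (π / 2), ∫ y, Real.exp (β * y) * |criticalZeta y| ≤
      |∫ y, Real.exp (β * y) * criticalZeta y| + C := by
  obtain ⟨T, hT, σ, hσ, hs⟩ := exists_abs_criticalZeta_eq h
  refine ⟨∫ y, 2 * Real.exp (π / 2 * T) * |criticalZeta y|, fun β hβ ↦ ?_⟩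
  have hi := integrable_exp_mul_criticalZeta (β := β) ⟨by linarith [hβ.1, pi_pos], hβ.2⟩
  have hi0 : Integrable criticalZeta := by
    simpa using integrable_exp_mul_criticalZeta (β := 0) ⟨by linarith [pi_pos], by positivity⟩
  have hi' : Integrable fun y ↦ Real.exp (β * y) * |criticalZeta y| := by
    simpa [abs_mul] using hi.abs
  have hp (y : ℝ) : Real.exp (β * y) * |criticalZeta y| ≤
      σ * (Real.exp (β * y) * criticalZeta y) + 2 * Real.exp (π / 2 * T) * |criticalZeta y| := by
    rcases lt_or_ge T y with hy | hy
    · rw [mul_left_comm, ← hs y hy]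
      have : 0 ≤ 2 * Real.exp (π / 2 * T) * |criticalZeta y| := by positivity
      linarith
    · have h1 : Real.exp (β * y) ≤ Real.exp (π / 2 * T) :=
        Real.exp_le_exp.mpr ((mul_le_mul_of_nonneg_left hy hβ.1).trans
          (mul_le_mul_of_nonneg_right hβ.2.le hT))
      have h2 : -(σ * (Real.exp (β * y) * criticalZeta y)) ≤
          Real.exp (β * y) * |criticalZeta y| := by
        refine (neg_le_abs _).trans_eq ?_
        rw [abs_mul, abs_mul, hσ, one_mul, Real.abs_exp]
      have h3 := mul_le_mul_of_nonneg_right h1 (abs_nonneg (criticalZeta y))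
      linarith
  refine (integral_mono hi' ((hi.const_mul σ).add (hi0.abs.const_mul _)) hp).trans ?_
  simp only [Pi.add_apply]
  rw [integral_add (hi.const_mul σ) (hi0.abs.const_mul _), integral_const_mul]
  gcongr
  refine (le_abs_self _).trans_eq ?_
  rw [abs_mul, hσ, one_mul]

lemma exists_norm_strippedTheta_two_le (h : {y | criticalZeta y = 0}.Finite) :
    ∃ C, ∀ β ∈ Ico 0 (π / 2), ‖strippedTheta (cexp (β * I)) 2‖ ≤
      ‖strippedTheta (cexp (β * I)) 1‖ + C := by
  obtain ⟨C, hC⟩ := exists_integral_exp_mul_abs_criticalZeta_le h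
  refine ⟨C / π, fun β hβ ↦ ?_⟩
  have hβ' : β ∈ Ioo (-(π / 2)) (π / 2) := ⟨by linarith [hβ.1, pi_pos], hβ.2⟩
  have h1 : π * ‖strippedTheta (cexp (β * I)) 1‖ =
      |∫ y, Real.exp (β * y) * criticalZeta y| := by
    have := congrArg norm (pi_mul_strippedTheta hβ' one_pos)
    simp only [ofReal_one, one_cpow, one_mul] at this
    rwa [integral_complex_ofReal, norm_mul, norm_mul, norm_exp_ofReal_mul_I, one_mul, norm_real,
      norm_real, Real.norm_eq_abs, Real.norm_eq_abs, abs_of_pos pi_pos] at this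
  have h2 : π * ‖strippedTheta (cexp (β * I)) 2‖ ≤
      ∫ y, Real.exp (β * y) * |criticalZeta y| := by
    have := congrArg norm (pi_mul_strippedTheta hβ' two_pos)
    rw [norm_mul, norm_mul, norm_exp_ofReal_mul_I, one_mul, norm_real, Real.norm_eq_abs,
      abs_of_pos pi_pos] at this
    rw [this]
    refine norm_integral_le_of_norm_le ?_ (.of_forall fun y ↦ ?_)
    · simpa [abs_mul] using (integrable_exp_mul_criticalZeta hβ').abs
    · rw [norm_mul, norm_cpow_eq_rpow_re_of_pos two_pos, norm_real, norm_mul, Real.norm_eq_abs,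
        Real.norm_eq_abs, Real.abs_exp]
      refine mul_le_of_le_one_left (by positivity) (Real.rpow_le_one_of_one_le_of_nonpos ?_ ?_)
      · norm_num
      · norm_num
  have h3 := hC β hβ
  rw [← h1] at h3
  have h4 : ‖strippedTheta (cexp (β * I)) 1‖ + C / π =
      (π * ‖strippedTheta (cexp (β * I)) 1‖ + C) / π := by
    field_simp
  rw [h4, le_div_iff₀' pi_pos]
  exact h2.trans h3

lemma norm_strippedTheta_sub_rightTheta_le (β : ℝ) {x : ℝ} (hx : 1 ≤ x) :
    ‖strippedTheta (cexp (β * I)) x - rightTheta (cexp (β * I) * x)‖ ≤ 2 := by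
  have h : ‖(cexp (β * I))⁻¹ ^ (1 / 2 : ℂ)‖ = 1 := by
    rw [norm_cpow_of_ne_zero (inv_ne_zero (Complex.exp_ne_zero _)), norm_inv,
      norm_exp_ofReal_mul_I]
    simp
  rw [strippedTheta, sub_sub (rightTheta _), sub_sub_cancel_left, norm_neg]
  refine (norm_add_le _ _).trans ?_
  rw [norm_mul, h, one_mul, norm_one, norm_real, Real.norm_eq_abs,
    abs_of_nonneg (Real.rpow_nonneg (by linarith) _)]
  linarith [Real.rpow_le_one_of_one_le_of_nonpos hx (by norm_num : (-(1 / 2) : ℝ) ≤ 0)]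

lemma infinite_setOf_criticalZeta_eq_zero : {y | criticalZeta y = 0}.Infinite := by
  intro h
  obtain ⟨C, hC⟩ := exists_norm_strippedTheta_two_le h
  have hmem : Ioo 0 (π / 2) ∈ 𝓝[<] (π / 2) := Ioo_mem_nhdsLT (by positivity)
  refine not_exists_norm_rightTheta_le (l := 𝓝[<] (π / 2)) (v := fun β : ℝ ↦ cexp (β * I) - I)
    ?_ ?_ tendsto_inv_exp_sub_I (C + 4) ?_
  · filter_upwards [hmem] with β hβ
    simpa using exp_mul_I_re_pos ⟨by linarith [hβ.1, pi_pos], hβ.2⟩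
  · have : ContinuousAt (fun β : ℝ ↦ cexp (β * I) - I) (π / 2) := by fun_prop
    have h0 : cexp ((π / 2 : ℝ) * I) - I = 0 := by
      rw [ofReal_div, ofReal_ofNat, exp_pi_div_two_mul_I, sub_self]
    rw [← h0]
    exact this.tendsto.mono_left nhdsWithin_le_nhds
  · filter_upwards [hmem] with β hβ
    have hβ' : β ∈ Ico 0 (π / 2) := ⟨hβ.1.le, hβ.2⟩
    rw [sub_add_cancel]
    have h1 := norm_strippedTheta_sub_rightTheta_le β le_rfl
    have h2 := norm_strippedTheta_sub_rightTheta_le β one_le_two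
    rw [ofReal_one, mul_one] at h1
    rw [ofReal_ofNat, mul_comm _ 2] at h2
    have h3 := hC β hβ'
    have h4 := norm_sub_norm_le (strippedTheta (cexp (β * I)) 1) (rightTheta (cexp (β * I)))
    have h5 := norm_sub_norm_le (rightTheta (2 * cexp (β * I))) (strippedTheta (cexp (β * I)) 2)
    rw [norm_sub_rev] at h5
    linarith

end

/-- Hardy's theorem: the Riemann zeta function has infinitely many zeros on the critical line. -/
theorem riemannZeta_infinitely_many_zeros_on_critical_line :
    {t : ℝ | riemannZeta (1 / 2 + t * Complex.I) = 0}.Infinite := by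
  refine (infinite_setOf_criticalZeta_eq_zero.image
    (mul_right_injective₀ (two_ne_zero' ℝ)).injOn).mono ?_
  rintro _ ⟨y, hy, rfl⟩
  exact riemannZeta_eq_zero_of_criticalZeta_eq_zero hy
end

section
/- For s ∈ ℂ let ξ(s) = (1/2)·s·(s−1)·π^{−s/2}·Γ(s/2)·ζ(s), and for t ∈ ℝ set Ξ(t) = ξ(1/2 + it). Then for every real t, Ξ(t) = 1/2 − (t² + 1/4)·∫_1^∞ x^{−3/4}·cos((t/2)·log x)·( Σ_{n≥1} e^{−π n² x} ) dx. -/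
open Real Filter Set

namespace WeakFEPair

open MeasureTheory

variable {E : Type*} [NormedAddCommGroup E] [NormedSpace ℂ E] (P : WeakFEPair E)

/-- The Mellin transform of `f - f₀` truncated to `(1, ∞)` converges everywhere. -/
theorem mellinConvergent_indicator_Ioi_one (s : ℂ) :
    MellinConvergent ((Ioi 1).indicator fun x ↦ P.f x - P.f₀) s := by
  have h : IntegrableOn (fun x : ℝ ↦ (x : ℂ) ^ (s - 1) • P.f_modif x) (Ioi 0) :=
    (P.isStrongFEPair_toStrongFEPair.hasMellin s).1
  refine (IntegrableOn.congr_fun (h.indicator (measurableSet_Ioi (a := (1 : ℝ)))) ?_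
    measurableSet_Ioi)
  intro x _
  by_cases hx : 1 < x
  · simp [f_modif, hx, hx.le]
  · simp [hx]

theorem f_modif_eq_add {x : ℝ} (hx : 0 < x) :
    P.f_modif x = (Ioi 1).indicator (fun x ↦ P.f x - P.f₀) x +
      P.ε • ((x : ℂ) ^ (-P.k : ℂ) • (Ioi 1).indicator (fun x ↦ P.g x - P.g₀) x⁻¹) := by
  have hcast : (x : ℂ) ^ (-P.k : ℂ) = ((x ^ (-P.k) : ℝ) : ℂ) := by
    rw [Complex.ofReal_cpow hx.le, Complex.ofReal_neg]
  rw [f_modif, Pi.add_apply]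
  congr 1
  by_cases h : x < 1
  · have hf : P.f x = (P.ε * ↑(x ^ (-P.k))) • P.g x⁻¹ := by
      have := P.h_feq x⁻¹ (inv_pos.mpr hx)
      rwa [one_div, inv_inv, Real.inv_rpow hx.le, ← Real.rpow_neg hx.le] at this
    rw [indicator_of_mem (mem_Ioo.mpr ⟨hx, h⟩),
      indicator_of_mem (mem_Ioi.mpr ((one_lt_inv₀ hx).mpr h)), hcast, hf, ← mul_smul, smul_sub]
  · rw [indicator_of_notMem (fun h' ↦ h h'.2),
      indicator_of_notMem (mt (one_lt_inv₀ hx).mp h : x⁻¹ ∉ Ioi 1), smul_zero, smul_zero]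

/-- `Λ₀` as a sum of two Mellin integrals over `(1, ∞)`. -/
theorem Λ₀_eq_mellin_add_mellin (s : ℂ) :
    P.Λ₀ s = mellin ((Ioi 1).indicator fun x ↦ P.f x - P.f₀) s +
      P.ε • mellin ((Ioi 1).indicator fun x ↦ P.g x - P.g₀) (P.k - s) := by
  set G := (Ioi (1 : ℝ)).indicator fun x ↦ P.g x - P.g₀ with hG
  have hconv : MellinConvergent (fun x : ℝ ↦ P.ε • ((x : ℂ) ^ (-P.k : ℂ) • G x⁻¹)) s := by
    refine MellinConvergent.const_smul (MellinConvergent.cpow_smul.mpr ?_) _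
    simp_rw [← Real.rpow_neg_one]
    rw [MellinConvergent.comp_rpow (by norm_num)]
    exact P.symm.mellinConvergent_indicator_Ioi_one _
  have hadd := (hasMellin_add (P.mellinConvergent_indicator_Ioi_one s) hconv).2
  rw [mellin_const_smul, mellin_cpow_smul, mellin_comp_inv,
    show -(s + -(P.k : ℂ)) = P.k - s by ring] at hadd
  rw [← hadd]
  exact setIntegral_congr_fun measurableSet_Ioi fun x hx ↦ by simp only [P.f_modif_eq_add hx, hG]

end WeakFEPair

open MeasureTheory HurwitzZeta

theorem evenKernel_zero_sub_one {x : ℝ} (hx : 0 < x) :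
    evenKernel 0 x - 1 = 2 * ∑' n : ℕ, Real.exp (-π * ((n : ℝ) + 1) ^ 2 * x) := by
  have h := (hasSum_nat_cosKernel₀ 0 hx).tsum_eq
  simp only [mul_zero, zero_mul, Real.cos_zero, mul_one, tsum_mul_left,
    QuotientAddGroup.mk_zero] at h
  rw [evenKernel_eq_cosKernel_of_zero, h]

theorem mellin_indicator_Ioi_one (f : ℝ → ℂ) (s : ℂ) :
    mellin ((Ioi 1).indicator f) s = ∫ x in Ioi (1 : ℝ), (x : ℂ) ^ (s - 1) * f x := by
  have h : (fun x : ℝ ↦ (x : ℂ) ^ (s - 1) • (Ioi 1).indicator f x) =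
      (Ioi 1).indicator fun x : ℝ ↦ (x : ℂ) ^ (s - 1) * f x := by
    ext x
    by_cases hx : 1 < x <;> simp [hx]
  rw [mellin, h, setIntegral_indicator measurableSet_Ioi,
    inter_eq_right.mpr (Ioi_subset_Ioi zero_le_one)]

theorem cpow_add_cpow_eq_rpow_mul_cos {x : ℝ} (hx : 0 < x) (a b : ℝ) :
    (x : ℂ) ^ (a + b * Complex.I) + (x : ℂ) ^ (a - b * Complex.I) =
      ((2 * (x ^ a * Real.cos (b * Real.log x)) : ℝ) : ℂ) := by
  have hx0 : (x : ℂ) ≠ 0 := Complex.ofReal_ne_zero.mpr hx.ne'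
  rw [Complex.cpow_add _ _ hx0, Complex.cpow_sub _ _ hx0, div_eq_mul_inv, ← Complex.cpow_neg,
    ← mul_add, Complex.ofReal_mul, Complex.ofReal_mul, Complex.ofReal_cpow hx.le,
    Complex.ofReal_cos, Complex.cos, Complex.cpow_def_of_ne_zero hx0 (b * Complex.I),
    Complex.cpow_def_of_ne_zero hx0 (-(b * Complex.I)), ← Complex.ofReal_log hx.le]
  push_cast
  ring_nf

/-- Riemann's integral for the entire completed zeta function on the critical line. -/
theorem completedRiemannZeta₀_critical_line (t : ℝ) :
    completedRiemannZeta₀ (1 / 2 + (t : ℂ) * Complex.I) =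
      ((2 * ∫ x in Ioi (1 : ℝ), x ^ (-(3 : ℝ) / 4) * Real.cos (t / 2 * Real.log x) *
        ∑' n : ℕ, Real.exp (-π * ((n : ℝ) + 1) ^ 2 * x) : ℝ) : ℂ) := by
  set P := hurwitzEvenFEPair 0 with hP
  set F : ℝ → ℂ := fun x ↦ P.f x - P.f₀ with hF
  set s : ℂ := (1 / 2 + (t : ℂ) * Complex.I) / 2 with hs
  have hsymm : (fun x ↦ P.g x - P.g₀) = F := by
    ext x
    simp [hF, hP, hurwitzEvenFEPair, evenKernel_eq_cosKernel_of_zero]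
  have hF_int (w : ℂ) : IntegrableOn (fun x : ℝ ↦ (x : ℂ) ^ (w - 1) * F x) (Ioi 1) := by
    refine ((P.mellinConvergent_indicator_Ioi_one w).mono_set
      (Ioi_subset_Ioi zero_le_one)).congr_fun (fun x hx ↦ ?_) measurableSet_Ioi
    simp only [indicator_of_mem hx, smul_eq_mul, hF]
  have hε : P.ε = 1 := rfl
  have hk : (P.k : ℂ) = 1 / 2 := by simp [hP, hurwitzEvenFEPair]
  rw [completedRiemannZeta₀, completedHurwitzZetaEven₀, ← hP, ← hs, P.Λ₀_eq_mellin_add_mellin,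
    hsymm, hε, one_smul, hk, mellin_indicator_Ioi_one, mellin_indicator_Ioi_one,
    ← integral_add (hF_int _) (hF_int _), ← integral_const_mul, ← integral_complex_ofReal,
    ← integral_div]
  refine setIntegral_congr_fun measurableSet_Ioi fun x hx ↦ ?_
  have hx0 : 0 < x := zero_lt_one.trans hx
  have hFx : F x = ((evenKernel 0 x - 1 : ℝ) : ℂ) := by
    simp [hF, hP, hurwitzEvenFEPair]
  have hpow := cpow_add_cpow_eq_rpow_mul_cos hx0 (-3 / 4) (t / 2)
  rw [show (((-3 / 4 : ℝ) : ℂ) + ((t / 2 : ℝ) : ℂ) * Complex.I) = s - 1 by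
      rw [hs]; push_cast; ring,
    show (((-3 / 4 : ℝ) : ℂ) - ((t / 2 : ℝ) : ℂ) * Complex.I) = 1 / 2 - s - 1 by
      rw [hs]; push_cast; ring] at hpow
  rw [← add_mul, hpow, hFx, evenKernel_zero_sub_one hx0]
  push_cast
  ring

/-- With `ξ(s) = (1/2)s(s−1)π^{−s/2}Γ(s/2)ζ(s)` and `Ξ(t) = ξ(1/2 + it)`, for every real `t`,
`Ξ(t) = 1/2 − (t² + 1/4)·∫_1^∞ x^{−3/4}·cos((t/2)·log x)·(Σ_{n≥1} e^{−πn²x}) dx`. -/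
theorem Xi_integral_representation (t : ℝ) :
    (fun s : ℂ => 1 / 2 * s * (s - 1) * (π : ℂ) ^ (-s / 2) * Complex.Gamma (s / 2)
        * riemannZeta s) (1 / 2 + (t : ℂ) * Complex.I)
      = ((1 / 2 - (t ^ 2 + 1 / 4) * ∫ x in Set.Ioi (1 : ℝ),
          x ^ (-(3 : ℝ) / 4) * Real.cos (t / 2 * Real.log x) *
            ∑' n : ℕ, Real.exp (-π * ((n : ℝ) + 1) ^ 2 * x) : ℝ) : ℂ) := by
  have hre : 0 < (1 / 2 + (t : ℂ) * Complex.I).re := by simp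
  have hzero := completedRiemannZeta₀_critical_line t
  set J : ℝ := ∫ x in Ioi (1 : ℝ), x ^ (-(3 : ℝ) / 4) * Real.cos (t / 2 * Real.log x) *
    ∑' n : ℕ, Real.exp (-π * ((n : ℝ) + 1) ^ 2 * x)
  have hs1 : 1 - (1 / 2 + (t : ℂ) * Complex.I) ≠ 0 := fun h ↦ by
    have := congrArg Complex.re h
    norm_num at this
  have hquad : (1 / 2 + (t : ℂ) * Complex.I) * (1 / 2 + (t : ℂ) * Complex.I - 1) =
      -((t : ℂ) ^ 2 + 1 / 4) := by
    linear_combination (t : ℂ) ^ 2 * Complex.I_sq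
  beta_reduce
  generalize 1 / 2 + (t : ℂ) * Complex.I = s at *
  have hs0 : s ≠ 0 := fun h ↦ by simp [h] at hre
  have hcomp : (π : ℂ) ^ (-s / 2) * Complex.Gamma (s / 2) * riemannZeta s =
      2 * J - 1 / s - 1 / (1 - s) := by
    rw [riemannZeta_def_of_ne_zero hs0, ← Complex.Gammaℝ_def,
      mul_div_cancel₀ _ (Complex.Gammaℝ_ne_zero_of_re_pos hre), completedRiemannZeta_eq, hzero]
    push_cast
    ring
  calc
    _ = 1 / 2 * (s * (s - 1)) *
        ((π : ℂ) ^ (-s / 2) * Complex.Gamma (s / 2) * riemannZeta s) := by ring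
    _ = 1 / 2 + s * (s - 1) * J := by
      rw [hcomp]
      field_simp
      ring
    _ = _ := by
      rw [hquad]
      push_cast
      ring
end

section
/- Let f : [0,1] → ℝ be continuous, and suppose its Fourier cosine coefficients a_n = 2·∫_0^1 f(t)·cos(nπt) dt satisfy (−1)^n·a_n > 0 for every integer n ≥ 0. Define the entire function U(z) = ∫_0^1 f(t)·cos(zt) dt for z ∈ ℂ. Then every zero of U is real and simple — that is, U(z) = 0 implies z ∈ ℝ and U′(z) ≠ 0 — and for every integer k there is exactly one zero of U in the open interval (kπ, (k+1)π). -/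
open Real Filter Set

open MeasureTheory Topology Interval

theorem sin_ne_zero_of_forall_ne_int_mul_pi {z : ℂ} (hz : ∀ k : ℤ, z ≠ k * π) :
    Complex.sin z ≠ 0 :=
  fun h => (Complex.sin_eq_zero_iff.1 h).elim hz

theorem integral_exp_mul_cos_eq (z : ℂ) (hz : ∀ k : ℤ, z ≠ k * π) (n : ℤ) :
    ∫ t in (-1 : ℝ)..1, Complex.exp (-(n * π * t * Complex.I)) * Complex.cos (z * t) =
      2 * ((-1) ^ n * (z * Complex.sin z / (z ^ 2 - (n * π) ^ 2))) := by
  have h₁ : z - n * π ≠ 0 := sub_ne_zero.2 (hz n)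
  have h₂ : z + n * π ≠ 0 := by
    intro h
    apply hz (-n)
    push_cast
    linear_combination h
  have e (t : ℝ) : Complex.exp (-(n * π * t * Complex.I)) * Complex.cos (z * t) =
      (Complex.exp ((z - n * π) * Complex.I * t) +
        Complex.exp (-(z + n * π) * Complex.I * t)) / 2 := by
    rw [Complex.cos, mul_div_assoc', mul_add, ← Complex.exp_add, ← Complex.exp_add]
    ring_nf
  simp_rw [e]
  rw [intervalIntegral.integral_div, intervalIntegral.integral_add
    (Continuous.intervalIntegrable (by fun_prop) _ _)
    (Continuous.intervalIntegrable (by fun_prop) _ _),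
    integral_exp_mul_complex (mul_ne_zero h₁ Complex.I_ne_zero),
    integral_exp_mul_complex (mul_ne_zero (neg_ne_zero.2 h₂) Complex.I_ne_zero)]
  have s₁ : Complex.exp ((z - n * π) * Complex.I) - Complex.exp (-(z - n * π) * Complex.I) =
      2 * Complex.I * ((-1) ^ n * Complex.sin z) := by
    rw [← n.cast_negOnePow ℂ, ← Complex.sin_antiperiodic.sub_int_mul_eq n, Complex.sin]
    linear_combination (-Complex.exp (-(z - n * π) * Complex.I) +
      Complex.exp ((z - n * π) * Complex.I)) * Complex.I_sq
  have s₂ : Complex.exp ((z + n * π) * Complex.I) - Complex.exp (-(z + n * π) * Complex.I) =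
      2 * Complex.I * ((-1) ^ n * Complex.sin z) := by
    rw [← n.cast_negOnePow ℂ, ← Complex.sin_antiperiodic.add_int_mul_eq n, Complex.sin]
    linear_combination (-Complex.exp (-(z + n * π) * Complex.I) +
      Complex.exp ((z + n * π) * Complex.I)) * Complex.I_sq
  have s₁' : Complex.exp ((z - n * π) * Complex.I * (1 : ℝ)) -
      Complex.exp ((z - n * π) * Complex.I * (-1 : ℝ)) =
      2 * Complex.I * ((-1) ^ n * Complex.sin z) := by
    rw [← s₁]; push_cast; ring_nf
  have s₂' : Complex.exp (-(z + n * π) * Complex.I * (1 : ℝ)) -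
      Complex.exp (-(z + n * π) * Complex.I * (-1 : ℝ)) =
      -(2 * Complex.I * ((-1) ^ n * Complex.sin z)) := by
    rw [← s₂]; push_cast; ring_nf
  rw [s₁', s₂', show z ^ 2 - (n * π) ^ 2 = (z - n * π) * (z + n * π) by ring]
  field_simp
  ring

theorem summable_inv_sq_sub_int_mul_pi_sq (z : ℂ) :
    Summable fun n : ℤ => (z ^ 2 - (n * π) ^ 2)⁻¹ := by
  have hpi : (π : ℂ) ≠ 0 := by exact_mod_cast pi_ne_zero
  refine ((EisensteinSeries.summable_linear_sub_mul_linear_add (z / π) 1 1).mul_left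
    ((π : ℂ) ^ 2)⁻¹).congr fun n => ?_
  rw [← mul_inv]
  congr 1
  field_simp
  push_cast
  ring

/-- The Fourier expansion of `t ↦ cos(zt)` on `(-1, 1)`. -/
theorem hasSum_cos_mul (z : ℂ) (hz : ∀ k : ℤ, z ≠ k * π) {t : ℝ} (ht : t ∈ Ioo (-1 : ℝ) 1) :
    HasSum (fun n : ℤ => (-1) ^ n * (z * Complex.sin z / (z ^ 2 - (n * π) ^ 2)) *
      Complex.cos (n * π * t)) (Complex.cos (z * t)) := by
  have : Fact ((0 : ℝ) < 2) := ⟨two_pos⟩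
  set c : ℝ → ℂ := fun t => Complex.cos (z * t) with hc
  have hcont : Continuous (AddCircle.liftIco 2 (-1) c) := by
    refine AddCircle.liftIco_continuous ?_ (Continuous.continuousOn (by fun_prop))
    rw [hc]
    norm_num
  let C : C(AddCircle (2 : ℝ), ℂ) := ⟨_, hcont⟩
  have hcoeff (n : ℤ) : fourierCoeff C n =
      (-1) ^ n * (z * Complex.sin z / (z ^ 2 - (n * π) ^ 2)) := by
    have h := integral_exp_mul_cos_eq z hz n
    change fourierCoeff (AddCircle.liftIco 2 (-1) c) n = _
    rw [fourierCoeff_liftIco_eq, fourierCoeffOn_eq_integral]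
    rw [show (-1 : ℝ) + 2 = 1 by norm_num, show (1 : ℝ) - -1 = 2 by norm_num]
    have e (t : ℝ) : fourier (-n) (t : AddCircle (2 : ℝ)) • c t =
        Complex.exp (-(n * π * t * Complex.I)) * Complex.cos (z * t) := by
      rw [fourier_coe_apply, smul_eq_mul]
      congr 2
      push_cast
      ring
    simp_rw [e, h, Complex.real_smul]
    push_cast
    ring
  have hsum : Summable (fourierCoeff C) := by
    refine .of_norm_bounded (g := fun n : ℤ => ‖z * Complex.sin z‖ * ‖(z ^ 2 - (n * π) ^ 2)⁻¹‖)
      ((summable_inv_sq_sub_int_mul_pi_sq z).norm.mul_left _) fun n => ?_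
    rw [hcoeff]
    simp [div_eq_mul_inv]
  have hval {s : ℝ} (hs : s ∈ Ioo (-1 : ℝ) 1) : C (s : AddCircle (2 : ℝ)) = c s :=
    AddCircle.liftIco_coe_apply (p := (2 : ℝ)) (a := -1) (f := c) (by constructor <;> linarith [hs.1, hs.2])
  have hs := has_pointwise_sum_fourier_series_of_summable hsum
  have h₁ := hs (t : AddCircle (2 : ℝ))
  have h₂ := hs ((-t : ℝ) : AddCircle (2 : ℝ))
  rw [hval ht] at h₁
  rw [hval (by constructor <;> linarith [ht.1, ht.2])] at h₂
  convert! (h₁.add h₂).div_const 2 using 1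
  · ext n
    rw [hcoeff, fourier_coe_apply, fourier_coe_apply, Complex.cos, smul_eq_mul, smul_eq_mul,
      show 2 * π * Complex.I * n * t / (2 : ℝ) = n * π * t * Complex.I by push_cast; ring,
      show 2 * π * Complex.I * n * (-t : ℝ) / (2 : ℝ) = -(n * π * t) * Complex.I by
        push_cast; ring]
    ring
  · simp [hc]

/-- The finite Fourier cosine transform `z ↦ ∫₀¹ f(t) cos(zt) dt`. -/
noncomputable def cosTransform (f : ℝ → ℝ) (z : ℂ) : ℂ :=
  ∫ t in (0 : ℝ)..1, (f t : ℂ) * Complex.cos (z * (t : ℂ))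

theorem cosTransform_ofReal (f : ℝ → ℝ) (x : ℝ) :
    cosTransform f x = ((∫ t in (0 : ℝ)..1, f t * Real.cos (x * t) : ℝ) : ℂ) := by
  rw [cosTransform, ← intervalIntegral.integral_ofReal]
  simp

theorem differentiable_cosTransform {f : ℝ → ℝ} (hf : IntervalIntegrable f volume 0 1) :
    Differentiable ℂ (cosTransform f) := by
  intro z
  have hm : AEStronglyMeasurable (fun t => (f t : ℂ)) (volume.restrict (Ι (0 : ℝ) 1)) :=
    Complex.continuous_ofReal.comp_aestronglyMeasurable hf.def'.aestronglyMeasurable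
  refine (intervalIntegral.hasDerivAt_integral_of_dominated_loc_of_deriv_le
    (F := fun w t => (f t : ℂ) * Complex.cos (w * (t : ℂ)))
    (F' := fun w t => (f t : ℂ) * (-Complex.sin (w * t) * t))
    (bound := fun t => |f t| * Real.exp (‖z‖ + 1))
    (Metric.ball_mem_nhds z one_pos) (.of_forall fun w => ?_) ?_ ?_ ?_ ?_ ?_).2.differentiableAt
  · exact hm.mul (Continuous.aestronglyMeasurable (by fun_prop))
  · exact IntervalIntegrable.mul_continuousOn ⟨hf.1.ofReal, hf.2.ofReal⟩ (Continuous.continuousOn (by fun_prop))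
  · exact hm.mul (Continuous.aestronglyMeasurable (by fun_prop))
  · refine .of_forall fun t ht w hw => ?_
    rw [uIoc_of_le zero_le_one] at ht
    have ht' : ‖(t : ℂ)‖ ≤ 1 := by
      rw [Complex.norm_real, Real.norm_of_nonneg ht.1.le]; exact ht.2
    have hw' : ‖w‖ ≤ ‖z‖ + 1 := by
      have := norm_le_norm_add_norm_sub' w z
      rw [mem_ball_iff_norm] at hw
      linarith
    have hwt : ‖w * t‖ ≤ ‖z‖ + 1 := by
      rw [norm_mul]
      nlinarith [norm_nonneg w, norm_nonneg (t : ℂ)]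
    have hsin : ‖Complex.sin (w * t)‖ ≤ Real.exp (‖z‖ + 1) := by
      have h₁ : ‖Complex.exp (-(w * t) * Complex.I)‖ ≤ Real.exp (‖z‖ + 1) :=
        (Complex.norm_exp_le_exp_norm _).trans (Real.exp_le_exp.2 (by simpa using hwt))
      have h₂ : ‖Complex.exp (w * t * Complex.I)‖ ≤ Real.exp (‖z‖ + 1) :=
        (Complex.norm_exp_le_exp_norm _).trans (Real.exp_le_exp.2 (by simpa using hwt))
      rw [Complex.sin, norm_div, norm_mul, Complex.norm_I, mul_one, Complex.norm_two]
      linarith [norm_sub_le (Complex.exp (-(w * t) * Complex.I)) (Complex.exp (w * t * Complex.I))]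
    rw [norm_mul, norm_mul, norm_neg, Complex.norm_real, Real.norm_eq_abs]
    gcongr
    exact (mul_le_of_le_one_right (norm_nonneg _) ht').trans hsin
  · exact hf.abs.mul_const _
  · refine .of_forall fun t _ w _ => ?_
    simpa using! (((hasDerivAt_id w).mul_const (t : ℂ)).ccos).const_mul (f t : ℂ)

/-- The partial fraction expansion of `cosTransform f z / sin z`. -/
theorem hasSum_cosTransform {f : ℝ → ℝ} (hf : IntervalIntegrable f volume 0 1)
    {z : ℂ} (hz : ∀ k : ℤ, z ≠ k * π) :
    HasSum (fun n : ℤ => (((-1) ^ n * ∫ t in (0 : ℝ)..1, f t * Real.cos (n * π * t) : ℝ) : ℂ) *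
      (z / (z ^ 2 - ((n * π : ℝ) : ℂ) ^ 2))) (cosTransform f z / Complex.sin z) := by
  have hsin : Complex.sin z ≠ 0 := sin_ne_zero_of_forall_ne_int_mul_pi hz
  have hm : AEStronglyMeasurable (fun t => (f t : ℂ)) (volume.restrict (Ι (0 : ℝ) 1)) :=
    Complex.continuous_ofReal.comp_aestronglyMeasurable hf.def'.aestronglyMeasurable
  have hsum : Summable fun n : ℤ => ‖z * Complex.sin z / (z ^ 2 - (n * π) ^ 2)‖ := by
    simp_rw [div_eq_mul_inv]
    exact ((summable_inv_sq_sub_int_mul_pi_sq z).mul_left _).norm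
  have key : HasSum (fun n : ℤ => ∫ t in (0 : ℝ)..1, (f t : ℂ) *
      ((-1) ^ n * (z * Complex.sin z / (z ^ 2 - (n * π) ^ 2)) * Complex.cos (n * π * t)))
      (cosTransform f z) := by
    refine intervalIntegral.hasSum_integral_of_dominated_convergence
      (fun n t => |f t| * ‖z * Complex.sin z / (z ^ 2 - (n * π) ^ 2)‖)
      (fun n => hm.mul (Continuous.aestronglyMeasurable (by fun_prop)))
      (fun n => .of_forall fun t _ => ?_) (.of_forall fun t _ => hsum.mul_left _) ?_ ?_
    · have hcos : ‖Complex.cos (n * π * t)‖ ≤ 1 := by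
        rw [← Complex.ofReal_intCast, ← Complex.ofReal_mul, ← Complex.ofReal_mul,
          ← Complex.ofReal_cos, Complex.norm_real]
        exact Real.abs_cos_le_one _
      rw [norm_mul, norm_mul, norm_mul, norm_zpow, norm_neg, norm_one, one_zpow, one_mul,
        Complex.norm_real, Real.norm_eq_abs]
      gcongr
      exact mul_le_of_le_one_right (norm_nonneg _) hcos
    · simp_rw [tsum_mul_left]
      exact hf.abs.mul_const _
    · filter_upwards [compl_mem_ae_iff.2 (measure_singleton (1 : ℝ))] with t ht₁ ht
      rw [uIoc_of_le zero_le_one] at ht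
      exact (hasSum_cos_mul z hz ⟨by linarith [ht.1], lt_of_le_of_ne ht.2 ht₁⟩).mul_left _
  convert! key.div_const (Complex.sin z) using 1
  ext n
  rw [show (fun t : ℝ => (f t : ℂ) * ((-1) ^ n * (z * Complex.sin z / (z ^ 2 - (n * π) ^ 2)) *
      Complex.cos (n * π * t))) = fun t : ℝ => ((-1) ^ n * (z * Complex.sin z /
      (z ^ 2 - (n * π) ^ 2))) * ((f t * Real.cos (n * π * t) : ℝ) : ℂ) by
    ext t; push_cast; ring, intervalIntegral.integral_const_mul, intervalIntegral.integral_ofReal]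
  push_cast
  field_simp

theorem im_div_sq_sub_sq (z : ℂ) (a : ℝ) :
    (z / (z ^ 2 - (a : ℂ) ^ 2)).im =
      -z.im * ((‖z‖ ^ 2 + a ^ 2) / ‖z ^ 2 - (a : ℂ) ^ 2‖ ^ 2) := by
  rw [Complex.div_im, Complex.sq_norm, Complex.sq_norm]
  simp only [Complex.sub_re, Complex.sub_im, ← Complex.ofReal_pow, Complex.ofReal_re,
    Complex.ofReal_im, Complex.normSq_apply z, pow_two z, Complex.mul_re, Complex.mul_im]
  ring

theorem mul_abs_im_div_le_abs_im_of_hasSum {b : ℤ → ℝ} (hb : ∀ n, 0 < b n) {z S : ℂ}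
    (h : HasSum (fun n : ℤ => (b n : ℂ) * (z / (z ^ 2 - ((n * π : ℝ) : ℂ) ^ 2))) S) :
    b 0 * (|z.im| / ‖z‖ ^ 2) ≤ |S.im| := by
  obtain hy | hy := eq_or_ne z.im 0
  · simp [hy]
  have hz : z ≠ 0 := by rintro rfl; simp at hy
  have h' := (Complex.hasSum_im h).mul_left (-z.im)⁻¹
  simp only [Complex.im_ofReal_mul, im_div_sq_sub_sq] at h'
  have h₀ := le_hasSum h' 0 fun n _ => by
    have := (hb n).le
    field_simp
    positivity
  have e : (-z.im)⁻¹ * (b 0 * (-z.im * ((‖z‖ ^ 2 + (((0 : ℤ) : ℝ) * π) ^ 2) /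
      ‖z ^ 2 - ((((0 : ℤ) : ℝ) * π : ℝ) : ℂ) ^ 2‖ ^ 2))) = b 0 / ‖z‖ ^ 2 := by
    have : ‖z‖ ≠ 0 := norm_ne_zero_iff.2 hz
    simp
    field_simp
  rw [e] at h₀
  have h₁ := h₀.trans (le_abs_self _)
  rw [abs_mul, abs_inv, abs_neg, inv_mul_eq_div, le_div_iff₀ (abs_pos.2 hy)] at h₁
  calc _ = b 0 / ‖z‖ ^ 2 * |z.im| := by ring
    _ ≤ _ := h₁

theorem div_sq_sub_sq_lt {k n : ℤ} {x y : ℝ} (hx : k * π < x) (hxy : x < y)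
    (hy : y < (k + 1) * π) :
    y / (y ^ 2 - (n * π) ^ 2) < x / (x ^ 2 - (n * π) ^ 2) := by
  have key (m : ℤ) : 0 < (x - m * π) * (y - m * π) := by
    obtain hm | hm := le_or_gt m k
    · have : (m : ℝ) * π ≤ k * π := by gcongr
      exact mul_pos (by linarith) (by linarith)
    · have : ((k : ℝ) + 1) * π ≤ m * π := by gcongr; exact_mod_cast hm
      exact mul_pos_of_neg_of_neg (by linarith) (by linarith)
  have h₀ : 0 < x * y := by simpa using key 0
  have h₁ := key n
  have h₂ : 0 < (x + n * π) * (y + n * π) := by simpa using key (-n)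
  have h₃ : 0 < (x ^ 2 - (n * π) ^ 2) * (y ^ 2 - (n * π) ^ 2) :=
    (mul_pos h₁ h₂).trans_eq (by ring)
  have hX := left_ne_zero_of_mul h₃.ne'
  have hY := right_ne_zero_of_mul h₃.ne'
  have e : x / (x ^ 2 - (n * π) ^ 2) - y / (y ^ 2 - (n * π) ^ 2) =
      (y - x) * (x * y + (n * π) ^ 2) / ((x ^ 2 - (n * π) ^ 2) * (y ^ 2 - (n * π) ^ 2)) := by
    rw [div_sub_div _ _ hX hY]
    ring
  have : 0 < y - x := sub_pos.2 hxy
  rw [← sub_pos, e]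
  positivity

theorem ne_int_mul_pi_of_mem_Ioo {k : ℤ} {x : ℝ} (hx : x ∈ Ioo (k * π) ((k + 1) * π)) (m : ℤ) :
    (x : ℂ) ≠ m * π := by
  intro h
  have h' : x = m * π := by exact_mod_cast h
  rw [h'] at hx
  have h₁ : (k : ℝ) < m := lt_of_mul_lt_mul_right hx.1 pi_pos.le
  have h₂ : (m : ℝ) < k + 1 := lt_of_mul_lt_mul_right hx.2 pi_pos.le
  norm_cast at h₁ h₂
  lia

theorem cosTransform_int_mul_pi_ne_zero {f : ℝ → ℝ}
    (hpos : ∀ n : ℤ, 0 < (-1 : ℝ) ^ n * ∫ t in (0 : ℝ)..1, f t * Real.cos (n * π * t)) (k : ℤ) :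
    cosTransform f (k * π) ≠ 0 := by
  have h := right_ne_zero_of_mul (hpos k).ne'
  have e := cosTransform_ofReal f (k * π)
  push_cast at e
  rw [e]
  exact_mod_cast h

theorem ne_int_mul_pi_of_cosTransform_eq_zero {f : ℝ → ℝ}
    (hpos : ∀ n : ℤ, 0 < (-1 : ℝ) ^ n * ∫ t in (0 : ℝ)..1, f t * Real.cos (n * π * t))
    {z : ℂ} (hz : cosTransform f z = 0) (k : ℤ) : z ≠ k * π := by
  rintro rfl
  exact cosTransform_int_mul_pi_ne_zero hpos k hz

theorem mul_abs_im_le_norm_cosTransform {f : ℝ → ℝ} (hf : IntervalIntegrable f volume 0 1)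
    (hpos : ∀ n : ℤ, 0 < (-1 : ℝ) ^ n * ∫ t in (0 : ℝ)..1, f t * Real.cos (n * π * t)) (z : ℂ) :
    ‖Complex.sin z‖ * ((∫ t in (0 : ℝ)..1, f t) * (|z.im| / ‖z‖ ^ 2)) ≤ ‖cosTransform f z‖ := by
  obtain hs | hs := eq_or_ne (Complex.sin z) 0
  · simp [hs]
  have h := mul_abs_im_div_le_abs_im_of_hasSum hpos (hasSum_cosTransform hf fun k hk =>
    hs (Complex.sin_eq_zero_iff.2 ⟨k, hk⟩))
  have h' := h.trans (Complex.abs_im_le_norm _)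
  rw [norm_div, le_div_iff₀ (norm_pos_iff.2 hs), mul_comm] at h'
  simpa using h'

theorem im_eq_zero_of_cosTransform_eq_zero {f : ℝ → ℝ} (hf : IntervalIntegrable f volume 0 1)
    (hpos : ∀ n : ℤ, 0 < (-1 : ℝ) ^ n * ∫ t in (0 : ℝ)..1, f t * Real.cos (n * π * t))
    {z : ℂ} (hz : cosTransform f z = 0) : z.im = 0 := by
  by_contra hy
  have h := mul_abs_im_le_norm_cosTransform hf hpos z
  have hne := ne_int_mul_pi_of_cosTransform_eq_zero hpos hz
  have hs : Complex.sin z ≠ 0 := sin_ne_zero_of_forall_ne_int_mul_pi hne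
  have h₀ : 0 < ∫ t in (0 : ℝ)..1, f t := by simpa using hpos 0
  have hz₀ : z ≠ 0 := by simpa using hne 0
  rw [hz, norm_zero] at h
  have : 0 < ‖Complex.sin z‖ * ((∫ t in (0 : ℝ)..1, f t) * (|z.im| / ‖z‖ ^ 2)) := by positivity
  linarith

theorem deriv_cosTransform_ne_zero {f : ℝ → ℝ} (hf : IntervalIntegrable f volume 0 1)
    (hpos : ∀ n : ℤ, 0 < (-1 : ℝ) ^ n * ∫ t in (0 : ℝ)..1, f t * Real.cos (n * π * t))
    {z : ℂ} (hz : cosTransform f z = 0) : deriv (cosTransform f) z ≠ 0 := by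
  intro hd
  have him := im_eq_zero_of_cosTransform_eq_zero hf hpos hz
  have hne := ne_int_mul_pi_of_cosTransform_eq_zero hpos hz
  have hs : Complex.sin z ≠ 0 := sin_ne_zero_of_forall_ne_int_mul_pi hne
  have h₀ : 0 < ∫ t in (0 : ℝ)..1, f t := by simpa using hpos 0
  have hz₀ : z ≠ 0 := by simpa using hne 0
  have hderiv := (differentiable_cosTransform hf z).hasDerivAt
  rw [hd, hasDerivAt_iff_tendsto_slope] at hderiv
  let p : ℝ → ℂ := fun y => z + y * Complex.I
  have hpc : Tendsto p (𝓝[>] 0) (𝓝 z) := by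
    have : Continuous p := by fun_prop
    simpa [p] using (this.tendsto 0).mono_left nhdsWithin_le_nhds
  have hp : Tendsto p (𝓝[>] 0) (𝓝[≠] z) := by
    refine tendsto_nhdsWithin_iff.2 ⟨hpc, ?_⟩
    filter_upwards [self_mem_nhdsWithin] with y hy
    have : y ≠ 0 := ne_of_gt hy
    simpa [p] using this
  have hupper := (hderiv.comp hp).norm
  have hlower : Tendsto (fun y => ‖Complex.sin (p y)‖ * ((∫ t in (0 : ℝ)..1, f t) / ‖p y‖ ^ 2))
      (𝓝[>] 0) (𝓝 (‖Complex.sin z‖ * ((∫ t in (0 : ℝ)..1, f t) / ‖z‖ ^ 2))) :=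
    ((Complex.continuous_sin.tendsto z).comp hpc).norm.mul
      (tendsto_const_nhds.div (hpc.norm.pow 2) (by simpa using hz₀))
  have hle := le_of_tendsto_of_tendsto hlower hupper (by
    filter_upwards [self_mem_nhdsWithin] with y hy
    have hy : 0 < y := hy
    have h := mul_abs_im_le_norm_cosTransform hf hpos (p y)
    have e : |(p y).im| = y := by simp [p, him, abs_of_pos hy]
    have e' : p y - z = y * Complex.I := by simp [p]
    rw [e] at h
    rw [Function.comp, slope_def_field, hz, sub_zero, e', norm_div, norm_mul, Complex.norm_I,
      mul_one, Complex.norm_real, Real.norm_of_nonneg hy.le, le_div_iff₀ hy]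
    exact le_of_eq_of_le (by ring) h)
  have : 0 < ‖Complex.sin z‖ * ((∫ t in (0 : ℝ)..1, f t) / ‖z‖ ^ 2) := by positivity
  rw [norm_zero] at hle
  linarith

theorem exists_cosTransform_eq_zero {f : ℝ → ℝ} (hf : IntervalIntegrable f volume 0 1)
    (hpos : ∀ n : ℤ, 0 < (-1 : ℝ) ^ n * ∫ t in (0 : ℝ)..1, f t * Real.cos (n * π * t)) (k : ℤ) :
    ∃ x ∈ Ioo ((k : ℝ) * π) (((k : ℝ) + 1) * π), cosTransform f x = 0 := by
  set u : ℝ → ℝ := fun x => (-1 : ℝ) ^ k * ∫ t in (0 : ℝ)..1, f t * Real.cos (x * t) with hu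
  have hcont : Continuous u := by
    refine continuous_const.mul ?_
    have : Continuous fun x : ℝ => (cosTransform f x).re :=
      Complex.continuous_re.comp
        ((differentiable_cosTransform hf).continuous.comp Complex.continuous_ofReal)
    simpa only [cosTransform_ofReal, Complex.ofReal_re] using this
  have h₁ : 0 < u (k * π) := hpos k
  have h₂ : u ((k + 1) * π) < 0 := by
    have h := hpos (k + 1)
    rw [zpow_add_one₀ (by norm_num)] at h
    push_cast at h
    simp only [hu]
    linarith
  obtain ⟨x, hx, hux⟩ := intermediate_value_Ioo'
    (mul_le_mul_of_nonneg_right (by linarith : (k : ℝ) ≤ k + 1) pi_pos.le)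
    hcont.continuousOn ⟨h₂, h₁⟩
  refine ⟨x, hx, ?_⟩
  rw [cosTransform_ofReal, (mul_eq_zero.1 hux).resolve_left (zpow_ne_zero _ (by norm_num)),
    Complex.ofReal_zero]

theorem cosTransform_ne_zero_of_lt {f : ℝ → ℝ} (hf : IntervalIntegrable f volume 0 1)
    (hpos : ∀ n : ℤ, 0 < (-1 : ℝ) ^ n * ∫ t in (0 : ℝ)..1, f t * Real.cos (n * π * t))
    {k : ℤ} {x y : ℝ} (hx : x ∈ Ioo ((k : ℝ) * π) (((k : ℝ) + 1) * π))
    (hy : y ∈ Ioo ((k : ℝ) * π) (((k : ℝ) + 1) * π)) (hxy : x < y)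
    (hx₀ : cosTransform f x = 0) : cosTransform f y ≠ 0 := by
  intro hy₀
  have h := (hasSum_cosTransform hf (ne_int_mul_pi_of_mem_Ioo hx)).sub
    (hasSum_cosTransform hf (ne_int_mul_pi_of_mem_Ioo hy))
  simp only [hx₀, hy₀, zero_div, sub_zero, ← mul_sub] at h
  have h' : HasSum (fun n : ℤ => ((-1) ^ n * ∫ t in (0 : ℝ)..1, f t * Real.cos (n * π * t)) *
      (x / (x ^ 2 - (n * π) ^ 2) - y / (y ^ 2 - (n * π) ^ 2))) 0 := by
    rw [← Complex.hasSum_ofReal]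
    push_cast at h ⊢
    exact h
  have hterm (n : ℤ) := mul_pos (hpos n) (sub_pos.2 (div_sq_sub_sq_lt (n := n) hx.1 hxy hy.2))
  exact (le_hasSum h' 0 fun n _ => (hterm n).le).not_gt (hterm 0)

theorem integral_cos_int_mul_pi_pos {f : ℝ → ℝ}
    (halt : ∀ n : ℕ, 0 < (-1 : ℝ) ^ n * (2 * ∫ t in (0 : ℝ)..1, f t * Real.cos (n * π * t)))
    (n : ℤ) : 0 < (-1 : ℝ) ^ n * ∫ t in (0 : ℝ)..1, f t * Real.cos (n * π * t) := by
  have hnat (m : ℕ) : 0 < (-1 : ℝ) ^ m * ∫ t in (0 : ℝ)..1, f t * Real.cos (m * π * t) := by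
    linarith [halt m]
  obtain ⟨m, rfl | rfl⟩ := n.eq_nat_or_neg
  · simpa using hnat m
  · simpa [← inv_pow] using hnat m

/-- Hurwitz's theorem on Fourier integrals: if `f : [0,1] → ℝ` is continuous with alternating
Fourier cosine coefficients `(−1)^n·a_n > 0` where `a_n = 2∫_0^1 f(t)cos(nπt)dt`, then every zero
of the entire function `U(z) = ∫_0^1 f(t)cos(zt)dt` is real and simple, and each open interval
`(kπ, (k+1)π)` contains exactly one zero of `U`. -/
theorem hurwitz_fourier_integral_zeros (f : ℝ → ℝ) (hf : ContinuousOn f (Set.Icc 0 1))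
    (halt : ∀ n : ℕ, 0 < (-1 : ℝ) ^ n * (2 * ∫ t in (0 : ℝ)..1, f t * Real.cos (n * π * t))) :
    (∀ z : ℂ, (∫ t in (0 : ℝ)..1, (f t : ℂ) * Complex.cos (z * (t : ℂ))) = 0 →
        z.im = 0 ∧
          deriv (fun w : ℂ => ∫ t in (0 : ℝ)..1, (f t : ℂ) * Complex.cos (w * (t : ℂ))) z ≠ 0) ∧
    (∀ k : ℤ, ∃! x : ℝ, x ∈ Set.Ioo ((k : ℝ) * π) (((k : ℝ) + 1) * π) ∧
        (∫ t in (0 : ℝ)..1, (f t : ℂ) * Complex.cos ((x : ℂ) * (t : ℂ))) = 0) := by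
  have hf' : IntervalIntegrable f volume 0 1 :=
    ContinuousOn.intervalIntegrable (by rwa [uIcc_of_le zero_le_one])
  have hpos := integral_cos_int_mul_pi_pos halt
  refine ⟨fun z hz => ⟨im_eq_zero_of_cosTransform_eq_zero hf' hpos hz,
    deriv_cosTransform_ne_zero hf' hpos hz⟩, fun k => ?_⟩
  obtain ⟨x, hx, hx₀⟩ := exists_cosTransform_eq_zero hf' hpos k
  refine ⟨x, ⟨hx, hx₀⟩, fun y ⟨hy, hy₀⟩ => ?_⟩
  obtain h | h | h := lt_trichotomy x y
  · exact (cosTransform_ne_zero_of_lt hf' hpos hx hy h hx₀ hy₀).elim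
  · exact h.symm
  · exact (cosTransform_ne_zero_of_lt hf' hpos hy hx h hy₀ hx₀).elim
end

section
/- Define Ξ*(z) = 4π²·∫_0^∞ cosh(9u/2)·e^{−2π·cosh(2u)}·cos(uz) du for z ∈ ℂ. Then every zero of Ξ* is real: if Ξ*(z) = 0 for some z ∈ ℂ, then Im z = 0. -/
open Real Filter Set

namespace Macdonald

open MeasureTheory Topology

lemma norm_sq_eq_re_im (z : ℂ) : ‖z‖ ^ 2 = z.re ^ 2 + z.im ^ 2 := by
  rw [← Complex.normSq_eq_norm_sq, Complex.normSq_apply]; ring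

lemma abs_le_one_add_pow_four (τ : ℝ) : |τ| ≤ 1 + τ ^ 4 := by
  rw [abs_le]
  constructor <;> nlinarith [sq_nonneg (τ ^ 2 - 1 / 2), sq_nonneg (τ - 1 / 2), sq_nonneg (τ + 1 / 2)]

lemma sq_le_one_add_pow_four (τ : ℝ) : τ ^ 2 ≤ 1 + τ ^ 4 := by
  nlinarith [sq_nonneg (τ ^ 2 - 1 / 2)]

lemma pow_six_le_cosh (τ : ℝ) : τ ^ 6 / 1440 ≤ cosh τ := by
  rw [← cosh_abs, cosh_eq]
  have h := pow_div_factorial_le_exp |τ| (abs_nonneg τ) 6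
  have h6 : |τ| ^ 6 = τ ^ 6 := by
    rw [show 6 = 2 * 3 from rfl, pow_mul, pow_mul, sq_abs]
  rw [h6] at h
  have hf : ((Nat.factorial 6 : ℕ) : ℝ) = 720 := by norm_num [Nat.factorial]
  rw [hf] at h
  have := exp_pos (-|τ|)
  linarith

lemma exists_exponent_bound {x : ℝ} (hx : 0 < x) (A : ℝ) :
    ∃ C, ∀ τ : ℝ, A * (1 + τ ^ 4) - x * cosh τ ≤ C - τ ^ 2 := by
  set B := |A| + 1 with hB
  set κ := x / 1440 with hκ
  have hκ0 : 0 < κ := by positivity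
  have hB1 : 1 ≤ B := by simp [hB]
  refine ⟨B * (1 + (B / κ) ^ 2) + 1, fun τ ↦ ?_⟩
  have h1 : x * (τ ^ 6 / 1440) ≤ x * cosh τ := by gcongr; exact pow_six_le_cosh τ
  have h2 : A * (1 + τ ^ 4) ≤ |A| * (1 + τ ^ 4) := by gcongr; exact le_abs_self A
  have h3 := sq_le_one_add_pow_four τ
  have h4 : B * τ ^ 4 - κ * τ ^ 6 ≤ B * (B / κ) ^ 2 := by
    rcases le_total (τ ^ 2) (B / κ) with h | h
    · have : τ ^ 4 ≤ (B / κ) ^ 2 := by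
        rw [show τ ^ 4 = (τ ^ 2) ^ 2 by ring]; gcongr
      have h5 : 0 ≤ κ * τ ^ 6 := by positivity
      nlinarith
    · have : B ≤ κ * τ ^ 2 := by rwa [div_le_iff₀' hκ0] at h
      have h5 : B * τ ^ 4 ≤ κ * τ ^ 2 * τ ^ 4 := by gcongr
      have : 0 ≤ B * (B / κ) ^ 2 := by positivity
      nlinarith
  have h5 : x * (τ ^ 6 / 1440) = κ * τ ^ 6 := by rw [hκ]; ring
  nlinarith

/-- A continuous function dominated by `exp (A (1 + τ⁴) - x cosh τ)` is integrable. -/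
lemma integrable_of_norm_le {E : Type*} [NormedAddCommGroup E] [SecondCountableTopology E]
    {g : ℝ → E} (hg : Continuous g) {x : ℝ} (hx : 0 < x) (A : ℝ)
    (h : ∀ τ, ‖g τ‖ ≤ exp (A * (1 + τ ^ 4) - x * cosh τ)) : Integrable g := by
  obtain ⟨C, hC⟩ := exists_exponent_bound hx A
  have hi : Integrable fun τ : ℝ ↦ exp C * exp (-1 * τ ^ 2) :=
    (integrable_exp_neg_mul_sq one_pos).const_mul _
  refine hi.mono' hg.aestronglyMeasurable (ae_of_all _ fun τ ↦ (h τ).trans ?_)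
  rw [← exp_add]
  exact exp_le_exp.2 (by linarith [hC τ])

lemma cosh_pow_le (k : ℕ) (τ : ℝ) : cosh τ ^ k ≤ exp (k * (1 + τ ^ 4)) := by
  rw [exp_nat_mul]
  refine pow_le_pow_left₀ (cosh_pos τ).le ((cosh_le_exp_half_sq τ).trans (exp_le_exp.2 ?_)) k
  nlinarith [sq_le_one_add_pow_four τ, sq_nonneg τ]

lemma mul_le_abs_mul (s τ : ℝ) : s * τ ≤ |s| * (1 + τ ^ 4) := by
  calc s * τ ≤ |s * τ| := le_abs_self _
    _ = |s| * |τ| := abs_mul _ _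
    _ ≤ _ := by gcongr; exact abs_le_one_add_pow_four τ

/-- The integrand of the `k`-th derivative in `x`, up to sign, of `2 K_μ(x)`. -/
noncomputable def kernel (k : ℕ) (μ : ℂ) (x τ : ℝ) : ℂ :=
  ((cosh τ ^ k : ℝ) : ℂ) * Complex.exp (μ * τ - ((x * cosh τ : ℝ) : ℂ))

/-- The moment `∫ cosh(τ)^k exp (μ τ - x cosh τ) dτ`; for `k = 0` this is `2 K_μ(x)`. -/
noncomputable def moment (k : ℕ) (μ : ℂ) (x : ℝ) : ℂ := ∫ τ : ℝ, kernel k μ x τ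

/-- The real counterpart of `kernel`. -/
noncomputable def realKernel (k : ℕ) (s x τ : ℝ) : ℝ := cosh τ ^ k * exp (s * τ - x * cosh τ)

/-- The real counterpart of `moment`. -/
noncomputable def realMoment (k : ℕ) (s x : ℝ) : ℝ := ∫ τ : ℝ, realKernel k s x τ

lemma norm_kernel (k : ℕ) (μ : ℂ) (x τ : ℝ) : ‖kernel k μ x τ‖ = realKernel k μ.re x τ := by
  rw [kernel, realKernel, norm_mul, Complex.norm_exp, Complex.norm_real, norm_of_nonneg
    (pow_nonneg (cosh_pos τ).le k)]
  simp

lemma kernel_ofReal (k : ℕ) (s x τ : ℝ) : kernel k s x τ = realKernel k s x τ := by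
  simp [kernel, realKernel]

lemma continuous_kernel (k : ℕ) (μ : ℂ) (x : ℝ) : Continuous (kernel k μ x) := by
  unfold kernel; fun_prop

lemma continuous_realKernel (k : ℕ) (s x : ℝ) : Continuous (realKernel k s x) := by
  unfold realKernel; fun_prop

lemma realKernel_pos (k : ℕ) (s x τ : ℝ) : 0 < realKernel k s x τ :=
  mul_pos (pow_pos (cosh_pos τ) k) (exp_pos _)

lemma realKernel_le (k : ℕ) (s x τ : ℝ) :
    realKernel k s x τ ≤ exp ((k + |s|) * (1 + τ ^ 4) - x * cosh τ) := by
  rw [show (k + |s|) * (1 + τ ^ 4) - x * cosh τ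
    = k * (1 + τ ^ 4) + (|s| * (1 + τ ^ 4) - x * cosh τ) by ring, exp_add, realKernel]
  refine mul_le_mul (cosh_pow_le k τ) (exp_le_exp.2 ?_) (exp_pos _).le (exp_pos _).le
  linarith [mul_le_abs_mul s τ]

lemma integrable_realKernel (k : ℕ) (s : ℝ) {x : ℝ} (hx : 0 < x) :
    Integrable (realKernel k s x) :=
  integrable_of_norm_le (continuous_realKernel k s x) hx (k + |s|) fun τ ↦ by
    rw [norm_of_nonneg (realKernel_pos k s x τ).le]; exact realKernel_le k s x τ

lemma integrable_kernel (k : ℕ) (μ : ℂ) {x : ℝ} (hx : 0 < x) : Integrable (kernel k μ x) :=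
  integrable_of_norm_le (continuous_kernel k μ x) hx (k + |μ.re|) fun τ ↦ by
    rw [norm_kernel]; exact realKernel_le k _ x τ

lemma norm_moment_le (k : ℕ) (μ : ℂ) (x : ℝ) : ‖moment k μ x‖ ≤ realMoment k μ.re x :=
  (norm_integral_le_integral_norm _).trans_eq (by simp only [norm_kernel]; rfl)

lemma moment_ofReal (k : ℕ) (s x : ℝ) : moment k s x = realMoment k s x := by
  simp only [moment, realMoment, kernel_ofReal]
  exact integral_ofReal

lemma moment_neg (k : ℕ) (μ : ℂ) (x : ℝ) : moment k (-μ) x = moment k μ x := by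
  rw [moment, moment, ← integral_neg_eq_self]
  simp [kernel]

lemma moment_conj (k : ℕ) (μ : ℂ) (x : ℝ) :
    moment k (starRingEnd ℂ μ) x = starRingEnd ℂ (moment k μ x) := by
  rw [moment, moment, ← integral_conj]
  congr 1 with τ
  simp only [kernel, map_mul, ← Complex.exp_conj, map_sub, Complex.conj_ofReal]

lemma norm_moment_conj (k : ℕ) (μ : ℂ) (x : ℝ) :
    ‖moment k (starRingEnd ℂ μ) x‖ = ‖moment k μ x‖ := by
  rw [moment_conj, RCLike.norm_conj]

lemma hasDerivAt_moment (k : ℕ) (μ : ℂ) {x : ℝ} (hx : 0 < x) :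
    HasDerivAt (moment k μ) (-moment (k + 1) μ x) x := by
  have key := hasDerivAt_integral_of_dominated_loc_of_deriv_le (μ := volume)
    (F := fun y τ ↦ kernel k μ y τ) (F' := fun y τ ↦ -kernel (k + 1) μ y τ)
    (s := Ioi (x / 2)) (x₀ := x) (bound := realKernel (k + 1) μ.re (x / 2))
    (Ioi_mem_nhds (by linarith))
    (Eventually.of_forall fun y ↦ (continuous_kernel k μ y).aestronglyMeasurable)
    (integrable_kernel k μ hx) (continuous_kernel (k + 1) μ x).neg.aestronglyMeasurable
    (ae_of_all _ fun τ y hy ↦ ?_) (integrable_realKernel _ _ (by positivity))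
    (ae_of_all _ fun τ y _ ↦ ?_)
  · have := key.2
    rwa [integral_neg] at this
  · rw [norm_neg, norm_kernel, realKernel, realKernel]
    have := cosh_pos τ
    have hy' : x / 2 < y := hy
    gcongr
  · have h1 : HasDerivAt (fun y : ℝ ↦ μ * τ - ((y * cosh τ : ℝ) : ℂ)) (-((cosh τ : ℝ) : ℂ)) y := by
      have := (((hasDerivAt_id y).mul_const (cosh τ)).ofReal_comp).const_sub (μ * τ)
      simpa using this
    have := h1.cexp.const_mul ((cosh τ ^ k : ℝ) : ℂ)
    refine this.congr_deriv ?_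
    simp only [kernel]; push_cast; ring

lemma differentiable_moment_zero {x : ℝ} (hx : 0 < x) : Differentiable ℂ fun μ ↦ moment 0 μ x := by
  intro μ
  have key := hasDerivAt_integral_of_dominated_loc_of_deriv_le (μ := volume)
    (F := fun ν τ ↦ kernel 0 ν x τ) (F' := fun (ν : ℂ) (τ : ℝ) ↦ (τ : ℂ) * kernel 0 ν x τ)
    (s := Metric.ball μ 1) (x₀ := μ)
    (bound := fun τ ↦ exp ((|μ.re| + 2) * (1 + τ ^ 4) - x * cosh τ))
    (Metric.ball_mem_nhds _ one_pos)
    (Eventually.of_forall fun y ↦ (continuous_kernel 0 y x).aestronglyMeasurable)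
    (integrable_kernel 0 μ hx)
    (Complex.continuous_ofReal.mul (continuous_kernel 0 μ x)).aestronglyMeasurable
    (ae_of_all _ fun τ ν hν ↦ ?_)
    (integrable_of_norm_le (by fun_prop) hx (|μ.re| + 2) fun τ ↦ by simp)
    (ae_of_all _ fun τ ν _ ↦ ?_)
  · exact key.2.differentiableAt
  · have h1 : |ν.re| ≤ |μ.re| + 1 := by
      have h2 := (Complex.abs_re_le_norm (ν - μ)).trans (mem_ball_iff_norm.1 hν).le
      rw [Complex.sub_re] at h2
      linarith [abs_sub_abs_le_abs_sub ν.re μ.re]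
    rw [norm_mul, norm_kernel, Complex.norm_real, Real.norm_eq_abs]
    have h3 : |τ| ≤ exp (1 + τ ^ 4) :=
      (abs_le_one_add_pow_four τ).trans (by linarith [add_one_le_exp (1 + τ ^ 4)])
    calc |τ| * realKernel 0 ν.re x τ
        ≤ exp (1 + τ ^ 4) * exp ((|ν.re|) * (1 + τ ^ 4) - x * cosh τ) := by
          have := realKernel_le 0 ν.re x τ
          have h0 := (realKernel_pos 0 ν.re x τ).le
          simp only [Nat.cast_zero, zero_add] at this
          gcongr
      _ ≤ _ := by
          rw [← exp_add]
          refine exp_le_exp.2 ?_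
          nlinarith [show 0 ≤ 1 + τ ^ 4 by positivity]
  · have h1 : HasDerivAt (fun ν : ℂ ↦ ν * τ - ((x * cosh τ : ℝ) : ℂ)) (τ : ℂ) ν := by
      simpa using ((hasDerivAt_id ν).mul_const (τ : ℂ)).sub_const ((x * cosh τ : ℝ) : ℂ)
    have := h1.cexp.const_mul ((cosh τ ^ 0 : ℝ) : ℂ)
    refine this.congr_deriv ?_
    simp only [kernel]; ring

/-- The modified Bessel equation. -/
lemma bessel_equation (μ : ℂ) {x : ℝ} (hx : 0 < x) :
    (x : ℂ) ^ 2 * moment 2 μ x = x * moment 1 μ x + ((x : ℂ) ^ 2 + μ ^ 2) * moment 0 μ x := by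
  have hd : ∀ τ : ℝ, HasDerivAt
      (fun τ : ℝ ↦ (((x * sinh τ : ℝ) : ℂ) + μ) * Complex.exp (μ * τ - ((x * cosh τ : ℝ) : ℂ)))
      (x * kernel 1 μ x τ + ((x : ℂ) ^ 2 + μ ^ 2) * kernel 0 μ x τ
        - (x : ℂ) ^ 2 * kernel 2 μ x τ) τ := by
    intro τ
    have h1 : HasDerivAt (fun τ : ℝ ↦ ((x * sinh τ : ℝ) : ℂ) + μ) ((x * cosh τ : ℝ) : ℂ) τ := by
      simpa using (((hasDerivAt_sinh τ).const_mul x).ofReal_comp).add_const μ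
    have h2 : HasDerivAt (fun τ : ℝ ↦ μ * τ - ((x * cosh τ : ℝ) : ℂ))
        (μ - ((x * sinh τ : ℝ) : ℂ)) τ := by
      have := ((hasDerivAt_id τ).ofReal_comp.const_mul μ).sub
        (((hasDerivAt_cosh τ).const_mul x).ofReal_comp)
      refine this.congr_deriv ?_
      simp
    refine (h1.mul h2.cexp).congr_deriv ?_
    have h3 : ((cosh τ : ℝ) : ℂ) ^ 2 = ((sinh τ : ℝ) : ℂ) ^ 2 + 1 := by
      exact_mod_cast cosh_sq τ
    simp only [kernel]
    push_cast at h3 ⊢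
    linear_combination ((x : ℂ) ^ 2 * Complex.exp (μ * τ - x * Complex.cosh τ)) * h3
  have i0 := integrable_kernel 0 μ hx
  have i1 := integrable_kernel 1 μ hx
  have i2 := integrable_kernel 2 μ hx
  have h_int : Integrable
      (fun τ : ℝ ↦ (((x * sinh τ : ℝ) : ℂ) + μ) * Complex.exp (μ * τ - ((x * cosh τ : ℝ) : ℂ))) := by
    refine Integrable.mono' ((i1.norm.const_mul x).add (i0.norm.const_mul ‖μ‖))
      (by fun_prop) (ae_of_all _ fun τ ↦ ?_)
    simp only [Pi.add_apply, norm_kernel]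
    rw [norm_mul, realKernel, realKernel, Complex.norm_exp]
    have h4 : ‖((x * sinh τ : ℝ) : ℂ) + μ‖ ≤ x * cosh τ + ‖μ‖ := by
      refine (norm_add_le _ _).trans ?_
      gcongr
      rw [Complex.norm_real, norm_mul, norm_of_nonneg hx.le, Real.norm_eq_abs]
      gcongr
      rw [abs_le]; constructor
      · linarith [cosh_add_sinh τ, exp_pos τ]
      · exact (sinh_lt_cosh τ).le
    refine (mul_le_mul_of_nonneg_right h4 (exp_pos _).le).trans_eq ?_
    simp; ring
  have := integral_eq_zero_of_hasDerivAt_of_integrable hd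
    (((i1.const_mul _).add (i0.const_mul _)).sub (i2.const_mul _)) h_int
  rw [integral_sub, integral_add, integral_const_mul, integral_const_mul, integral_const_mul] at this
  · simp only [moment]
    linear_combination -this
  · exact i1.const_mul _
  · exact i0.const_mul _
  · exact (i1.const_mul _).add (i0.const_mul _)
  · exact i2.const_mul _

lemma realMoment_le_exp_neg (k : ℕ) (s : ℝ) {x : ℝ} (hx : 1 ≤ x) :
    realMoment k s x ≤ exp 1 * realMoment k s 1 * exp (-x) := by
  have : exp 1 * realMoment k s 1 * exp (-x) = ∫ τ, exp (1 - x) * realKernel k s 1 τ := by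
    rw [integral_const_mul, sub_eq_add_neg, exp_add, realMoment]; ring
  rw [this]
  refine integral_mono (integrable_realKernel k s (by linarith))
    ((integrable_realKernel k s one_pos).const_mul _) fun τ ↦ ?_
  simp only [realKernel]
  rw [mul_left_comm, ← exp_add]
  have := one_le_cosh τ
  have := pow_pos (cosh_pos τ) k
  gcongr
  nlinarith

lemma exists_norm_moment_le_exp_neg (k : ℕ) (μ : ℂ) :
    ∃ C, 0 ≤ C ∧ ∀ x, 1 ≤ x → ‖moment k μ x‖ ≤ C * exp (-x) :=
  ⟨exp 1 * realMoment k μ.re 1,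
    mul_nonneg (exp_pos _).le (integral_nonneg fun τ ↦ (realKernel_pos _ _ _ τ).le),
    fun x hx ↦ (norm_moment_le k μ x).trans (realMoment_le_exp_neg k μ.re hx)⟩

lemma self_le_mul_sinh (τ : ℝ) : τ ^ 2 ≤ τ * sinh τ := by
  rcases le_total 0 τ with h | h
  · nlinarith [self_le_sinh_iff.2 h]
  · nlinarith [sinh_le_self_iff.2 h]

lemma integral_ibp_realKernel (s : ℝ) {b : ℝ} (hb : 0 < b) :
    Integrable (fun τ ↦ (1 + s * τ - b * (τ * sinh τ)) * realKernel 0 s b τ) ∧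
      ∫ τ, (1 + s * τ - b * (τ * sinh τ)) * realKernel 0 s b τ = 0 := by
  have hτ (τ : ℝ) : |τ| ≤ exp (1 + τ ^ 4) :=
    (abs_le_one_add_pow_four τ).trans (by linarith [add_one_le_exp (1 + τ ^ 4)])
  have hi1 : Integrable fun τ ↦ τ * realKernel 0 s b τ := by
    refine integrable_of_norm_le (continuous_id.mul (continuous_realKernel 0 s b)) hb (1 + |s|)
      fun τ ↦ ?_
    rw [norm_mul, norm_of_nonneg (realKernel_pos _ _ _ _).le, Real.norm_eq_abs,
      show (1 + |s|) * (1 + τ ^ 4) - b * cosh τ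
        = (1 + τ ^ 4) + (((0 : ℕ) + |s|) * (1 + τ ^ 4) - b * cosh τ) by push_cast; ring, exp_add]
    have := (realKernel_pos 0 s b τ).le
    exact mul_le_mul (hτ τ) (realKernel_le 0 s b τ) this (exp_pos _).le
  have hi2 : Integrable fun τ ↦ τ * sinh τ * realKernel 0 s b τ := by
    refine integrable_of_norm_le ((continuous_id.mul continuous_sinh).mul
      (continuous_realKernel 0 s b)) hb (2 + |s|) fun τ ↦ ?_
    rw [norm_mul, norm_mul, norm_of_nonneg (realKernel_pos _ _ _ _).le, Real.norm_eq_abs,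
      Real.norm_eq_abs, show (2 + |s|) * (1 + τ ^ 4) - b * cosh τ
        = (1 + τ ^ 4) + (1 + τ ^ 4) + (((0 : ℕ) + |s|) * (1 + τ ^ 4) - b * cosh τ) by
          push_cast; ring, exp_add, exp_add]
    have h1 : |sinh τ| ≤ exp (1 + τ ^ 4) := by
      have : |sinh τ| ≤ cosh τ := by
        rw [abs_le]
        exact ⟨by linarith [cosh_add_sinh τ, exp_pos τ], (sinh_lt_cosh τ).le⟩
      simpa using this.trans (by simpa using cosh_pow_le 1 τ)
    have := (realKernel_pos 0 s b τ).le
    exact mul_le_mul (mul_le_mul (hτ τ) h1 (abs_nonneg _) (exp_pos _).le)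
      (realKernel_le 0 s b τ) this (by positivity)
  have hi0 := integrable_realKernel 0 s hb
  have h_int : Integrable (fun τ ↦ (1 + s * τ - b * (τ * sinh τ)) * realKernel 0 s b τ) := by
    have := (hi0.add (hi1.const_mul s)).sub (hi2.const_mul b)
    refine this.congr (ae_of_all _ fun τ ↦ ?_)
    simp only [Pi.add_apply, Pi.sub_apply]; ring
  refine ⟨h_int, integral_eq_zero_of_hasDerivAt_of_integrable (fun τ ↦ ?_) h_int hi1⟩
  have h2 : HasDerivAt (realKernel 0 s b) ((s - b * sinh τ) * realKernel 0 s b τ) τ := by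
    have h3 : HasDerivAt (fun τ ↦ s * τ - b * cosh τ) (s - b * sinh τ) τ := by
      refine (((hasDerivAt_id τ).const_mul s).sub
        ((hasDerivAt_cosh τ).const_mul b)).congr_deriv ?_
      simp
    have h4 := h3.exp.const_mul (cosh τ ^ 0)
    simp only [pow_zero, one_mul] at h4
    unfold realKernel
    simp only [pow_zero, one_mul]
    refine h4.congr_deriv (by ring)
  refine ((hasDerivAt_id τ).mul h2).congr_deriv ?_
  simp only [id]; ring

lemma re_kernel_zero (μ : ℂ) (b τ : ℝ) :
    (kernel 0 μ b τ).re = realKernel 0 μ.re b τ * cos (μ.im * τ) := by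
  simp [kernel, realKernel, Complex.exp_re]

lemma half_realMoment_le (μ : ℂ) {b : ℝ} (hb : 1 ≤ b) (hb' : 2 * ‖μ‖ ^ 2 ≤ b) :
    realMoment 0 μ.re b / 2 ≤ ‖moment 0 μ b‖ := by
  refine le_trans ?_ (Complex.re_le_norm _)
  have hb0 : 0 < b := by linarith
  obtain ⟨hi, h0⟩ := integral_ibp_realKernel μ.re hb0
  have hre : (moment 0 μ b).re = ∫ τ, (kernel 0 μ b τ).re := by
    rw [moment]; exact (integral_re (integrable_kernel 0 μ hb0)).symm
  have hE := integrable_realKernel 0 μ.re hb0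
  have : realMoment 0 μ.re b / 2 = ∫ τ, (realKernel 0 μ.re b τ / 2
      + (1 / 3) * ((1 + μ.re * τ - b * (τ * sinh τ)) * realKernel 0 μ.re b τ)) := by
    rw [integral_add (hE.div_const 2) (hi.const_mul _), integral_const_mul, h0, integral_div,
      realMoment]
    ring
  rw [this, hre]
  refine integral_mono ((hE.div_const 2).add (hi.const_mul _)) (integrable_kernel 0 μ hb0).re
    fun τ ↦ ?_
  simp only [re_kernel_zero]
  have hE0 := realKernel_pos 0 μ.re b τ
  have hcos := one_sub_sq_div_two_le_cos (x := μ.im * τ)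
  have hsinh := self_le_mul_sinh τ
  have key : 1 / 2 + (1 / 3) * (1 + μ.re * τ - b * (τ * sinh τ)) ≤ cos (μ.im * τ) := by
    refine le_trans ?_ hcos
    have h1 : b * τ ^ 2 ≤ b * (τ * sinh τ) := by gcongr
    have h2 : 2 * (μ.re ^ 2 + μ.im ^ 2) * τ ^ 2 ≤ b * τ ^ 2 := by
      rw [← norm_sq_eq_re_im]; gcongr
    nlinarith [sq_nonneg (1 - μ.re * τ), sq_nonneg (μ.re * τ), sq_nonneg (μ.im * τ)]
  calc _ = realKernel 0 μ.re b τ * (1 / 2 + (1 / 3) * (1 + μ.re * τ - b * (τ * sinh τ))) := by ring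
    _ ≤ _ := by gcongr

lemma cosh_le_one_add_sq {τ : ℝ} (h : τ ^ 2 ≤ 1) : cosh τ ≤ 1 + τ ^ 2 := by
  refine (cosh_le_exp_half_sq τ).trans ?_
  have h0 := sq_nonneg τ
  have := exp_bound_div_one_sub_of_interval (x := τ ^ 2 / 2) (by positivity) (by linarith)
  refine this.trans ?_
  rw [div_le_iff₀ (by linarith)]
  nlinarith

lemma le_realMoment_zero {s b : ℝ} (hs : 0 ≤ s) (hb : 1 ≤ b) :
    exp (-b - 1) / b ≤ realMoment 0 s b := by
  have hb0 : 0 < b := by linarith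
  have hi := integrable_realKernel 0 s hb0
  have h1 : ∫ τ in Icc 0 (1 / b), realKernel 0 s b τ ≤ realMoment 0 s b :=
    setIntegral_le_integral hi (ae_of_all _ fun τ ↦ (realKernel_pos 0 s b τ).le)
  refine le_trans ?_ h1
  have h2 : exp (-b - 1) / b = ∫ τ in Icc (0 : ℝ) (1 / b), exp (-b - 1) := by
    simp [integral_const, hb0.le, div_eq_inv_mul]
  rw [h2]
  refine setIntegral_mono_on (by simp) hi.integrableOn measurableSet_Icc fun τ hτ ↦ ?_
  have h3 : b * τ ≤ 1 := by
    have := hτ.2; rwa [le_div_iff₀' hb0] at this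
  have h4 : τ ≤ 1 := by nlinarith [hτ.1]
  have h5 : b * cosh τ ≤ b + 1 := by
    have h6 := cosh_le_one_add_sq (τ := τ) (by nlinarith [hτ.1])
    have h7 : b * cosh τ ≤ b * (1 + τ ^ 2) := by gcongr
    nlinarith [hτ.1]
  simp only [realKernel, pow_zero, one_mul]
  refine exp_le_exp.2 ?_
  nlinarith [mul_nonneg hs hτ.1]

lemma nonpos_of_deriv_nonneg_of_tendsto {T T' : ℝ → ℝ} {x₀ : ℝ}
    (h : ∀ x, x₀ ≤ x → HasDerivAt T (T' x) x) (h' : ∀ x, x₀ ≤ x → 0 ≤ T' x)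
    (hlim : Tendsto T atTop (𝓝 0)) : T x₀ ≤ 0 := by
  have hmono : MonotoneOn T (Ici x₀) := by
    refine monotoneOn_of_deriv_nonneg (convex_Ici x₀)
      (fun x hx ↦ (h x hx).continuousAt.continuousWithinAt)
      (fun x hx ↦ (h x (interior_subset hx)).differentiableAt.differentiableWithinAt)
      fun x hx ↦ ?_
    rw [(h x (interior_subset hx)).deriv]
    exact h' x (interior_subset hx)
  refine ge_of_tendsto hlim ?_
  filter_upwards [eventually_ge_atTop x₀] with x hx
  exact hmono self_mem_Ici hx hx

lemma tendsto_zero_of_le_mul_exp {T : ℝ → ℝ} {C x₀ : ℝ}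
    (h : ∀ x, x₀ ≤ x → |T x| ≤ C * (x * (exp (-x) * exp (-x)))) : Tendsto T atTop (𝓝 0) := by
  have h1 : Tendsto (fun x : ℝ ↦ C * (x ^ 1 * exp (-x) * exp (-x))) atTop (𝓝 (C * (0 * 0))) :=
    ((tendsto_pow_mul_exp_neg_atTop_nhds_zero 1).mul
      (tendsto_exp_atBot.comp tendsto_neg_atTop_atBot)).const_mul C
  rw [zero_mul, mul_zero] at h1
  refine squeeze_zero_norm' ?_ h1
  filter_upwards [eventually_ge_atTop x₀] with x hx
  refine (h x hx).trans_eq ?_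
  ring

lemma hasDerivAt_re_moment (k : ℕ) (μ : ℂ) {x : ℝ} (hx : 0 < x) :
    HasDerivAt (fun x ↦ (moment k μ x).re) (-(moment (k + 1) μ x).re) x := by
  exact (Complex.reCLM.hasFDerivAt.comp_hasDerivAt x (hasDerivAt_moment k μ hx)).congr_deriv (by simp)

lemma hasDerivAt_im_moment (k : ℕ) (μ : ℂ) {x : ℝ} (hx : 0 < x) :
    HasDerivAt (fun x ↦ (moment k μ x).im) (-(moment (k + 1) μ x).im) x := by
  exact (Complex.imCLM.hasFDerivAt.comp_hasDerivAt x (hasDerivAt_moment k μ hx)).congr_deriv (by simp)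

lemma re_bessel_equation (μ : ℂ) {x : ℝ} (hx : 0 < x) :
    x ^ 2 * (moment 2 μ x).re = x * (moment 1 μ x).re
      + (x ^ 2 + μ.re ^ 2 - μ.im ^ 2) * (moment 0 μ x).re
      - 2 * μ.re * μ.im * (moment 0 μ x).im := by
  have := congrArg Complex.re (bessel_equation μ hx)
  simp [pow_two] at this
  linear_combination this

lemma im_bessel_equation (μ : ℂ) {x : ℝ} (hx : 0 < x) :
    x ^ 2 * (moment 2 μ x).im = x * (moment 1 μ x).im
      + (x ^ 2 + μ.re ^ 2 - μ.im ^ 2) * (moment 0 μ x).im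
      + 2 * μ.re * μ.im * (moment 0 μ x).re := by
  have := congrArg Complex.im (bessel_equation μ hx)
  simp [pow_two] at this
  linear_combination this

/-- The logarithmic derivative of `‖K_μ(x)‖` is at most that of `exp (-x - (im μ)² / x)`
when `|im μ| ≤ x`. -/
lemma logDeriv_bound (μ : ℂ) {x : ℝ} (hx : 0 < x) (hxt : |μ.im| ≤ x) :
    -x * ((moment 1 μ x).re * (moment 0 μ x).re + (moment 1 μ x).im * (moment 0 μ x).im)
      - (-x + μ.im ^ 2 / x) * ((moment 0 μ x).re ^ 2 + (moment 0 μ x).im ^ 2) ≤ 0 := by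
  set t := μ.im
  refine nonpos_of_deriv_nonneg_of_tendsto (T := fun x ↦
    -x * ((moment 1 μ x).re * (moment 0 μ x).re + (moment 1 μ x).im * (moment 0 μ x).im)
      - (-x + t ^ 2 / x) * ((moment 0 μ x).re ^ 2 + (moment 0 μ x).im ^ 2))
    (T' := fun y ↦ ((y * (moment 1 μ y).re + (-y + t ^ 2 / y) * (moment 0 μ y).re) ^ 2
      + (y * (moment 1 μ y).im + (-y + t ^ 2 / y) * (moment 0 μ y).im) ^ 2
      + (μ.re ^ 2 + t ^ 2 * (1 - t ^ 2 / y ^ 2) + y + t ^ 2 / y)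
        * ((moment 0 μ y).re ^ 2 + (moment 0 μ y).im ^ 2)) / y) ?_ ?_ ?_
  · intro y hy
    have hy0 : 0 < y := hx.trans_le hy
    have a0 := hasDerivAt_re_moment 0 μ hy0
    have b0 := hasDerivAt_im_moment 0 μ hy0
    have a1 := hasDerivAt_re_moment 1 μ hy0
    have b1 := hasDerivAt_im_moment 1 μ hy0
    have hφ : HasDerivAt (fun y : ℝ ↦ -y + t ^ 2 / y) (-1 - t ^ 2 / y ^ 2) y := by
      refine ((hasDerivAt_id y).neg.add
        ((hasDerivAt_inv hy0.ne').const_mul (t ^ 2))).congr_deriv ?_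
      field_simp; ring
    have := ((hasDerivAt_id y).neg.mul ((a1.mul a0).add (b1.mul b0))).sub
      (hφ.mul ((a0.pow 2).add (b0.pow 2)))
    refine this.congr_deriv ?_
    have e1 := re_bessel_equation μ hy0
    have e2 := im_bessel_equation μ hy0
    simp only [id, Pi.add_apply, Pi.mul_apply, Pi.pow_apply, Pi.neg_apply, zero_add,
      Nat.reduceAdd] at e1 e2 ⊢
    rw [eq_div_iff hy0.ne']
    have hq : t ^ 2 / y * y = t ^ 2 := by field_simp
    have hr : t ^ 2 / y ^ 2 * y = t ^ 2 / y := by field_simp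
    generalize t ^ 2 / y ^ 2 = r at *
    generalize t ^ 2 / y = q at *
    push_cast
    linear_combination (moment 0 μ y).re * e1 + (moment 0 μ y).im * e2
      + ((moment 0 μ y).re ^ 2 + (moment 0 μ y).im ^ 2) * ((2 - r) * hq + (1 + q) * hr)
  · intro y hy
    have hy0 : 0 < y := hx.trans_le hy
    have h1 : t ^ 2 / y ^ 2 ≤ 1 := by
      rw [div_le_one (by positivity), ← sq_abs t]
      have := hxt.trans hy
      gcongr
    have h2 : 0 ≤ t ^ 2 * (1 - t ^ 2 / y ^ 2) := mul_nonneg (sq_nonneg _) (by linarith)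
    positivity
  · obtain ⟨C0, hC0, h0⟩ := exists_norm_moment_le_exp_neg 0 μ
    obtain ⟨C1, hC1, h1⟩ := exists_norm_moment_le_exp_neg 1 μ
    refine tendsto_zero_of_le_mul_exp (C := 2 * (C1 * C0) + 2 * (C0 * C0)) (x₀ := max 1 x)
      fun y hy ↦ ?_
    have hy1 : 1 ≤ y := (le_max_left _ _).trans hy
    have hy0 : 0 < y := by linarith
    have hyt : |t| ≤ y := hxt.trans ((le_max_right _ _).trans hy)
    have hφ : |(-y + t ^ 2 / y)| ≤ y := by
      have h3 : t ^ 2 / y ≤ y := by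
        rw [div_le_iff₀ hy0, ← sq_abs t]; nlinarith [abs_nonneg t]
      have h4 : 0 ≤ t ^ 2 / y := by positivity
      rw [abs_le]; constructor <;> linarith
    have r0 := (Complex.abs_re_le_norm _).trans (h0 y hy1)
    have i0 := (Complex.abs_im_le_norm _).trans (h0 y hy1)
    have r1 := (Complex.abs_re_le_norm _).trans (h1 y hy1)
    have i1 := (Complex.abs_im_le_norm _).trans (h1 y hy1)
    have he := exp_pos (-y)
    calc _ ≤ |y| * (|(moment 1 μ y).re| * |(moment 0 μ y).re|
            + |(moment 1 μ y).im| * |(moment 0 μ y).im|)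
          + |(-y + t ^ 2 / y)| * (|(moment 0 μ y).re| ^ 2 + |(moment 0 μ y).im| ^ 2) := by
          refine (abs_sub _ _).trans ?_
          rw [abs_mul, abs_mul, abs_neg]
          gcongr
          · refine (abs_add_le _ _).trans ?_
            rw [abs_mul, abs_mul]
          · refine (abs_add_le _ _).trans ?_
            rw [abs_pow, abs_pow]
      _ ≤ y * (C1 * exp (-y) * (C0 * exp (-y)) + C1 * exp (-y) * (C0 * exp (-y)))
          + y * ((C0 * exp (-y)) ^ 2 + (C0 * exp (-y)) ^ 2) := by
          rw [abs_of_pos hy0]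
          gcongr
      _ = _ := by ring

lemma norm_moment_mul_exp_antitone (μ : ℂ) {x b : ℝ} (hx : 0 < x) (hxt : |μ.im| ≤ x) (hb : x ≤ b) :
    ‖moment 0 μ b‖ * exp (b + μ.im ^ 2 / b) ≤ ‖moment 0 μ x‖ * exp (x + μ.im ^ 2 / x) := by
  set t := μ.im
  have hd : ∀ y, x ≤ y → HasDerivAt
      (fun y ↦ ((moment 0 μ y).re ^ 2 + (moment 0 μ y).im ^ 2) * exp (2 * (y + t ^ 2 / y)))
      (2 / y * (-y * ((moment 1 μ y).re * (moment 0 μ y).re + (moment 1 μ y).im * (moment 0 μ y).im)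
        - (-y + t ^ 2 / y) * ((moment 0 μ y).re ^ 2 + (moment 0 μ y).im ^ 2))
        * exp (2 * (y + t ^ 2 / y))) y := by
    intro y hy
    have hy0 : 0 < y := hx.trans_le hy
    have a0 := hasDerivAt_re_moment 0 μ hy0
    have b0 := hasDerivAt_im_moment 0 μ hy0
    have hφ : HasDerivAt (fun y : ℝ ↦ 2 * (y + t ^ 2 / y)) (2 * (1 - t ^ 2 / y ^ 2)) y := by
      refine (((hasDerivAt_id y).add
        ((hasDerivAt_inv hy0.ne').const_mul (t ^ 2))).const_mul 2).congr_deriv ?_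
      ring
    refine (((a0.pow 2).add (b0.pow 2)).mul hφ.exp).congr_deriv ?_
    simp only [Pi.add_apply, Pi.pow_apply]
    field_simp
    push_cast
    ring
  have hanti : AntitoneOn
      (fun y ↦ ((moment 0 μ y).re ^ 2 + (moment 0 μ y).im ^ 2) * exp (2 * (y + t ^ 2 / y)))
      (Ici x) := by
    refine antitoneOn_of_deriv_nonpos (convex_Ici x)
      (fun y hy ↦ (hd y hy).continuousAt.continuousWithinAt)
      (fun y hy ↦ (hd y (interior_subset hy)).differentiableAt.differentiableWithinAt)
      fun y hy ↦ ?_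
    have hy' : x ≤ y := interior_subset hy
    have hy0 : 0 < y := hx.trans_le hy'
    rw [(hd y hy').deriv]
    exact mul_nonpos_of_nonpos_of_nonneg (mul_nonpos_of_nonneg_of_nonpos (by positivity)
      (logDeriv_bound μ hy0 (hxt.trans hy'))) (exp_pos _).le
  have := hanti (self_mem_Ici) hb hb
  simp only [← norm_sq_eq_re_im] at this
  have e (y : ℝ) : ‖moment 0 μ y‖ ^ 2 * exp (2 * (y + t ^ 2 / y))
      = (‖moment 0 μ y‖ * exp (y + t ^ 2 / y)) ^ 2 := by
    rw [mul_pow, ← exp_nat_mul]; norm_num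
  rw [e, e] at this
  exact le_of_sq_le_sq this (by positivity)

lemma exp_le_norm_moment_of_abs_im_le {μ : ℂ} (hμ : 0 ≤ μ.re) {x : ℝ} (hx : 0 < x)
    (hxt : |μ.im| ≤ x) : exp (-(3 + 4 * x + 3 * ‖μ‖)) ≤ ‖moment 0 μ x‖ := by
  set t := μ.im
  set b := 2 * ‖μ‖ ^ 2 + x + 1 with hb
  have hn := norm_nonneg μ
  have hb1 : 1 ≤ b := by nlinarith
  have hb0 : 0 < b := by linarith
  have h1 := norm_moment_mul_exp_antitone μ hx hxt (b := b) (by nlinarith)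
  have h2 := half_realMoment_le μ hb1 (by linarith)
  have h3 := le_realMoment_zero hμ hb1
  have h4 : t ^ 2 / x ≤ x := by
    rw [div_le_iff₀ hx, ← sq_abs t]; nlinarith [abs_nonneg t]
  have h5 : exp b ≤ exp (b + t ^ 2 / b) := exp_le_exp.2 (le_add_of_nonneg_right (by positivity))
  have h6 : exp (-1) / (2 * b) ≤ ‖moment 0 μ x‖ * exp (2 * x) := by
    calc exp (-1) / (2 * b) = exp (-b - 1) / b / 2 * exp b := by
          rw [show (-1 : ℝ) = (-b - 1) + b by ring, exp_add]
          field_simp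
      _ ≤ ‖moment 0 μ b‖ * exp (b + t ^ 2 / b) := by
          gcongr; linarith
      _ ≤ _ := h1
      _ ≤ _ := by gcongr; linarith
  have h7 : 2 * b ≤ exp (2 + 2 * x + 3 * ‖μ‖) := by
    have h9 := quadratic_le_exp_of_nonneg (x := 2 + 2 * x + 3 * ‖μ‖) (by positivity)
    nlinarith
  have h8 : exp (-1) / exp (2 + 2 * x + 3 * ‖μ‖) ≤ exp (-1) / (2 * b) := by gcongr
  have h10 := h8.trans h6
  rw [← exp_sub] at h10
  have h11 : exp (-(3 + 4 * x + 3 * ‖μ‖))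
      = exp (-1 - (2 + 2 * x + 3 * ‖μ‖)) * exp (-(2 * x)) := by rw [← exp_add]; ring_nf
  rw [h11]
  calc _ ≤ ‖moment 0 μ x‖ * exp (2 * x) * exp (-(2 * x)) := by gcongr
    _ = _ := by rw [mul_assoc, ← exp_add]; simp

/-- The Wronskian of `K_μ` and its conjugate. -/
lemma hasDerivAt_wronskian (μ : ℂ) {x : ℝ} (hx : 0 < x) :
    HasDerivAt (fun x ↦ x * ((moment 1 μ x).im * (moment 0 μ x).re
        - (moment 1 μ x).re * (moment 0 μ x).im))
      (-(2 * μ.re * μ.im * ‖moment 0 μ x‖ ^ 2 / x)) x := by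
  have a0 := hasDerivAt_re_moment 0 μ hx
  have b0 := hasDerivAt_im_moment 0 μ hx
  have a1 := hasDerivAt_re_moment 1 μ hx
  have b1 := hasDerivAt_im_moment 1 μ hx
  refine ((hasDerivAt_id x).mul ((b1.mul a0).sub (a1.mul b0))).congr_deriv ?_
  have e1 := re_bessel_equation μ hx
  have e2 := im_bessel_equation μ hx
  simp only [id, Pi.sub_apply, Pi.mul_apply, zero_add, Nat.reduceAdd] at e1 e2 ⊢
  rw [norm_sq_eq_re_im, ← neg_div, eq_div_iff hx.ne']
  linear_combination (moment 0 μ x).im * e1 - (moment 0 μ x).re * e2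

lemma tendsto_wronskian (μ : ℂ) :
    Tendsto (fun x ↦ x * ((moment 1 μ x).im * (moment 0 μ x).re
        - (moment 1 μ x).re * (moment 0 μ x).im)) atTop (𝓝 0) := by
  obtain ⟨C0, hC0, h0⟩ := exists_norm_moment_le_exp_neg 0 μ
  obtain ⟨C1, hC1, h1⟩ := exists_norm_moment_le_exp_neg 1 μ
  refine tendsto_zero_of_le_mul_exp (C := 2 * (C1 * C0)) (x₀ := 1) fun y hy ↦ ?_
  have hy0 : 0 < y := by linarith
  have r0 := (Complex.abs_re_le_norm _).trans (h0 y hy)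
  have i0 := (Complex.abs_im_le_norm _).trans (h0 y hy)
  have r1 := (Complex.abs_re_le_norm _).trans (h1 y hy)
  have i1 := (Complex.abs_im_le_norm _).trans (h1 y hy)
  calc _ ≤ y * (|(moment 1 μ y).im| * |(moment 0 μ y).re|
            + |(moment 1 μ y).re| * |(moment 0 μ y).im|) := by
          rw [abs_mul, abs_of_pos hy0]
          gcongr
          refine (abs_sub _ _).trans ?_
          rw [abs_mul, abs_mul]
    _ ≤ y * (C1 * exp (-y) * (C0 * exp (-y)) + C1 * exp (-y) * (C0 * exp (-y))) := by gcongr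
    _ = _ := by ring

lemma exists_realMoment_le (k : ℕ) {x : ℝ} (hx : 0 < x) :
    ∃ C, 0 < C ∧ ∀ s, realMoment k s x ≤ C * exp (|s| ^ (3 / 2 : ℝ)) := by
  have hi : Integrable fun τ ↦ cosh τ ^ k * exp (|τ| ^ 3 - x * cosh τ) := by
    refine integrable_of_norm_le (by fun_prop) hx (k + 1) fun τ ↦ ?_
    rw [norm_of_nonneg (mul_pos (pow_pos (cosh_pos τ) k) (exp_pos _)).le,
      show ((k : ℝ) + 1) * (1 + τ ^ 4) - x * cosh τ
        = k * (1 + τ ^ 4) + ((1 + τ ^ 4) - x * cosh τ) by ring, exp_add]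
    refine mul_le_mul (cosh_pow_le k τ) (exp_le_exp.2 ?_) (exp_pos _).le (exp_pos _).le
    have h1 : |τ| ^ 4 = τ ^ 4 := by rw [show 4 = 2 * 2 from rfl, pow_mul, pow_mul, sq_abs]
    have : |τ| ^ 3 ≤ 1 + τ ^ 4 := by
      rw [← h1]
      nlinarith [sq_nonneg (|τ| ^ 2 - |τ|), sq_nonneg (|τ| - 1), sq_nonneg (|τ| ^ 2 - 1),
        abs_nonneg τ, sq_nonneg (|τ| ^ 2 - |τ| / 2)]
    linarith
  refine ⟨(∫ τ, cosh τ ^ k * exp (|τ| ^ 3 - x * cosh τ)) + 1, ?_, fun s ↦ ?_⟩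
  · have : 0 ≤ ∫ τ, cosh τ ^ k * exp (|τ| ^ 3 - x * cosh τ) :=
      integral_nonneg fun τ ↦ (mul_pos (pow_pos (cosh_pos τ) k) (exp_pos _)).le
    linarith
  have h1 : realMoment k s x
      ≤ (∫ τ, cosh τ ^ k * exp (|τ| ^ 3 - x * cosh τ)) * exp (|s| ^ (3 / 2 : ℝ)) := by
    rw [realMoment, ← integral_mul_const]
    refine integral_mono (integrable_realKernel k s hx) (hi.mul_const _) fun τ ↦ ?_
    simp only [realKernel]
    rw [mul_assoc, ← exp_add]
    have := pow_pos (cosh_pos τ) k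
    have key : s * τ ≤ |τ| ^ 3 + |s| ^ (3 / 2 : ℝ) := by
      have h2 : |s| ^ (3 / 2 : ℝ) = √|s| ^ 3 := by
        rw [sqrt_eq_rpow, ← rpow_natCast, ← rpow_mul (abs_nonneg s)]; norm_num
      have h3 : |s| = √|s| ^ 2 := (sq_sqrt (abs_nonneg s)).symm
      have h4 : s * τ ≤ |s| * |τ| := (le_abs_self _).trans_eq (abs_mul _ _)
      rw [h2]
      have h5 := sqrt_nonneg |s|
      have h6 := abs_nonneg τ
      generalize √|s| = r at *
      rw [h3] at h4
      refine h4.trans ?_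
      rcases le_total |τ| r with h | h
      · have : r ^ 2 * |τ| ≤ r ^ 2 * r := by gcongr
        nlinarith [pow_nonneg h6 3]
      · have : r ^ 2 * |τ| ≤ |τ| ^ 2 * |τ| := by gcongr
        nlinarith [pow_nonneg h5 3]
    gcongr
    linarith
  refine h1.trans ?_
  gcongr
  linarith

/-- A lower bound for `K_μ(a)` of order less than two in `μ`. -/
lemma exists_exp_le_norm_moment {a : ℝ} (ha : 1 ≤ a) :
    ∃ C, 0 < C ∧ ∀ μ : ℂ, 1 ≤ μ.re →
      C * exp (-(14 * ‖μ‖ + ‖μ‖ ^ (3 / 2 : ℝ))) ≤ ‖moment 0 μ a‖ := by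
  have ha0 : 0 < a := by linarith
  obtain ⟨M, hM, hM'⟩ := exists_realMoment_le 1 ha0
  refine ⟨min (exp (-(3 + 4 * a))) (exp (-14) / (2 * a * M)), by positivity, ?_⟩
  have main : ∀ μ : ℂ, 1 ≤ μ.re → 0 ≤ μ.im →
      min (exp (-(3 + 4 * a))) (exp (-14) / (2 * a * M)) *
        exp (-(14 * ‖μ‖ + ‖μ‖ ^ (3 / 2 : ℝ))) ≤ ‖moment 0 μ a‖ := by
    intro μ hs ht
    have hn := norm_nonneg μ
    have hn' : 0 ≤ ‖μ‖ ^ (3 / 2 : ℝ) := by positivity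
    have hre : 0 ≤ μ.re := by linarith
    rcases le_total μ.im a with hta | hta
    · refine le_trans ?_ (exp_le_norm_moment_of_abs_im_le hre ha0 (by rwa [abs_of_nonneg ht]))
      refine (mul_le_mul_of_nonneg_right (min_le_left _ _) (exp_pos _).le).trans ?_
      rw [← exp_add]
      exact exp_le_exp.2 (by linarith)
    · set t := μ.im with htdef
      set U : ℝ → ℝ := fun x ↦ x * ((moment 1 μ x).im * (moment 0 μ x).re
        - (moment 1 μ x).re * (moment 0 μ x).im) with hU
      have ht1 : 1 ≤ t := ha.trans hta
      have hanti : AntitoneOn U (Ici a) := by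
        refine antitoneOn_of_deriv_nonpos (convex_Ici a)
          (fun y hy ↦ (hasDerivAt_wronskian μ (ha0.trans_le hy)).continuousAt.continuousWithinAt)
          (fun y hy ↦ (hasDerivAt_wronskian μ
            (ha0.trans_le (interior_subset hy))).differentiableAt.differentiableWithinAt)
          fun y hy ↦ ?_
        have hy0 : 0 < y := ha0.trans_le (interior_subset hy)
        rw [(hasDerivAt_wronskian μ hy0).deriv, neg_nonpos]
        positivity
      have hpos : 0 ≤ U (t + 1) := by
        refine le_of_tendsto (tendsto_wronskian μ) ?_
        filter_upwards [eventually_ge_atTop (t + 1)] with x hx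
        exact hanti (by simp; linarith) (by simp; linarith) hx
      obtain ⟨ξ, hξ, hξ'⟩ := exists_hasDerivAt_eq_slope U
        (fun x ↦ -(2 * μ.re * μ.im * ‖moment 0 μ x‖ ^ 2 / x)) (lt_add_one t)
        (fun y hy ↦ (hasDerivAt_wronskian μ (by linarith [hy.1])).continuousAt.continuousWithinAt)
        (fun y hy ↦ hasDerivAt_wronskian μ (by linarith [hy.1]))
      have hξ0 : 0 < ξ := by linarith [hξ.1]
      have hUt : ‖moment 0 μ ξ‖ ^ 2 ≤ U t := by
        have h1 : U t - U (t + 1) = 2 * μ.re * t * ‖moment 0 μ ξ‖ ^ 2 / ξ := by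
          rw [add_sub_cancel_left, div_one] at hξ'
          linarith
        have h2 : ‖moment 0 μ ξ‖ ^ 2 ≤ 2 * μ.re * t * ‖moment 0 μ ξ‖ ^ 2 / ξ := by
          rw [le_div_iff₀ hξ0]
          have : ξ ≤ 2 * μ.re * t := by nlinarith [hξ.2]
          nlinarith [sq_nonneg ‖moment 0 μ ξ‖]
        linarith
      have hUa : U t ≤ U a := hanti self_mem_Ici hta hta
      have htn : t ≤ ‖μ‖ := (le_abs_self _).trans (Complex.abs_im_le_norm μ)
      have hlow : exp (-(14 + 14 * ‖μ‖)) ≤ ‖moment 0 μ ξ‖ ^ 2 := by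
        have h1 := exp_le_norm_moment_of_abs_im_le hre hξ0
          (by rw [abs_of_nonneg ht]; exact hξ.1.le)
        calc exp (-(14 + 14 * ‖μ‖)) ≤ exp (-(3 + 4 * ξ + 3 * ‖μ‖)) ^ 2 := by
              rw [← exp_nat_mul]
              refine exp_le_exp.2 ?_
              push_cast
              linarith [hξ.2]
          _ ≤ _ := by gcongr
      have hup : U a ≤ 2 * a * (M * exp (‖μ‖ ^ (3 / 2 : ℝ))) * ‖moment 0 μ a‖ := by
        have h1 : ‖moment 1 μ a‖ ≤ M * exp (‖μ‖ ^ (3 / 2 : ℝ)) := by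
          refine (norm_moment_le 1 μ a).trans ((hM' μ.re).trans ?_)
          gcongr
          exact Complex.abs_re_le_norm μ
        have h2 : (moment 1 μ a).im * (moment 0 μ a).re - (moment 1 μ a).re * (moment 0 μ a).im
            ≤ ‖moment 1 μ a‖ * ‖moment 0 μ a‖ + ‖moment 1 μ a‖ * ‖moment 0 μ a‖ := by
          refine (le_abs_self _).trans ((abs_sub _ _).trans ?_)
          rw [abs_mul, abs_mul]
          gcongr
          · exact Complex.abs_im_le_norm _
          · exact Complex.abs_re_le_norm _
          · exact Complex.abs_re_le_norm _
          · exact Complex.abs_im_le_norm _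
        have h3 : ‖moment 1 μ a‖ * ‖moment 0 μ a‖
            ≤ M * exp (‖μ‖ ^ (3 / 2 : ℝ)) * ‖moment 0 μ a‖ := by gcongr
        calc U a ≤ a * (2 * (M * exp (‖μ‖ ^ (3 / 2 : ℝ)) * ‖moment 0 μ a‖)) := by
              simp only [hU]; gcongr; linarith
          _ = _ := by ring
      have htot := hlow.trans (hUt.trans (hUa.trans hup))
      refine (mul_le_mul_of_nonneg_right (min_le_right _ _) (exp_pos _).le).trans ?_
      rw [div_mul_eq_mul_div, div_le_iff₀ (by positivity), ← exp_add]
      calc exp (-14 + -(14 * ‖μ‖ + ‖μ‖ ^ (3 / 2 : ℝ)))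
          = exp (-(14 + 14 * ‖μ‖)) * exp (-‖μ‖ ^ (3 / 2 : ℝ)) := by rw [← exp_add]; ring_nf
        _ ≤ 2 * a * (M * exp (‖μ‖ ^ (3 / 2 : ℝ))) * ‖moment 0 μ a‖ * exp (-‖μ‖ ^ (3 / 2 : ℝ)) := by
            gcongr
        _ = ‖moment 0 μ a‖ * (2 * a * M)
            * (exp (‖μ‖ ^ (3 / 2 : ℝ)) * exp (-‖μ‖ ^ (3 / 2 : ℝ))) := by ring
        _ = _ := by rw [← exp_add]; simp
  intro μ hs
  rcases le_total 0 μ.im with ht | ht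
  · exact main μ hs ht
  · have := main (starRingEnd ℂ μ) (by simpa using hs) (by simpa using ht)
    rwa [norm_moment_conj, RCLike.norm_conj] at this

lemma moment_ne_zero {a : ℝ} (ha : 1 ≤ a) {μ : ℂ} (hμ : 1 ≤ μ.re) : moment 0 μ a ≠ 0 := by
  obtain ⟨C, hC, h⟩ := exists_exp_le_norm_moment ha
  exact norm_pos_iff.1 ((mul_pos hC (exp_pos _)).trans_le (h μ hμ))

lemma realMoment_pos (s : ℝ) {a : ℝ} (ha : 1 ≤ a) : 0 < realMoment 0 s a := by
  have : 0 < realMoment 0 |s| a :=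
    (div_pos (exp_pos _) (by linarith)).trans_le (le_realMoment_zero (abs_nonneg s) ha)
  rcases abs_choice s with h | h
  · rwa [h] at this
  · rw [h] at this
    have e := moment_neg 0 (s : ℂ) a
    rw [← Complex.ofReal_neg, moment_ofReal, moment_ofReal] at e
    rwa [Complex.ofReal_injective e] at this

lemma realMoment_le_two_mul {s r a : ℝ} (ha : 0 < a) (hs : |s| ≤ r) :
    realMoment 0 s a ≤ 2 * realMoment 0 r a := by
  have e : realMoment 0 (-r) a = realMoment 0 r a := by
    have e := moment_neg 0 (r : ℂ) a
    rw [← Complex.ofReal_neg, moment_ofReal, moment_ofReal] at e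
    exact Complex.ofReal_injective e
  have h2 : 2 * realMoment 0 r a = ∫ τ, (realKernel 0 r a τ + realKernel 0 (-r) a τ) := by
    rw [integral_add (integrable_realKernel 0 r ha) (integrable_realKernel 0 (-r) ha)]
    rw [two_mul]; nth_rewrite 2 [← e]; rfl
  rw [h2]
  refine integral_mono (integrable_realKernel 0 s ha)
    ((integrable_realKernel 0 r ha).add (integrable_realKernel 0 (-r) ha)) fun τ ↦ ?_
  have p1 := realKernel_pos 0 r a τ
  have p2 := realKernel_pos 0 (-r) a τ
  obtain ⟨h3, h4⟩ := abs_le.1 hs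
  rcases le_total 0 τ with h | h
  · have : realKernel 0 s a τ ≤ realKernel 0 r a τ := by
      simp only [realKernel, pow_zero, one_mul]
      gcongr
    linarith
  · have : realKernel 0 s a τ ≤ realKernel 0 (-r) a τ := by
      simp only [realKernel, pow_zero, one_mul]
      refine exp_le_exp.2 ?_
      nlinarith
    linarith

/-- `K_{μ - c}(a) / K_{μ + c}(a)`. -/
noncomputable def quotient (a c : ℝ) (μ : ℂ) : ℂ := moment 0 (μ - c) a / moment 0 (μ + c) a

lemma differentiableAt_quotient {a c : ℝ} (ha : 1 ≤ a) (hc : 1 ≤ c) {μ : ℂ} (hμ : 0 ≤ μ.re) :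
    DifferentiableAt ℂ (quotient a c) μ := by
  have hd := differentiable_moment_zero (x := a) (by linarith)
  exact (hd.comp (differentiable_id.sub_const (c : ℂ)) μ).div
    (hd.comp (differentiable_id.add_const (c : ℂ)) μ) (moment_ne_zero ha (by simp; linarith))

lemma norm_quotient_mul_I (a c t : ℝ) :
    ‖quotient a c (t * Complex.I)‖ ≤ 1 := by
  have : moment 0 (t * Complex.I - c) a
      = starRingEnd ℂ (moment 0 (t * Complex.I + c) a) := by
    rw [← moment_conj, ← moment_neg]
    congr 1
    simp [neg_add_eq_sub]
  rw [quotient, norm_div, this, RCLike.norm_conj]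
  exact div_self_le_one _

lemma isBigO_quotient {a c : ℝ} (ha : 1 ≤ a) (hc : 1 ≤ c) :
    quotient a c =O[Bornology.cobounded ℂ ⊓ 𝓟 {z | 0 < z.re}]
      fun z ↦ exp (36 * ‖z‖ ^ (3 / 2 : ℝ)) := by
  obtain ⟨C, hC, hlow⟩ := exists_exp_le_norm_moment ha
  obtain ⟨M, hM, hup⟩ := exists_realMoment_le 0 (x := a) (by linarith)
  refine Asymptotics.IsBigO.of_bound (M / C) ?_
  rw [eventually_inf_principal]
  filter_upwards [eventually_cobounded_le_norm c] with z hz hz0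
  have hz0 : 0 < z.re := hz0
  have hz1 : 1 ≤ ‖z‖ := hc.trans hz
  have hcn : ‖(c : ℂ)‖ ≤ ‖z‖ := by rwa [Complex.norm_real, norm_of_nonneg (by linarith)]
  have h1 : ‖z - c‖ ≤ 2 * ‖z‖ := (norm_sub_le _ _).trans (by linarith)
  have h2 : ‖z + c‖ ≤ 2 * ‖z‖ := (norm_add_le _ _).trans (by linarith)
  have h3 : (2 * ‖z‖) ^ (3 / 2 : ℝ) ≤ 4 * ‖z‖ ^ (3 / 2 : ℝ) := by
    rw [mul_rpow (by norm_num) (norm_nonneg z)]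
    gcongr
    calc (2 : ℝ) ^ (3 / 2 : ℝ) ≤ 2 ^ (2 : ℝ) := by
          apply rpow_le_rpow_of_exponent_le <;> norm_num
      _ = 4 := by norm_num
  have h4 : ‖z‖ ≤ ‖z‖ ^ (3 / 2 : ℝ) := by
    calc ‖z‖ = ‖z‖ ^ (1 : ℝ) := (rpow_one _).symm
      _ ≤ _ := rpow_le_rpow_of_exponent_le hz1 (by norm_num)
  have hnum : ‖moment 0 (z - c) a‖ ≤ M * exp (4 * ‖z‖ ^ (3 / 2 : ℝ)) := by
    refine (norm_moment_le _ _ _).trans ((hup _).trans ?_)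
    gcongr
    refine le_trans ?_ h3
    gcongr
    exact (Complex.abs_re_le_norm _).trans h1
  have hden : C * exp (-(32 * ‖z‖ ^ (3 / 2 : ℝ))) ≤ ‖moment 0 (z + c) a‖ := by
    refine le_trans ?_ (hlow (z + c) (by simp; linarith))
    gcongr
    have : ‖z + c‖ ^ (3 / 2 : ℝ) ≤ (2 * ‖z‖) ^ (3 / 2 : ℝ) := by gcongr
    linarith
  rw [quotient, norm_div, norm_of_nonneg (exp_pos _).le]
  refine (div_le_div₀ (by positivity) hnum (by positivity) hden).trans_eq ?_
  rw [exp_neg, show 36 * ‖z‖ ^ (3 / 2 : ℝ) = 4 * ‖z‖ ^ (3 / 2 : ℝ) + 32 * ‖z‖ ^ (3 / 2 : ℝ) by ring,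
    exp_add]
  field_simp

lemma quotient_ofReal (a c s : ℝ) :
    quotient a c s = ((realMoment 0 (s - c) a / realMoment 0 (s + c) a : ℝ) : ℂ) := by
  rw [quotient, ← Complex.ofReal_sub, ← Complex.ofReal_add, moment_ofReal, moment_ofReal,
    Complex.ofReal_div]

lemma norm_quotient_le_one {a c : ℝ} (ha : 1 ≤ a) (hc : 1 ≤ c) {μ : ℂ} (hμ : 0 ≤ μ.re) :
    ‖quotient a c μ‖ ≤ 1 := by
  refine PhragmenLindelof.right_half_plane_of_bounded_on_real ?_
    ⟨3 / 2, by norm_num, 36, isBigO_quotient ha hc⟩ ?_ (norm_quotient_mul_I a c) hμ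
  · refine DifferentiableOn.diffContOnCl fun z hz ↦ ?_
    rw [Complex.closure_setOfPred_lt_re] at hz
    exact (differentiableAt_quotient ha hc hz).differentiableWithinAt
  · refine isBoundedUnder_of_eventually_le (a := 2) ?_
    filter_upwards [eventually_ge_atTop 0] with s hs
    rw [quotient_ofReal, Complex.norm_real, norm_of_nonneg
      (div_pos (realMoment_pos _ ha) (realMoment_pos _ ha)).le, div_le_iff₀ (realMoment_pos _ ha)]
    exact realMoment_le_two_mul (by linarith) (abs_le.2 ⟨by linarith, by linarith⟩)

lemma moment_add_moment_ne_zero {a c : ℝ} (ha : 1 ≤ a) (hc : 1 ≤ c) {μ : ℂ} (hμ : 0 < μ.re) :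
    moment 0 (μ + c) a + moment 0 (μ - c) a ≠ 0 := by
  intro h
  have hne : moment 0 (μ + c) a ≠ 0 := moment_ne_zero ha (by simp; linarith)
  have hq : quotient a c μ = -1 := by
    rw [quotient, div_eq_iff hne]
    linear_combination h
  have hmax : IsMaxOn (norm ∘ quotient a c) {z | 0 < z.re} μ := fun z hz ↦ by
    simpa [hq] using norm_quotient_le_one ha hc (le_of_lt hz)
  have := Complex.eqOn_of_isPreconnected_of_isMaxOn_norm
    (convex_halfSpace_re_gt 0).isPreconnected (isOpen_lt continuous_const Complex.continuous_re)
    (fun z hz ↦ (differentiableAt_quotient ha hc (le_of_lt hz)).differentiableWithinAt) hμ hmax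
  have h1 := this (show ((1 : ℝ) : ℂ) ∈ {z : ℂ | 0 < z.re} by simp)
  rw [Function.const_apply, hq, quotient_ofReal] at h1
  have h2 : realMoment 0 (1 - c) a / realMoment 0 (1 + c) a = -1 := by exact_mod_cast h1
  linarith [div_pos (realMoment_pos (1 - c) ha) (realMoment_pos (1 + c) ha)]

lemma re_eq_zero_of_moment_add_moment_eq_zero {a c : ℝ} (ha : 1 ≤ a) (hc : 1 ≤ c) {μ : ℂ}
    (h : moment 0 (μ + c) a + moment 0 (μ - c) a = 0) : μ.re = 0 := by
  rcases lt_trichotomy μ.re 0 with h1 | h1 | h1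
  · refine absurd ?_ (moment_add_moment_ne_zero ha hc (μ := -μ) (by simpa using h1))
    rw [← h, ← moment_neg 0 (-μ + c), ← moment_neg 0 (-μ - c), add_comm]
    congr 2 <;> ring
  · exact h1
  · exact absurd h (moment_add_moment_ne_zero ha hc h1)

lemma moment_add_moment_eq_integral {a : ℝ} (ha : 0 < a) (c : ℝ) (z : ℂ) :
    moment 0 (Complex.I * z / 2 + c) a + moment 0 (Complex.I * z / 2 - c) a
      = 8 * ∫ u in Ioi (0 : ℝ), ((cosh (2 * c * u) * exp (-a * cosh (2 * u)) : ℝ) : ℂ) *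
          Complex.cos ((u : ℂ) * z) := by
  set μ := Complex.I * z / 2 with hμ
  set f : ℝ → ℂ := fun τ ↦ kernel 0 (μ + c) a τ + kernel 0 (μ - c) a τ with hf
  have hi : Integrable f := (integrable_kernel 0 _ ha).add (integrable_kernel 0 _ ha)
  have h1 : moment 0 (μ + c) a + moment 0 (μ - c) a = ∫ τ, f τ :=
    (integral_add (integrable_kernel 0 _ ha) (integrable_kernel 0 _ ha)).symm
  have h2 : ∫ τ, f τ = ∫ τ in Ioi (0 : ℝ), (f τ + f (-τ)) := by
    rw [← intervalIntegral.integral_Iic_add_Ioi hi.integrableOn hi.integrableOn (b := 0),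
      integral_add hi.integrableOn hi.comp_neg.integrableOn, integral_comp_neg_Ioi, neg_zero,
      add_comm]
  have h3 := integral_comp_mul_left_Ioi (fun τ ↦ f τ + f (-τ)) 0 (two_pos (α := ℝ))
  rw [mul_zero] at h3
  have h4 : ∀ u : ℝ, f (2 * u) + f (-(2 * u))
      = 4 * (((cosh (2 * c * u) * exp (-a * cosh (2 * u)) : ℝ) : ℂ)
        * Complex.cos ((u : ℂ) * z)) := by
    intro u
    simp only [hf, kernel, pow_zero, Complex.ofReal_one, one_mul, cosh_neg, hμ]
    rw [Complex.cos]
    push_cast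
    rw [show Complex.cosh (2 * c * u)
      = (Complex.exp (2 * c * u) + Complex.exp (-(2 * c * u))) / 2 from rfl]
    generalize Complex.cosh (2 * u) = w
    have e (p q : ℂ) (σ ρ : ℂ) (h : p = σ + ρ) :
        Complex.exp (p - q) = Complex.exp σ * Complex.exp ρ * Complex.exp (-q) := by
      rw [← Complex.exp_add, ← Complex.exp_add, h, sub_eq_add_neg]
    rw [e _ _ (u * z * Complex.I) (2 * c * u) (by ring),
      e _ _ (u * z * Complex.I) (-(2 * c * u)) (by ring),
      e _ _ (-(u * z) * Complex.I) (-(2 * c * u)) (by ring),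
      e _ _ (-(u * z) * Complex.I) (2 * c * u) (by ring), neg_mul (a : ℂ)]
    ring
  simp only [h4] at h3
  rw [integral_const_mul] at h3
  rw [h1, h2]
  rw [Complex.real_smul] at h3
  rw [Complex.ofReal_inv, Complex.ofReal_ofNat] at h3
  linear_combination (-2) * h3

end Macdonald

/-- Pólya's theorem: every zero of
`Ξ*(z) = 4π²∫_0^∞ cosh(9u/2)·e^{−2π·cosh(2u)}·cos(uz) du` is real. -/
theorem polya_Xi_star_zeros_real (z : ℂ)
    (hz : (4 * (π : ℂ) ^ 2 * ∫ u in Set.Ioi (0 : ℝ),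
        ((Real.cosh (9 * u / 2) * Real.exp (-2 * π * Real.cosh (2 * u)) : ℝ) : ℂ) *
          Complex.cos ((u : ℂ) * z)) = 0) :
    z.im = 0 := by
  have hπ : (4 * (π : ℂ) ^ 2) ≠ 0 := by simp [pi_ne_zero]
  have h := Macdonald.moment_add_moment_eq_integral two_pi_pos (9 / 4) z
  have hI := (mul_eq_zero.1 hz).resolve_left hπ
  have e : ∀ u : ℝ, 2 * (9 / 4) * u = 9 * u / 2 := fun u ↦ by ring
  simp only [e, ← neg_mul] at h
  rw [hI, mul_zero] at h
  have := Macdonald.re_eq_zero_of_moment_add_moment_eq_zero (by linarith [pi_gt_three])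
    (by norm_num) h
  simpa using this
end

section
/- Let U ⊆ ℂ be an open connected set, let (f_n) be a sequence of holomorphic functions on U converging locally uniformly on U to a function f that is not identically zero on U, and let z₀ ∈ U satisfy f(z₀) = 0. Then for every neighborhood V of z₀ with V ⊆ U, for all sufficiently large n the function f_n has a zero in V. -/
open Filter Set

/-- A function holomorphic on a disc whose norm at the center is smaller than a lower bound for
its norm on the boundary circle has a zero in the closed disc. -/
lemma DiffContOnCl.exists_mem_closedBall_eq_zero {f : ℂ → ℂ} {c : ℂ} {r m : ℝ}
    (hf : DiffContOnCl ℂ f (Metric.ball c r)) (hr : 0 < r) (hm : 0 < m)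
    (hsphere : ∀ z ∈ Metric.sphere c r, m ≤ ‖f z‖) (hc : ‖f c‖ < m) :
    ∃ z ∈ Metric.closedBall c r, f z = 0 := by
  by_contra! hne
  have hinv : DiffContOnCl ℂ f⁻¹ (Metric.ball c r) :=
    hf.inv fun z hz => hne z (by rwa [closure_ball c hr.ne'] at hz)
  have hle : ‖f⁻¹ c‖ ≤ m⁻¹ := by
    refine Complex.norm_le_of_forall_mem_frontier_norm_le Metric.isBounded_ball hinv
      (fun z hz => ?_) (subset_closure (Metric.mem_ball_self hr))
    rw [frontier_ball c hr.ne'] at hz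
    rw [Pi.inv_apply, norm_inv]
    exact inv_anti₀ hm (hsphere z hz)
  rw [Pi.inv_apply, norm_inv] at hle
  have hpos : 0 < ‖f c‖ := norm_pos_iff.2 (hne c (Metric.mem_closedBall_self hr.le))
  exact hc.not_ge ((inv_le_inv₀ hpos hm).1 hle)

/-- Hurwitz's theorem: if holomorphic functions `f n` on an open connected set `U` converge
locally uniformly to `g`, which is not identically zero on `U`, and `g z₀ = 0` for some `z₀ ∈ U`,
then for every neighborhood `V ⊆ U` of `z₀`, for all sufficiently large `n` the function `f n`
has a zero in `V`. -/
theorem hurwitz_zeros_of_locally_uniform_limit (U : Set ℂ) (hU : IsOpen U) (hconn : IsConnected U)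
    (f : ℕ → ℂ → ℂ) (g : ℂ → ℂ) (hf : ∀ n, DifferentiableOn ℂ (f n) U)
    (hconv : TendstoLocallyUniformlyOn f g Filter.atTop U)
    (hg : ¬ ∀ z ∈ U, g z = 0) (z₀ : ℂ) (hz₀ : z₀ ∈ U) (hgz₀ : g z₀ = 0) :
    ∀ V ∈ nhds z₀, V ⊆ U → ∀ᶠ n in Filter.atTop, ∃ z ∈ V, f n z = 0 := by
  intro V hV hVU
  have hgd : DifferentiableOn ℂ g U := hconv.differentiableOn (Eventually.of_forall hf) hU
  have hga : AnalyticOnNhd ℂ g U := hgd.analyticOnNhd hU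
  have hisol : ∀ᶠ z in nhdsWithin z₀ {z₀}ᶜ, g z ≠ 0 :=
    (hga z₀ hz₀).eventually_eq_zero_or_eventually_ne_zero.resolve_left fun h =>
      hg (hga.eqOn_zero_of_preconnected_of_eventuallyEq_zero hconn.isPreconnected hz₀ h)
  rw [eventually_nhdsWithin_iff] at hisol
  obtain ⟨r, hr, hball⟩ := Metric.nhds_basis_closedBall.mem_iff.1 (inter_mem hV hisol)
  have hBV : Metric.closedBall z₀ r ⊆ V := fun z hz => (hball hz).1
  have hBU := hBV.trans hVU
  obtain ⟨w, hw, hmin⟩ := (isCompact_sphere z₀ r).exists_isMinOn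
    (NormedSpace.sphere_nonempty.2 hr.le)
    (hgd.continuousOn.mono (Metric.sphere_subset_closedBall.trans hBU)).norm
  have hgw : 0 < ‖g w‖ := norm_pos_iff.2
    ((hball (Metric.sphere_subset_closedBall hw)).2 (Metric.ne_of_mem_sphere hw hr.ne'))
  have hunif := (tendstoLocallyUniformlyOn_iff_forall_isCompact hU).1 hconv _ hBU
    (isCompact_closedBall z₀ r)
  filter_upwards [Metric.tendstoUniformlyOn_iff.1 hunif (‖g w‖ / 2) (half_pos hgw)] with n hn
  have hdiff : DiffContOnCl ℂ (f n) (Metric.ball z₀ r) :=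
    ((hf n).mono (by rwa [closure_ball z₀ hr.ne'])).diffContOnCl
  have hsphere : ∀ z ∈ Metric.sphere z₀ r, ‖g w‖ / 2 ≤ ‖f n z‖ := fun z hz => by
    have hclose := hn z (Metric.sphere_subset_closedBall hz)
    have hgz : ‖g w‖ ≤ ‖g z‖ := hmin hz
    rw [dist_eq_norm] at hclose
    linarith [norm_sub_norm_le (g z) (f n z)]
  have hcenter : ‖f n z₀‖ < ‖g w‖ / 2 := by
    simpa [hgz₀] using hn z₀ (Metric.mem_closedBall_self hr.le)
  obtain ⟨z, hz, hfz⟩ := hdiff.exists_mem_closedBall_eq_zero hr (half_pos hgw) hsphere hcenter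
  exact ⟨z, hBV hz, hfz⟩
end
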